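/- Let P₁, P₂ : ℝ → ℝ be linearly independent polynomials with P₁(0) = P₂(0) = 0. Fix constants C₁ > 0, C₂ > 0, B > 0 and β with 8/9 < β ≤ 1. Then there exists ε₀ > 0, depending only on P₁, P₂, C₁, C₂, B and β, such that the following holds: for every α with 0 < α < 1 and α > 1 − ε₀, and every closed set E ⊆ [0,1] which supports a Borel probability measure μ satisfying (A) μ([x, x+ε]) ≤ C₁·ε^α for all x ∈ ℝ and all 0 < ε ≤ 1, and (B) |μ̂(k)| ≤ C₂·(1−α)^{−B}·|k|^{−β/2} for all k ∈ ℤ \ {0}, there exist x ∈ E and t > 0 with x + P₁(t) ∈ E and x + P₂(t) ∈ E. -/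

import Mathlib

open MeasureTheory Polynomial

/-- Bounded and Lipschitz with the same constant. -/
def BddLip (A : ℝ) (f : ℝ → ℝ) : Prop :=
  (∀ t, |f t| ≤ A) ∧ ∀ t s, |f t - f s| ≤ A * |t - s|

namespace BddLip

variable {A A' : ℝ} {f g : ℝ → ℝ}

lemma nonneg (hf : BddLip A f) : 0 ≤ A := (abs_nonneg _).trans (hf.1 0)

lemma lipschitzWith (hf : BddLip A f) : LipschitzWith (Real.toNNReal A) f :=
  LipschitzWith.of_dist_le_mul fun x y => by
    simpa [Real.dist_eq, Real.coe_toNNReal _ hf.nonneg] using hf.2 x y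

lemma continuous (hf : BddLip A f) : Continuous f := hf.lipschitzWith.continuous

lemma mono (hf : BddLip A f) (h : A ≤ A') : BddLip A' f :=
  ⟨fun t => (hf.1 t).trans h, fun t s => (hf.2 t s).trans (by gcongr)⟩

lemma mul (hf : BddLip A f) (hg : BddLip A' g) : BddLip (2 * A * A') fun t => f t * g t := by
  have h1 := hf.nonneg
  have h2 := hg.nonneg
  refine ⟨fun t => ?_, fun t s => ?_⟩
  · rw [abs_mul]
    calc |f t| * |g t| ≤ A * A' := by gcongr; exacts [hf.1 t, hg.1 t]
      _ ≤ 2 * A * A' := by nlinarith [mul_nonneg h1 h2]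
  · calc |f t * g t - f s * g s| = |f t * (g t - g s) + (f t - f s) * g s| := by ring_nf
      _ ≤ |f t| * |g t - g s| + |f t - f s| * |g s| := by
        rw [← abs_mul, ← abs_mul]; exact abs_add_le _ _
      _ ≤ A * (A' * |t - s|) + (A * |t - s|) * A' := by
        gcongr
        exacts [hf.1 t, hg.2 t s, hf.2 t s, hg.1 s]
      _ = _ := by ring

lemma abs (hf : BddLip A f) : BddLip A fun t => |f t| :=
  ⟨fun t => by simpa using hf.1 t, fun t s => (abs_abs_sub_abs_le _ _).trans (hf.2 t s)⟩

lemma comp_add_const (hf : BddLip A f) (c : ℝ) : BddLip A fun t => f (t + c) :=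
  ⟨fun t => hf.1 _, fun t s => by simpa using hf.2 (t + c) (s + c)⟩

/-- Composition of a compactly supported Lipschitz weight at scale `H` with `u * f`. -/
lemma comp_mul {w : ℝ → ℝ} {H a : ℝ} (hH : 0 < H) (ha : 0 ≤ a) (hw0 : ∀ k, H < |k| → w k = 0)
    (hw1 : ∀ k, |w k| ≤ a / H) (hw2 : ∀ k l, |w k - w l| ≤ a / H ^ 2 * |k - l|)
    (hf : BddLip A f) (hA : 0 < A) (h : ∀ t, 1 / A ≤ |f t|) (u : ℝ) :
    BddLip (a / H * (1 + A ^ 2)) fun t => w (u * f t) := by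
  have h0 : 0 ≤ a / H := by positivity
  refine ⟨fun t => (hw1 _).trans ?_, fun t s => ?_⟩
  · have : 0 ≤ a / H * A ^ 2 := by positivity
    linarith
  by_cases hu : A * H < |u|
  · have key : ∀ t, w (u * f t) = 0 := fun t => hw0 _ <| by
      rw [abs_mul]
      calc H = (A * H) * (1 / A) := by field_simp
        _ < |u| * (1 / A) := by gcongr
        _ ≤ _ := by gcongr; exact h t
    simp only [key, sub_self, abs_zero]
    positivity
  · push Not at hu
    calc |w (u * f t) - w (u * f s)| ≤ a / H ^ 2 * |u * f t - u * f s| := hw2 _ _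
      _ = a / H ^ 2 * (|u| * |f t - f s|) := by rw [← mul_sub, abs_mul]
      _ ≤ a / H ^ 2 * ((A * H) * (A * |t - s|)) := by gcongr; exact hf.2 t s
      _ = a / H * A ^ 2 * |t - s| := by field_simp
      _ ≤ _ := by gcongr; linarith

end BddLip

/-- Non-stationary phase bound with Lipschitz amplitude. -/
lemma abs_integral_comp_mul_le {d D θ θ' Ω : ℝ → ℝ} {a b η lam A c : ℝ} (hab : a ≤ b)
    (hD : ∀ x, HasDerivAt D (d x) x) (hDη : ∀ x, |D x| ≤ η)
    (hd1 : ∀ x, |d x| ≤ 1)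
    (hθ : ∀ t ∈ Set.Icc a b, HasDerivAt θ (θ' t) t) (hlam : 0 < lam)
    (hθl : ∀ t ∈ Set.Icc a b, lam ≤ |θ' t|)
    (hθL : ∀ t ∈ Set.Icc a b, ∀ s ∈ Set.Icc a b, |θ' t - θ' s| ≤ c * lam * |t - s|)
    (hΩ : BddLip A Ω) (hc : 0 ≤ c) :
    |∫ t in a..b, Ω t * d (θ t)| ≤ η * A / lam * (2 + (1 + c) * (b - a)) := by
  have hA := hΩ.nonneg
  have hη : 0 ≤ η := (abs_nonneg _).trans (hDη 0)
  set f : ℝ → ℝ := fun t => Ω t / θ' t with hf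
  set g : ℝ → ℝ := fun t => D (θ t) with hg
  have hne : ∀ t ∈ Set.Icc a b, θ' t ≠ 0 := fun t ht h0 => by
    have := hθl t ht; rw [h0, abs_zero] at this; linarith
  have hfb : ∀ t ∈ Set.Icc a b, |f t| ≤ A / lam := fun t ht => by
    rw [hf, abs_div]; exact div_le_div₀ hA (hΩ.1 t) hlam (hθl t ht)
  have hfL : ∀ t ∈ Set.Icc a b, ∀ s ∈ Set.Icc a b, |f t - f s| ≤ A / lam * (1 + c) * |t - s| := by
    intro t ht s hs
    have e : f t - f s = (Ω t - Ω s) / θ' t + Ω s * (θ' s - θ' t) / (θ' t * θ' s) := by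
      have := hne t ht; have := hne s hs; simp only [hf]; field_simp; ring
    rw [e]
    refine (abs_add_le _ _).trans ?_
    have e1 : |(Ω t - Ω s) / θ' t| ≤ A * |t - s| / lam := by
      rw [abs_div]; exact div_le_div₀ (by positivity) (hΩ.2 t s) hlam (hθl t ht)
    have e2 : |Ω s * (θ' s - θ' t) / (θ' t * θ' s)| ≤ A * (c * lam * |t - s|) / (lam * lam) := by
      rw [abs_div, abs_mul, abs_mul]
      refine div_le_div₀ (by positivity) ?_ (by positivity) ?_
      · have := hθL s hs t ht
        rw [abs_sub_comm s t] at this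
        exact mul_le_mul (hΩ.1 s) this (abs_nonneg _) hA
      · exact mul_le_mul (hθl t ht) (hθl s hs) hlam.le (abs_nonneg _)
    refine (add_le_add e1 e2).trans (le_of_eq ?_)
    field_simp
  set Kf : NNReal := ⟨A / lam * (1 + c), by positivity⟩
  have hfLip : LipschitzOnWith Kf f (Set.uIcc a b) := by
    rw [Set.uIcc_of_le hab]
    refine LipschitzOnWith.of_dist_le_mul fun x hx y hy => ?_
    exact hfL x hx y hy
  have hfac := hfLip.absolutelyContinuousOnInterval
  have hgac : AbsolutelyContinuousOnInterval g a b := by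
    have hDL : LipschitzWith 1 D := by
      refine lipschitzWith_of_nnnorm_deriv_le (fun x => (hD x).differentiableAt) fun x => ?_
      rw [(hD x).deriv]; exact_mod_cast hd1 x
    obtain ⟨Mθ, hMθ⟩ : ∃ M : NNReal, ∀ t ∈ Set.Icc a b, ‖θ' t‖ ≤ M := by
      refine ⟨⟨|θ' a| + c * lam * (b - a), ?_⟩, fun t ht => ?_⟩
      · have : 0 ≤ b - a := by linarith
        positivity
      · have h1 := hθL t ht a ⟨le_rfl, hab⟩
        have h2 : |t - a| ≤ b - a := by rw [abs_of_nonneg] <;> linarith [ht.1, ht.2]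
        have h3 : |θ' t| ≤ |θ' t - θ' a| + |θ' a| := by
          simpa using abs_add_le (θ' t - θ' a) (θ' a)
        show |θ' t| ≤ |θ' a| + c * lam * (b - a)
        have : c * lam * |t - a| ≤ c * lam * (b - a) := by gcongr
        linarith
    have hθLip : LipschitzOnWith Mθ θ (Set.Icc a b) :=
      (convex_Icc a b).lipschitzOnWith_of_nnnorm_hasDerivWithin_le
        (fun x hx => (hθ x hx).hasDerivWithinAt) fun x hx => by exact_mod_cast hMθ x hx
    have := (hDL.comp_lipschitzOnWith hθLip)
    rw [← Set.uIcc_of_le hab] at this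
    exact this.absolutelyContinuousOnInterval
  have hderg : ∀ t ∈ Set.Icc a b, deriv g t = d (θ t) * θ' t := fun t ht =>
    ((hD (θ t)).comp t (hθ t ht)).deriv
  have ibp := hfac.integral_mul_deriv_eq_deriv_mul hgac
  have e1 : ∫ t in a..b, Ω t * d (θ t) = ∫ t in a..b, f t * deriv g t := by
    refine intervalIntegral.integral_congr fun t ht => ?_
    rw [Set.uIcc_of_le hab] at ht
    simp only [hderg t ht, hf]
    have := hne t ht
    field_simp
  rw [e1, ibp]
  have hI : |∫ t in a..b, deriv f t * g t| ≤ (A / lam * (1 + c) * η) * (b - a) := by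
    have := intervalIntegral.norm_integral_le_of_norm_le_const_ae
      (a := a) (b := b) (C := A / lam * (1 + c) * η) (f := fun t => deriv f t * g t) ?_
    · rwa [abs_of_nonneg (by linarith : (0 : ℝ) ≤ b - a)] at this
    · have hb : ∀ᵐ x : ℝ, x ≠ b := by simp [ae_iff]
      filter_upwards [hb] with t htb ht
      rw [Set.uIoc_of_le hab] at ht
      have hn : Set.Icc a b ∈ nhds t := Icc_mem_nhds ht.1 (lt_of_le_of_ne ht.2 htb)
      rw [norm_mul]
      refine mul_le_mul ?_ (hDη _) (abs_nonneg _) (by positivity)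
      rw [← Set.uIcc_of_le hab] at hn
      exact norm_deriv_le_of_lipschitzOn hn hfLip
  have hB : ∀ t ∈ Set.Icc a b, |f t * g t| ≤ A / lam * η := fun t ht => by
    rw [abs_mul]; exact mul_le_mul (hfb t ht) (hDη _) (abs_nonneg _) (by positivity)
  have h1 := hB b ⟨hab, le_rfl⟩
  have h2 := hB a ⟨le_rfl, hab⟩
  calc _ ≤ |f b * g b| + |f a * g a| + |∫ t in a..b, deriv f t * g t| :=
        (abs_sub _ _).trans (add_le_add (abs_sub _ _) le_rfl)
    _ ≤ A / lam * η + A / lam * η + (A / lam * (1 + c) * η) * (b - a) := by gcongr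
    _ = _ := by field_simp; ring

/-- Cauchy–Schwarz against a bounded weight on a set of finite measure. -/
lemma sq_integral_mul_le {g h : ℝ × ℝ → ℝ} {S : Set (ℝ × ℝ)} {V : ℝ} (hg : Continuous g)
    (hh : Continuous h) (hS : IsCompact S) (hg1 : ∀ x, |g x| ≤ 1) (hhS : ∀ x, x ∉ S → h x = 0)
    (hV : volume.real S ≤ V) (hV0 : 0 < V) :
    (∫ x, g x * h x) ^ 2 ≤ V * ∫ x, h x * h x := by
  have e1 : ∫ x, g x * h x = ∫ x in S, g x * h x :=
    (setIntegral_eq_integral_of_forall_compl_eq_zero fun x hx => by rw [hhS x hx, mul_zero]).symm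
  have e2 : ∫ x, h x * h x = ∫ x in S, h x * h x :=
    (setIntegral_eq_integral_of_forall_compl_eq_zero fun x hx => by rw [hhS x hx, mul_zero]).symm
  rw [e1, e2]
  have i1 : IntegrableOn (fun x => g x * h x) S :=
    (hg.mul hh).continuousOn.integrableOn_compact hS
  have i2 : IntegrableOn (fun x => h x * h x) S :=
    (hh.mul hh).continuousOn.integrableOn_compact hS
  have i3 : IntegrableOn (fun x => g x * g x) S :=
    (hg.mul hg).continuousOn.integrableOn_compact hS
  set I := ∫ x in S, g x * h x
  set J := ∫ x in S, h x * h x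
  have hG : ∫ x in S, g x * g x ≤ V := by
    refine le_trans ?_ hV
    have : ∀ x ∈ S, ‖g x * g x‖ ≤ 1 := fun x _ => by
      rw [norm_mul]
      exact mul_le_one₀ (hg1 x) (abs_nonneg _) (hg1 x)
    have := norm_setIntegral_le_of_norm_le_const (μ := volume) hS.measure_lt_top this
    rw [one_mul] at this
    exact (le_abs_self _).trans this
  have h0 : 0 ≤ ∫ x in S, (h x - I / V * g x) ^ 2 := integral_nonneg fun x => sq_nonneg _
  have e3 : ∫ x in S, (h x - I / V * g x) ^ 2
      = J - 2 * (I / V) * I + (I / V) ^ 2 * ∫ x in S, g x * g x := by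
    rw [← integral_const_mul, ← integral_const_mul, ← integral_sub i2 (i1.const_mul _),
      ← integral_add (f := fun x => h x * h x - 2 * (I / V) * (g x * h x))
        (i2.sub (i1.const_mul _)) (i3.const_mul _)]
    refine integral_congr_ae (Filter.Eventually.of_forall fun x => ?_)
    simp only; ring
  rw [e3] at h0
  have : (I / V) ^ 2 * ∫ x in S, g x * g x ≤ (I / V) ^ 2 * V := by gcongr
  have h2 : J - 2 * (I / V) * I + (I / V) ^ 2 * V = J - I ^ 2 / V := by field_simp; ring
  have h3 : I ^ 2 / V ≤ J := by linarith
  rw [div_le_iff₀ hV0] at h3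
  linarith

lemma continuous_integral_of_compactSupport {Ξ : ℝ × ℝ → ℝ → ℝ}
    (hc : Continuous (Function.uncurry Ξ)) (hs : HasCompactSupport (Function.uncurry Ξ)) :
    Continuous fun x => ∫ y, Ξ x y := by
  set K := Prod.snd '' tsupport (Function.uncurry Ξ)
  have hK : IsCompact K := hs.isCompact.image continuous_snd
  have : (fun x => ∫ y, Ξ x y) = fun x => ∫ y in K, Ξ x y := by
    ext x
    refine (setIntegral_eq_integral_of_forall_compl_eq_zero fun y hy => ?_).symm
    by_contra h
    exact hy ⟨(x, y), subset_tsupport _ h, rfl⟩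
  rw [this]
  exact continuous_parametric_integral_of_continuous hc hK

/-- Cauchy–Schwarz, with the square of the inner integral expanded. -/
lemma sq_integral_integral_le {g : ℝ × ℝ → ℝ} {Ξ : ℝ × ℝ → ℝ → ℝ} {S : Set (ℝ × ℝ)} {V : ℝ}
    (hg : Continuous g) (hg1 : ∀ x, |g x| ≤ 1)
    (hc : Continuous (Function.uncurry Ξ)) (hs : HasCompactSupport (Function.uncurry Ξ))
    (hS : IsCompact S) (hΞS : ∀ x y, x ∉ S → Ξ x y = 0)
    (hV : volume.real S ≤ V) (hV0 : 0 < V) :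
    (∫ x, g x * ∫ y, Ξ x y) ^ 2 ≤ V * ∫ y, ∫ y', ∫ x, Ξ x y * Ξ x y' := by
  have hh := continuous_integral_of_compactSupport hc hs
  have h1 := sq_integral_mul_le hg hh hS hg1 (fun x hx => by simp [hΞS x _ hx]) hV hV0
  refine h1.trans (le_of_eq ?_)
  congr 1
  have e1 : ∀ x, (∫ y, Ξ x y) * (∫ y, Ξ x y) = ∫ y, Ξ x y * ∫ y', Ξ x y' := fun x => by
    rw [integral_mul_const]
  simp_rw [e1]
  rw [integral_integral_swap_of_hasCompactSupport (f := fun x y => Ξ x y * ∫ y', Ξ x y')]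
  · refine integral_congr_ae (Filter.Eventually.of_forall fun y => ?_)
    simp only
    simp_rw [← integral_const_mul]
    rw [integral_integral_swap_of_hasCompactSupport (f := fun x y' => Ξ x y * Ξ x y')]
    · have : Continuous fun p : (ℝ × ℝ) × ℝ => Function.uncurry Ξ (p.1, y) :=
        hc.comp (by fun_prop)
      exact this.mul hc
    · exact hs.mul_left (f := fun p : (ℝ × ℝ) × ℝ => Ξ p.1 y)
  · exact hc.mul (hh.comp continuous_fst)
  · exact hs.mul_right (f' := fun p : (ℝ × ℝ) × ℝ => ∫ y', Ξ p.1 y')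

lemma hasCompactSupport_of_box {f : (ℝ × ℝ) × ℝ → ℝ} (R : ℝ)
    (h : ∀ x y z, f ((x, y), z) ≠ 0 → |x| ≤ R ∧ |y| ≤ R ∧ |z| ≤ R) : HasCompactSupport f := by
  refine HasCompactSupport.intro
    ((isCompact_Icc.prod isCompact_Icc).prod isCompact_Icc : IsCompact
      ((Set.Icc (-R) R ×ˢ Set.Icc (-R) R) ×ˢ Set.Icc (-R) R)) fun p hp => ?_
  by_contra hne
  obtain ⟨h1, h2, h3⟩ := h p.1.1 p.1.2 p.2 hne
  exact hp ⟨⟨abs_le.1 h1, abs_le.1 h2⟩, abs_le.1 h3⟩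

lemma hasCompactSupport_of_box₂ {f : ℝ × ℝ → ℝ} (R : ℝ)
    (h : ∀ x y, f (x, y) ≠ 0 → |x| ≤ R ∧ |y| ≤ R) : HasCompactSupport f := by
  refine HasCompactSupport.intro
    (isCompact_Icc.prod isCompact_Icc : IsCompact (Set.Icc (-R) R ×ˢ Set.Icc (-R) R)) fun p hp => ?_
  by_contra hne
  obtain ⟨h1, h2⟩ := h p.1 p.2 hne
  exact hp ⟨abs_le.1 h1, abs_le.1 h2⟩

lemma integral_prod_of_box {f : ℝ × ℝ → ℝ} (hf : Continuous f) (R : ℝ)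
    (h : ∀ x y, f (x, y) ≠ 0 → |x| ≤ R ∧ |y| ≤ R) : ∫ z, f z = ∫ x, ∫ y, f (x, y) :=
  integral_prod _ (hf.integrable_of_hasCompactSupport (hasCompactSupport_of_box₂ R h))

/-- Averaging over small shifts followed by Cauchy–Schwarz. -/
lemma sq_integral_le_of_shift_correlation {F : ℝ → ℝ → ℝ} {g χ : ℝ → ℝ} {a b H R S : ℝ}
    (hF : Continuous (Function.uncurry F)) (hR : 0 < R)
    (hF0 : ∀ t y, F t y ≠ 0 → t ∈ Set.Icc a b ∧ |y| ≤ R) (hab : a ≤ b) (hL : b - a ≤ 1)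
    (hH : 0 < H) (hH1 : H ≤ 1) (hg : Continuous g) (hg1 : ∀ x, |g x| ≤ 1)
    (hχ : Continuous χ) (hχ0 : ∀ h, 0 ≤ χ h) (hχs : ∀ h, χ h ≠ 0 → h ∈ Set.Icc 0 H)
    (hχ1 : ∫ h, χ h = 1)
    (hS : ∀ h ∈ Set.Icc 0 H, |∫ k, χ (k + h) * ∫ t, ∫ y, F t y * F (t + k) y| ≤ S) :
    (∫ t, ∫ y, F t y * g y) ^ 2 ≤ 4 * R * S := by
  set Ξ : ℝ × ℝ → ℝ → ℝ := fun x h => χ h * F (x.1 + h) x.2 with hΞ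
  set M := R + |a| + |b| + 1 with hM
  have hbox : ∀ t y h, χ h * F (t + h) y ≠ 0 → |t| ≤ M ∧ |y| ≤ M ∧ |h| ≤ M := by
    intro t y h hne
    obtain ⟨h1, h2⟩ := mul_ne_zero_iff.1 hne
    obtain ⟨h3, h4⟩ := hF0 _ _ h2
    have h5 := hχs h h1
    have := neg_abs_le a; have := le_abs_self b
    have := abs_nonneg a; have := abs_nonneg b
    refine ⟨abs_le.2 ⟨?_, ?_⟩, by linarith, abs_le.2 ⟨?_, ?_⟩⟩ <;>
      linarith [h3.1, h3.2, h5.1, h5.2]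
  have hc : Continuous (Function.uncurry Ξ) := by
    refine (hχ.comp continuous_snd).mul (?_ : Continuous fun p : (ℝ × ℝ) × ℝ => _)
    exact hF.comp (by fun_prop : Continuous fun p : (ℝ × ℝ) × ℝ => (p.1.1 + p.2, p.1.2))
  have hs : HasCompactSupport (Function.uncurry Ξ) := hasCompactSupport_of_box M hbox
  have key := sq_integral_integral_le (g := fun x => g x.2) (V := 4 * R)
    (S := Set.Icc (a - H) b ×ˢ Set.Icc (-R) R) (hg.comp continuous_snd) (fun x => hg1 _) hc hs
    (isCompact_Icc.prod isCompact_Icc) ?_ ?_ (by positivity)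
  rotate_left
  · rintro ⟨t, y⟩ h hx
    by_contra hne
    obtain ⟨h1, h2⟩ := mul_ne_zero_iff.1 hne
    obtain ⟨h3, h4⟩ := hF0 _ _ h2
    have h5 := hχs h h1
    exact hx ⟨⟨by linarith [h3.1, h5.2], by linarith [h3.2, h5.1]⟩, abs_le.1 h4⟩
  · rw [measureReal_def, Measure.volume_eq_prod, Measure.prod_prod, ENNReal.toReal_mul,
      Real.volume_Icc, Real.volume_Icc, ENNReal.toReal_ofReal (by linarith),
      ENNReal.toReal_ofReal (by linarith)]
    nlinarith
  have cF : ∀ c, Continuous fun p : ℝ × ℝ => F (p.1 + c) p.2 := fun c =>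
    hF.comp (by fun_prop : Continuous fun p : ℝ × ℝ => (p.1 + c, p.2))
  have lhs : ∫ x : ℝ × ℝ, g x.2 * ∫ h, Ξ x h = ∫ t, ∫ y, F t y * g y := by
    have e0 : ∀ x : ℝ × ℝ, g x.2 * ∫ h, Ξ x h = ∫ h, g x.2 * Ξ x h := fun x =>
      (integral_const_mul _ _).symm
    simp_rw [e0]
    rw [integral_integral_swap_of_hasCompactSupport (f := fun x h => g x.2 * Ξ x h)]
    · have e1 : ∀ h, ∫ x : ℝ × ℝ, g x.2 * Ξ x h = χ h * ∫ t, ∫ y, F t y * g y := by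
        intro h
        have : ∀ x : ℝ × ℝ, g x.2 * Ξ x h = χ h * (F (x.1 + h) x.2 * g x.2) := fun x => by
          simp only [hΞ]; ring
        simp_rw [this]
        rw [integral_const_mul]
        by_cases hh : χ h = 0
        · simp [hh]
        congr 1
        rw [integral_prod_of_box (f := fun x => F (x.1 + h) x.2 * g x.2)
          ((cF h).mul (hg.comp continuous_snd)) M]
        · exact integral_add_right_eq_self (fun t => ∫ y, F t y * g y) h
        · intro t y hne
          have := hbox t y h (mul_ne_zero hh (left_ne_zero_of_mul hne))
          exact ⟨this.1, this.2.1⟩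
      simp_rw [e1]
      rw [integral_mul_const, hχ1, one_mul]
    · exact (by fun_prop : Continuous fun p : (ℝ × ℝ) × ℝ => g p.1.2).mul hc
    · exact hs.mul_left (f := fun p : (ℝ × ℝ) × ℝ => g p.1.2)
  rw [lhs] at key
  refine key.trans ?_
  gcongr
  have e2 : ∀ h, ∫ h', ∫ x, Ξ x h * Ξ x h'
      = χ h * ∫ k, χ (k + h) * ∫ t, ∫ y, F t y * F (t + k) y := by
    intro h
    have : ∀ h' (x : ℝ × ℝ), Ξ x h * Ξ x h' = χ h * (χ h' * (F (x.1 + h) x.2 * F (x.1 + h') x.2)) :=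
      fun h' x => by simp only [hΞ]; ring
    simp_rw [this, integral_const_mul]
    by_cases hh : χ h = 0
    · simp [hh]
    congr 1
    rw [← integral_add_right_eq_self _ h]
    refine integral_congr_ae (Filter.Eventually.of_forall fun k => ?_)
    simp only
    congr 1
    rw [integral_prod_of_box (f := fun x => F (x.1 + h) x.2 * F (x.1 + (k + h)) x.2)
      ((cF h).mul (cF (k + h))) M]
    · rw [← integral_add_right_eq_self (fun t => ∫ y, F t y * F (t + k) y) h]
      simp only [add_assoc, add_comm k h]
    · intro t y hne
      have := hbox t y h (mul_ne_zero hh (left_ne_zero_of_mul hne))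
      exact ⟨this.1, this.2.1⟩
  simp_rw [e2]
  refine (le_abs_self _).trans ?_
  have hχi : Integrable χ := by
    by_contra h
    rw [integral_undef h] at hχ1
    exact zero_ne_one hχ1
  have := norm_integral_le_of_norm_le (hχi.mul_const S)
    (f := fun h => χ h * ∫ k, χ (k + h) * ∫ t, ∫ y, F t y * F (t + k) y)
    (Filter.Eventually.of_forall fun h => ?_)
  · rwa [integral_mul_const, hχ1, one_mul] at this
  · by_cases hh : χ h = 0
    · simp [hh]
    · rw [norm_mul, Real.norm_of_nonneg (hχ0 h)]
      exact mul_le_mul_of_nonneg_left (hS h (hχs h hh)) (hχ0 h)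

/-- A continuous function of three real variables supported in a bounded box. -/
structure BoxSupported (f : ℝ → ℝ → ℝ → ℝ) : Prop where
  cont : Continuous fun p : (ℝ × ℝ) × ℝ => f p.1.1 p.1.2 p.2
  box : ∃ R, ∀ x y z, f x y z ≠ 0 → |x| ≤ R ∧ |y| ≤ R ∧ |z| ≤ R

namespace BoxSupported

variable {f g : ℝ → ℝ → ℝ → ℝ}

lemma hasCompactSupport (hf : BoxSupported f) :
    HasCompactSupport fun p : (ℝ × ℝ) × ℝ => f p.1.1 p.1.2 p.2 := by
  obtain ⟨R, hR⟩ := hf.box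
  exact hasCompactSupport_of_box R hR

lemma integrable (hf : BoxSupported f) :
    Integrable fun p : (ℝ × ℝ) × ℝ => f p.1.1 p.1.2 p.2 :=
  hf.cont.integrable_of_hasCompactSupport hf.hasCompactSupport

lemma continuous_inner (hf : BoxSupported f) : Continuous fun p : ℝ × ℝ => ∫ z, f p.1 p.2 z :=
  continuous_integral_of_compactSupport (Ξ := fun p z => f p.1 p.2 z) hf.cont hf.hasCompactSupport

lemma exists_inner_box (hf : BoxSupported f) :
    ∃ R, ∀ x y, (∫ z, f x y z) ≠ 0 → |x| ≤ R ∧ |y| ≤ R := by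
  obtain ⟨R, hR⟩ := hf.box
  refine ⟨R, fun x y hne => ?_⟩
  by_contra hcon
  refine hne (integral_eq_zero_of_ae (Filter.Eventually.of_forall fun z => ?_))
  by_contra hz
  exact hcon ⟨(hR x y z hz).1, (hR x y z hz).2.1⟩

lemma integral_swap (hf : BoxSupported f) :
    ∫ x, ∫ y, ∫ z, f x y z = ∫ y, ∫ x, ∫ z, f x y z := by
  obtain ⟨R, hR⟩ := hf.exists_inner_box
  exact integral_integral_swap_of_hasCompactSupport (f := fun x y => ∫ z, f x y z)
    hf.continuous_inner (hasCompactSupport_of_box₂ R hR)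

lemma integral_prod_eq (hf : BoxSupported f) :
    ∫ p : (ℝ × ℝ) × ℝ, f p.1.1 p.1.2 p.2 = ∫ x, ∫ y, ∫ z, f x y z := by
  obtain ⟨R, hR⟩ := hf.exists_inner_box
  rw [Measure.volume_eq_prod, integral_prod _ hf.integrable]
  exact integral_prod_of_box hf.continuous_inner R hR

lemma integral_last (hf : BoxSupported f) :
    ∫ z, ∫ x, ∫ y, f x y z = ∫ p : ℝ × ℝ, ∫ z, f p.1 p.2 z := by
  rw [integral_integral_swap_of_hasCompactSupport (f := fun (p : ℝ × ℝ) z => f p.1 p.2 z)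
    hf.cont hf.hasCompactSupport]
  obtain ⟨R, hR⟩ := hf.box
  refine integral_congr_ae (Filter.Eventually.of_forall fun z => ?_)
  refine (integral_prod_of_box (f := fun p => f p.1 p.2 z) ?_ R fun x y h => ?_).symm
  · exact hf.cont.comp (by fun_prop : Continuous fun p : ℝ × ℝ => (p, z))
  · exact ⟨(hR x y z h).1, (hR x y z h).2.1⟩

end BoxSupported

lemma abs_integral_prod_le {F : (ℝ × ℝ) × ℝ → ℝ} {f g h : ℝ → ℝ} (hf : Integrable f)
    (hg : Integrable g) (hh : Integrable h)
    (hF : ∀ᵐ p : (ℝ × ℝ) × ℝ, |F p| ≤ f p.1.1 * g p.1.2 * h p.2) :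
    |∫ p, F p| ≤ (∫ x, f x) * (∫ x, g x) * ∫ x, h x := by
  have h1 : Integrable fun p : (ℝ × ℝ) × ℝ => f p.1.1 * g p.1.2 * h p.2 :=
    (hf.mul_prod hg).mul_prod hh
  refine (norm_integral_le_of_norm_le (f := F) h1 hF).trans (le_of_eq ?_)
  rw [← integral_prod_mul f g, ← integral_prod_mul (fun p : ℝ × ℝ => f p.1 * g p.2) h]
  rfl

/-- The triangular bump of mass one on `[0, H]`. -/
noncomputable def tent (H h : ℝ) : ℝ := max 0 (2 / H - 4 / H ^ 2 * |h - H / 2|)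

section tent

variable {H : ℝ}

lemma tent_nonneg (h : ℝ) : 0 ≤ tent H h := le_max_left _ _

lemma tent_continuous : Continuous (tent H) := by unfold tent; fun_prop

lemma tent_le (hH : 0 < H) (h : ℝ) : tent H h ≤ 2 / H := by
  refine max_le (by positivity) (sub_le_self _ (by positivity))

lemma tent_lip (hH : 0 < H) (h k : ℝ) : |tent H h - tent H k| ≤ 4 / H ^ 2 * |h - k| := by
  unfold tent
  refine (abs_max_sub_max_le_max _ _ _ _).trans (max_le ?_ ?_)
  · rw [sub_self, abs_zero]; positivity
  have e : 2 / H - 4 / H ^ 2 * |h - H / 2| - (2 / H - 4 / H ^ 2 * |k - H / 2|)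
      = 4 / H ^ 2 * (|k - H / 2| - |h - H / 2|) := by ring
  rw [e, abs_mul, abs_of_nonneg (by positivity : (0 : ℝ) ≤ 4 / H ^ 2)]
  refine mul_le_mul_of_nonneg_left ?_ (by positivity)
  have := abs_abs_sub_abs_le (k - H / 2) (h - H / 2)
  rwa [sub_sub_sub_cancel_right, abs_sub_comm k h] at this

lemma tent_support (hH : 0 < H) (h : ℝ) (hne : tent H h ≠ 0) : h ∈ Set.Icc 0 H := by
  by_contra hcon
  refine hne (max_eq_left ?_)
  have : H / 2 ≤ |h - H / 2| := by
    by_contra hlt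
    have := abs_lt.1 (not_le.1 hlt)
    exact hcon ⟨by linarith, by linarith⟩
  have h2 : 4 / H ^ 2 * (H / 2) ≤ 4 / H ^ 2 * |h - H / 2| := by gcongr
  have h3 : 4 / H ^ 2 * (H / 2) = 2 / H := by field_simp; norm_num
  linarith

lemma tent_integral (hH : 0 < H) : ∫ h, tent H h = 1 := by
  have h1 : ∫ h, tent H h = ∫ h in (0 : ℝ)..H, tent H h := by
    rw [intervalIntegral.integral_of_le hH.le, ← integral_Icc_eq_integral_Ioc]
    refine (setIntegral_eq_integral_of_forall_compl_eq_zero fun x hx => ?_).symm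
    by_contra h
    exact hx (tent_support hH x h)
  rw [h1, ← intervalIntegral.integral_add_adjacent_intervals (b := H / 2)
    (tent_continuous.intervalIntegrable _ _) (tent_continuous.intervalIntegrable _ _)]
  have e1 : ∫ h in (0 : ℝ)..(H / 2), tent H h = ∫ h in (0 : ℝ)..(H / 2), 4 / H ^ 2 * h := by
    refine intervalIntegral.integral_congr fun x hx => ?_
    rw [Set.uIcc_of_le (by positivity)] at hx
    simp only [tent]
    rw [abs_of_nonpos (by linarith [hx.2])]
    have : 2 / H - 4 / H ^ 2 * -(x - H / 2) = 4 / H ^ 2 * x := by field_simp; ring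
    rw [this]
    exact max_eq_right (mul_nonneg (by positivity) hx.1)
  have e2 : ∫ h in (H / 2)..H, tent H h = ∫ h in (H / 2)..H, 4 / H ^ 2 * (H - h) := by
    refine intervalIntegral.integral_congr fun x hx => ?_
    rw [Set.uIcc_of_le (by linarith)] at hx
    simp only [tent]
    rw [abs_of_nonneg (by linarith [hx.1])]
    have : 2 / H - 4 / H ^ 2 * (x - H / 2) = 4 / H ^ 2 * (H - x) := by field_simp; ring
    rw [this]
    exact max_eq_right (mul_nonneg (by positivity) (by linarith [hx.2]))
  rw [e1, e2]
  rw [intervalIntegral.integral_const_mul, intervalIntegral.integral_const_mul]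
  rw [intervalIntegral.integral_sub (by simp) (by simp)]
  simp only [intervalIntegral.integral_const, integral_id, smul_eq_mul]
  field_simp
  ring

end tent

/-- `|x|^{-1/2}` on `[-R, R]`. -/
noncomputable def invSqrtOn (R : ℝ) : ℝ → ℝ :=
  (Set.Icc (-R) R).indicator fun x => |x| ^ (-(1 / 2) : ℝ)

lemma invSqrtOn_spec {R : ℝ} (hR : 0 ≤ R) :
    Integrable (invSqrtOn R) ∧ ∫ x, invSqrtOn R x = 4 * R ^ (1 / 2 : ℝ) := by
  have hpos : ∀ b : ℝ, 0 ≤ b →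
      IntervalIntegrable (fun x : ℝ => |x| ^ (-(1 / 2) : ℝ)) volume 0 b := fun b hb => by
    refine (intervalIntegral.intervalIntegrable_rpow' (r := -(1 / 2)) (by norm_num)).congr
      fun x hx => ?_
    rw [Set.uIoc_of_le hb] at hx
    simp only [abs_of_pos hx.1]
  have hneg : IntervalIntegrable (fun x : ℝ => |x| ^ (-(1 / 2) : ℝ)) volume (-R) 0 := by
    refine IntervalIntegrable.symm ?_
    rw [IntervalIntegrable.iff_comp_neg]
    simpa using hpos R hR
  have hval : ∫ x in (0 : ℝ)..R, |x| ^ (-(1 / 2) : ℝ) = 2 * R ^ (1 / 2 : ℝ) := by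
    have : ∫ x in (0 : ℝ)..R, |x| ^ (-(1 / 2) : ℝ) = ∫ x in (0 : ℝ)..R, x ^ (-(1 / 2) : ℝ) := by
      refine intervalIntegral.integral_congr fun x hx => ?_
      rw [Set.uIcc_of_le hR] at hx
      simp only [abs_of_nonneg hx.1]
    rw [this, integral_rpow (Or.inl (by norm_num))]
    norm_num
    ring
  have hi := hneg.trans (hpos R hR)
  refine ⟨((integrableOn_Icc_iff_integrableOn_Ioc (by simp)).2 hi.1).integrable_indicator measurableSet_Icc,
    ?_⟩
  rw [invSqrtOn, integral_indicator measurableSet_Icc, integral_Icc_eq_integral_Ioc,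
    ← intervalIntegral.integral_of_le (by linarith),
    ← intervalIntegral.integral_add_adjacent_intervals hneg (hpos R hR), hval]
  have : ∫ x in (-R)..0, |x| ^ (-(1 / 2) : ℝ) = ∫ x in (0 : ℝ)..R, |x| ^ (-(1 / 2) : ℝ) := by
    have := intervalIntegral.integral_comp_neg (a := 0) (b := R)
      (fun x : ℝ => |x| ^ (-(1 / 2) : ℝ))
    simpa using this.symm
  rw [this, hval]; ring

section quad

variable {ψ qi ρ ρi w d : ℝ → ℝ} {a b R c : ℝ}

/-- The amplitude produced by the linearised correlation. -/
noncomputable def ampl (ψ qi w : ℝ → ℝ) (v t : ℝ) : ℝ := ψ t ^ 2 * |qi t| * w (v * qi t)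

/-- Fourfold correlation of `d`, bounded by an oscillatory integral in the innermost variable. -/
lemma abs_quad_correlation_le (hψc : Continuous ψ) (hqic : Continuous qi) (hρc : Continuous ρ)
    (hρic : Continuous ρi) (hwc : Continuous w) (hdc : Continuous d)
    (hρ : ∀ t, ρ t * ρi t = 1) (hψ0 : ∀ t, ψ t ≠ 0 → t ∈ Set.Icc a b) (hab : b - a ≤ 1)
    (hd0 : ∀ x, d x ≠ 0 → x ∈ Set.Icc (-1) 2) (hd1 : ∀ x, |d x| ≤ 1) (hR : 0 ≤ R)
    (hwR : ∀ u t, w (u * ρi t * qi t) ≠ 0 → |u| ≤ R)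
    (hb : ∀ τ u x, τ ≠ 0 → u ≠ 0 →
      |∫ t, |ρi t| * (ampl ψ qi w (u * ρi t) t * ampl ψ qi w (u * ρi t) (t + τ)) *
        d (x - τ - ρ (t + τ) * ρi t * u)| ≤ c * |τ| ^ (-(1 / 2) : ℝ) * |u| ^ (-(1 / 2) : ℝ)) :
    |∫ t, ∫ t', ∫ p : ℝ × ℝ, ampl ψ qi w p.1 t * (d (p.2 - t) * d (p.2 - t - ρ t * p.1)) *
      (ampl ψ qi w p.1 t' * (d (p.2 - t') * d (p.2 - t' - ρ t' * p.1)))| ≤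
      c * 4 * (4 * R ^ (1 / 2 : ℝ)) * 3 := by
  set J : ℝ → ℝ → ℝ → ℝ → ℝ := fun t τ u x =>
    d x * d (x - u) * d (x - τ) *
    (|ρi t| * (ampl ψ qi w (u * ρi t) t * ampl ψ qi w (u * ρi t) (t + τ)) *
        d (x - τ - ρ (t + τ) * ρi t * u)) with hJ
  have hρi0 : ∀ t, ρi t ≠ 0 := fun t => right_ne_zero_of_mul_eq_one (hρ t)
  have hsupp : ∀ t τ u x, J t τ u x ≠ 0 → t ∈ Set.Icc a b ∧ |τ| ≤ 1 ∧ |u| ≤ R ∧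
      x ∈ Set.Icc (-1) 2 := by
    intro t τ u x h
    simp only [hJ, ampl, mul_ne_zero_iff, pow_ne_zero_iff (two_ne_zero)] at h
    have h1 := hψ0 _ h.2.1.2.1.1.1
    have h2 := hψ0 _ h.2.1.2.2.1.1
    refine ⟨h1, abs_le.2 ⟨?_, ?_⟩, hwR _ _ h.2.1.2.1.2, hd0 _ h.1.1.1⟩ <;>
      linarith [h1.1, h1.2, h2.1, h2.2]
  have hJc : Continuous fun p : ℝ × ((ℝ × ℝ) × ℝ) => J p.1 p.2.1.1 p.2.1.2 p.2.2 := by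
    simp only [hJ, ampl]; fun_prop
  have hbox : ∀ t, BoxSupported (J t) := fun t => by
    refine ⟨?_, R + 2, fun τ u x h => ?_⟩
    · exact hJc.comp (by fun_prop : Continuous fun p : (ℝ × ℝ) × ℝ => (t, p))
    · obtain ⟨-, h2, h3, h4⟩ := hsupp t τ u x h
      exact ⟨by linarith, by linarith, abs_le.2 ⟨by linarith [h4.1], by linarith [h4.2]⟩⟩
  have stepa : ∀ t, ∫ t', ∫ p : ℝ × ℝ,
      ampl ψ qi w p.1 t * (d (p.2 - t) * d (p.2 - t - ρ t * p.1)) *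
      (ampl ψ qi w p.1 t' * (d (p.2 - t') * d (p.2 - t' - ρ t' * p.1)))
      = ∫ p : (ℝ × ℝ) × ℝ, J t p.1.1 p.1.2 p.2 := by
    intro t
    rw [(hbox t).integral_prod_eq, ← integral_add_left_eq_self _ t]
    refine integral_congr_ae (Filter.Eventually.of_forall fun τ => ?_)
    simp only
    rw [integral_prod_of_box (f := fun p : ℝ × ℝ =>
      ampl ψ qi w p.1 t * (d (p.2 - t) * d (p.2 - t - ρ t * p.1)) *
      (ampl ψ qi w p.1 (t + τ) * (d (p.2 - (t + τ)) * d (p.2 - (t + τ) - ρ (t + τ) * p.1))))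
      (by simp only [ampl]; fun_prop) (|ρi t| * R + (|t| + 2))]
    · have key := Measure.integral_comp_mul_right (fun v => ∫ z,
        ampl ψ qi w v t * (d (z - t) * d (z - t - ρ t * v)) *
        (ampl ψ qi w v (t + τ) * (d (z - (t + τ)) * d (z - (t + τ) - ρ (t + τ) * v)))) (ρi t)
      have h2 : ∀ I : ℝ, I = |ρi t| * (|(ρi t)⁻¹| • I) := fun I => by
        have : |ρi t| ≠ 0 := abs_ne_zero.2 (hρi0 t)
        rw [abs_inv, smul_eq_mul]; field_simp
      rw [h2 (∫ v, ∫ z, ampl ψ qi w v t * (d (z - t) * d (z - t - ρ t * v)) *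
        (ampl ψ qi w v (t + τ) * (d (z - (t + τ)) * d (z - (t + τ) - ρ (t + τ) * v)))), ← key,
        ← integral_const_mul]
      refine integral_congr_ae (Filter.Eventually.of_forall fun u => ?_)
      simp only
      rw [← integral_const_mul, ← integral_add_right_eq_self _ t]
      refine integral_congr_ae (Filter.Eventually.of_forall fun x => ?_)
      simp only [hJ]
      have e1 : ρ t * (u * ρi t) = u := by rw [mul_comm u, ← mul_assoc, hρ, one_mul]
      have e2 : x + t - (t + τ) = x - τ := by ring
      have e3 : ρ (t + τ) * (u * ρi t) = ρ (t + τ) * ρi t * u := by ring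
      rw [add_sub_cancel_right, e1, e2, e3]
      ring
    · intro v z h
      simp only [ampl, mul_ne_zero_iff] at h
      have h1 : |ρ t * v| ≤ R := hwR (ρ t * v) t (by
        have e : ρ t * v * ρi t = v := by rw [mul_comm (ρ t), mul_assoc, hρ, mul_one]
        rw [e]; exact h.1.1.2)
      have h2 := hd0 _ h.1.2.1
      have h3 : |v| = |ρi t| * |ρ t * v| := by
        rw [← abs_mul, ← mul_assoc, mul_comm (ρi t), hρ, one_mul]
      have h4 : |ρi t| * |ρ t * v| ≤ |ρi t| * R := by gcongr
      have h5 : 0 ≤ |ρi t| * R := by positivity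
      have := neg_abs_le t; have := le_abs_self t
      refine ⟨by linarith [abs_nonneg t], abs_le.2 ⟨?_, ?_⟩⟩ <;> linarith [h2.1, h2.2]
  simp_rw [stepa]
  rw [integral_integral_swap_of_hasCompactSupport
    (f := fun t (p : (ℝ × ℝ) × ℝ) => J t p.1.1 p.1.2 p.2) hJc]
  swap
  · refine HasCompactSupport.intro (isCompact_Icc.prod
      ((isCompact_Icc.prod isCompact_Icc).prod isCompact_Icc) : IsCompact
      (Set.Icc a b ×ˢ ((Set.Icc (-1 : ℝ) 1 ×ˢ Set.Icc (-R) R) ×ˢ Set.Icc (-1 : ℝ) 2)))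
      fun p hp => ?_
    by_contra hne
    obtain ⟨h1, h2, h3, h4⟩ := hsupp _ _ _ _ hne
    exact hp ⟨h1, ⟨abs_le.1 h2, abs_le.1 h3⟩, h4⟩
  have hi3 : Integrable ((Set.Icc (-1 : ℝ) 2).indicator fun _ => (1 : ℝ)) :=
    (integrableOn_const (by simp)).integrable_indicator measurableSet_Icc
  have hv3 : ∫ x, (Set.Icc (-1 : ℝ) 2).indicator (fun _ => (1 : ℝ)) x = 3 := by
    rw [integral_indicator measurableSet_Icc]; simp; norm_num
  have hi1 := invSqrtOn_spec zero_le_one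
  have hi2 := invSqrtOn_spec hR
  have key := abs_integral_prod_le (F := fun p => ∫ t, J t p.1.1 p.1.2 p.2)
    (hi1.1.const_mul c) hi2.1 hi3 ?_
  · rw [integral_const_mul, hi1.2, hi2.2, hv3] at key
    simpa using key
  have ae0 : ∀ᵐ x : ℝ, x ≠ 0 := by simp [ae_iff]
  have ae1 : ∀ᵐ p : (ℝ × ℝ) × ℝ, p.1.1 ≠ 0 :=
    (Measure.quasiMeasurePreserving_fst.comp Measure.quasiMeasurePreserving_fst).ae ae0
  have ae2 : ∀ᵐ p : (ℝ × ℝ) × ℝ, p.1.2 ≠ 0 :=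
    (Measure.quasiMeasurePreserving_snd.comp Measure.quasiMeasurePreserving_fst).ae ae0
  filter_upwards [ae1, ae2] with p h1 h2
  have hb' := hb p.1.1 p.1.2 p.2 h1 h2
  have hc0 : 0 ≤ c * |p.1.1| ^ (-(1 / 2) : ℝ) * |p.1.2| ^ (-(1 / 2) : ℝ) :=
    (abs_nonneg _).trans hb'
  have hpos1 : 0 < |p.1.1| ^ (-(1 / 2) : ℝ) := Real.rpow_pos_of_pos (abs_pos.2 h1) _
  have hpos2 : 0 < |p.1.2| ^ (-(1 / 2) : ℝ) := Real.rpow_pos_of_pos (abs_pos.2 h2) _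
  have hc : 0 ≤ c := by
    by_contra hneg
    have : c * |p.1.1| ^ (-(1 / 2) : ℝ) * |p.1.2| ^ (-(1 / 2) : ℝ) < 0 :=
      mul_neg_of_neg_of_pos (mul_neg_of_neg_of_pos (not_le.1 hneg) hpos1) hpos2
    linarith
  by_cases hz : (∫ t, J t p.1.1 p.1.2 p.2) = 0
  · rw [hz, abs_zero]
    refine mul_nonneg (mul_nonneg (mul_nonneg hc ?_) ?_) ?_ <;>
      refine Set.indicator_nonneg (fun x _ => ?_) _ <;> positivity
  · obtain ⟨t, ht⟩ : ∃ t, J t p.1.1 p.1.2 p.2 ≠ 0 := by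
      by_contra hcon
      push Not at hcon
      exact hz (by simp [hcon])
    obtain ⟨-, h4, h5, h6⟩ := hsupp _ _ _ _ ht
    rw [invSqrtOn, invSqrtOn, Set.indicator_of_mem (Set.mem_Icc.2 (abs_le.1 h4)),
      Set.indicator_of_mem (Set.mem_Icc.2 (abs_le.1 h5)),
      Set.indicator_of_mem h6, mul_one]
    refine le_trans ?_ hb'
    simp only [hJ, integral_const_mul]
    rw [abs_mul]
    refine mul_le_of_le_one_left (abs_nonneg _) ?_
    rw [abs_mul, abs_mul]
    exact mul_le_one₀ (mul_le_one₀ (hd1 _) (abs_nonneg _) (hd1 _)) (abs_nonneg _) (hd1 _)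

end quad

/-- A curve `t ↦ (t, φ t)` with amplitude `ψ`, together with the reciprocals and the
nondegeneracy bounds needed for smoothing. -/
structure PhaseData (A a b : ℝ) (φ ψ p qi ρ ρi : ℝ → ℝ) (κ' : ℝ → ℝ → ℝ) : Prop where
  one_le : 1 ≤ A
  lt : a < b
  len : b - a ≤ 1
  φ_cont : Continuous φ
  φ_bdd : ∀ t, |φ t| ≤ A
  lin : ∀ t ∈ Set.Icc a b, ∀ k, |k| ≤ b - a → |φ (t + k) - φ t - p t * k| ≤ A * k ^ 2
  ψ_bl : BddLip A ψ
  ψ_supp : ∀ t, ψ t ≠ 0 → t ∈ Set.Icc a b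
  p_cont : Continuous p
  q_bdd : ∀ t, |1 - p t| ≤ A
  qi_bl : BddLip A qi
  ρ_cont : Continuous ρ
  ρ_bdd : ∀ t, |ρ t| ≤ A
  ρi_bl : BddLip A ρi
  q_mul : ∀ t, (1 - p t) * qi t = 1
  ρ_mul : ∀ t, ρ t * ρi t = 1
  ρ_eq : ∀ t, ρ t = p t * qi t
  κ_deriv : ∀ t ∈ Set.Icc a b, ∀ τ, |τ| ≤ b - a →
    HasDerivAt (fun t => ρ (t + τ) * ρi t) (κ' τ t) t
  κ_ge : ∀ t ∈ Set.Icc a b, ∀ τ, |τ| ≤ b - a → |τ| / A ≤ |κ' τ t|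
  κ_lip : ∀ t ∈ Set.Icc a b, ∀ s ∈ Set.Icc a b, ∀ τ, |τ| ≤ b - a →
    |κ' τ t - κ' τ s| ≤ A * |τ| * |t - s|

/-- A Lipschitz weight at scale `H`. -/
structure ScaleWeight (H : ℝ) (w : ℝ → ℝ) : Prop where
  pos : 0 < H
  supp : ∀ k, H < |k| → w k = 0
  bdd : ∀ k, |w k| ≤ 4 / H
  lip : ∀ k l, |w k - w l| ≤ 4 / H ^ 2 * |k - l|

lemma ScaleWeight.continuous {H : ℝ} {w : ℝ → ℝ} (hw : ScaleWeight H w) : Continuous w := by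
  have := hw.pos
  refine (LipschitzWith.of_dist_le_mul (K := ⟨4 / H ^ 2, by positivity⟩) fun x y => ?_).continuous
  exact hw.lip x y

/-- A bounded function on `[-1, 2]` oscillating at frequency `N`. -/
structure Oscillating (N : ℝ) (d : ℝ → ℝ) : Prop where
  cont : Continuous d
  supp : ∀ x, d x ≠ 0 → x ∈ Set.Icc (-1) 2
  bdd : ∀ x, |d x| ≤ 1
  lip : ∀ x y, |d x - d y| ≤ N * |x - y|
  prim : ∃ D : ℝ → ℝ, (∀ x, HasDerivAt D (d x) x) ∧ ∀ x, |D x| ≤ 1 / N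

/-- A bounded function on `[-1, 2]`. -/
structure UnitBump (g : ℝ → ℝ) : Prop where
  cont : Continuous g
  supp : ∀ x, g x ≠ 0 → x ∈ Set.Icc (-1) 2
  bdd : ∀ x, |g x| ≤ 1

lemma min_one_inv_le_rpow {I c y : ℝ} (hy : 0 < y) (h1 : I ≤ c) (h2 : I ≤ c / y) (hc : 0 ≤ c) :
    I ≤ c * y ^ (-(1 / 2) : ℝ) := by
  rcases le_total 1 y with h | h
  · refine h2.trans ?_
    rw [div_eq_mul_inv, ← Real.rpow_neg_one]
    gcongr
    norm_num
  · refine h1.trans (le_mul_of_one_le_right hc ?_)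
    exact Real.one_le_rpow_of_pos_of_le_one_of_nonpos hy h (by norm_num)

namespace PhaseData

variable {A a b : ℝ} {φ ψ p qi ρ ρi : ℝ → ℝ} {κ' : ℝ → ℝ → ℝ}

lemma pos (h : PhaseData A a b φ ψ p qi ρ ρi κ') : 0 < A := zero_lt_one.trans_le h.one_le

lemma qi_ge (h : PhaseData A a b φ ψ p qi ρ ρi κ') (t : ℝ) : 1 / A ≤ |qi t| := by
  have h1 := congrArg abs (h.q_mul t)
  rw [abs_mul, abs_one] at h1
  rw [div_le_iff₀ h.pos, ← h1, mul_comm]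
  exact mul_le_mul_of_nonneg_left (h.q_bdd t) (abs_nonneg _)

lemma ρi_ge (h : PhaseData A a b φ ψ p qi ρ ρi κ') (t : ℝ) : 1 / A ≤ |ρi t| := by
  have h1 := congrArg abs (h.ρ_mul t)
  rw [abs_mul, abs_one] at h1
  rw [div_le_iff₀ h.pos, ← h1, mul_comm]
  exact mul_le_mul_of_nonneg_left (h.ρ_bdd t) (abs_nonneg _)

lemma exists_amplitude_bddLip (h : PhaseData A a b φ ψ p qi ρ ρi κ') :
    ∃ C, 0 ≤ C ∧ ∀ H w, ScaleWeight H w → ∀ τ u, BddLip (C / H ^ 2) fun t =>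
      |ρi t| * (ampl ψ qi w (u * ρi t) t * ampl ψ qi w (u * ρi t) (t + τ)) := by
  have hA := h.pos
  set B0 := 2 * (2 * A * A) * A with hB0
  set A2 := 2 * A * A with hA2
  refine ⟨16 * A * B0 ^ 2 * (4 * (1 + A2 ^ 2)) ^ 2, by positivity, fun H w hw τ u => ?_⟩
  have hH := hw.pos
  have hψq : BddLip B0 fun t => ψ t * ψ t * |qi t| := (h.ψ_bl.mul h.ψ_bl).mul h.qi_bl.abs
  have hge : ∀ τ t, 1 / A2 ≤ |ρi t * qi (t + τ)| := fun τ t => by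
    rw [abs_mul]
    calc 1 / A2 ≤ 1 / A * (1 / A) := by
          rw [hA2, div_mul_div_comm, one_mul]
          exact one_div_le_one_div_of_le (by positivity) (by nlinarith [mul_pos hA hA])
      _ ≤ _ := mul_le_mul (h.ρi_ge t) (h.qi_ge _) (by positivity) (abs_nonneg _)
  have hw' : ∀ τ, BddLip (4 / H * (1 + A2 ^ 2)) fun t => w (u * (ρi t * qi (t + τ))) := fun τ =>
    (h.ρi_bl.mul (h.qi_bl.comp_add_const τ)).comp_mul hH (by norm_num) hw.supp hw.bdd hw.lip
      (by positivity) (hge τ) u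
  have hamp : ∀ τ, BddLip (2 * B0 * (4 / H * (1 + A2 ^ 2))) fun t =>
      ampl ψ qi w (u * ρi t) (t + τ) := fun τ => by
    have := (hψq.comp_add_const τ).mul (hw' τ)
    convert this using 2 with t
    simp only [ampl]; rw [mul_assoc u]; ring
  have h0 := hamp 0
  simp only [add_zero] at h0
  have := h.ρi_bl.abs.mul (h0.mul (hamp τ))
  convert this using 1
  field_simp
  ring

lemma exists_oscillatory_bound (h : PhaseData A a b φ ψ p qi ρ ρi κ') :
    ∃ C, 0 ≤ C ∧ ∀ H w N d, ScaleWeight H w → 1 ≤ N → Oscillating N d →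
      ∀ τ u x, τ ≠ 0 → u ≠ 0 →
      |∫ t, |ρi t| * (ampl ψ qi w (u * ρi t) t * ampl ψ qi w (u * ρi t) (t + τ)) *
        d (x - τ - ρ (t + τ) * ρi t * u)| ≤
        C / H ^ 2 * N ^ (-(1 / 2) : ℝ) * |τ| ^ (-(1 / 2) : ℝ) * |u| ^ (-(1 / 2) : ℝ) := by
  have hA := h.pos
  obtain ⟨CΩ, hCΩ, hΩ⟩ := h.exists_amplitude_bddLip
  refine ⟨CΩ * (A * (3 + A ^ 2)), by positivity, fun H w N d hw hN hd τ u x hτ hu => ?_⟩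
  have hH := hw.pos
  have hN0 : 0 < N := zero_lt_one.trans_le hN
  specialize hΩ H w hw τ u
  set Ω : ℝ → ℝ := fun t =>
    |ρi t| * (ampl ψ qi w (u * ρi t) t * ampl ψ qi w (u * ρi t) (t + τ)) with hΩd
  change |∫ t, Ω t * d (x - τ - ρ (t + τ) * ρi t * u)| ≤ _
  have hτ0 := abs_pos.2 hτ
  have hu0 := abs_pos.2 hu
  have hsupp : ∀ t, Ω t ≠ 0 → t ∈ Set.Icc a b ∧ t + τ ∈ Set.Icc a b := fun t ht => by
    simp only [hΩd, ampl, mul_ne_zero_iff, pow_ne_zero_iff (two_ne_zero)] at ht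
    exact ⟨h.ψ_supp _ ht.2.1.1.1, h.ψ_supp _ ht.2.2.1.1⟩
  have e1 : CΩ * (A * (3 + A ^ 2)) / H ^ 2 * N ^ (-(1 / 2) : ℝ) * |τ| ^ (-(1 / 2) : ℝ) *
      |u| ^ (-(1 / 2) : ℝ) =
      CΩ * (A * (3 + A ^ 2)) / H ^ 2 * (N * |τ| * |u|) ^ (-(1 / 2) : ℝ) := by
    rw [Real.mul_rpow (by positivity) hu0.le, Real.mul_rpow hN0.le hτ0.le]; ring
  rw [e1]
  by_cases hτL : b - a < |τ|
  · have : ∀ t, Ω t * d (x - τ - ρ (t + τ) * ρi t * u) = 0 := fun t => by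
      by_contra hne
      obtain ⟨h1, h2⟩ := hsupp t (left_ne_zero_of_mul hne)
      have : |τ| ≤ b - a := abs_le.2 ⟨by linarith [h1.2, h2.1], by linarith [h1.1, h2.2]⟩
      linarith
    simp only [this, integral_zero, abs_zero]
    positivity
  push Not at hτL
  have hset : ∫ t, Ω t * d (x - τ - ρ (t + τ) * ρi t * u) =
      ∫ t in a..b, Ω t * d (x - τ - ρ (t + τ) * ρi t * u) := by
    rw [intervalIntegral.integral_of_le h.lt.le, ← integral_Icc_eq_integral_Ioc]
    refine (setIntegral_eq_integral_of_forall_compl_eq_zero fun t ht => ?_).symm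
    by_contra hne
    exact ht (hsupp t (left_ne_zero_of_mul hne)).1
  rw [hset]
  have hA1 : 1 ≤ A * (3 + A ^ 2) := by nlinarith [h.one_le, sq_nonneg A]
  have hlen := h.len
  have hlt := h.lt
  have hba : 0 ≤ b - a := by linarith
  refine min_one_inv_le_rpow (by positivity) ?_ ?_ (by positivity)
  · have := intervalIntegral.norm_integral_le_of_norm_le_const (a := a) (b := b) (C := CΩ / H ^ 2)
      (f := fun t => Ω t * d (x - τ - ρ (t + τ) * ρi t * u)) (fun t _ => by
        rw [norm_mul]
        exact (mul_le_of_le_one_right (abs_nonneg _) (hd.bdd _)).trans (hΩ.1 t))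
    refine this.trans ?_
    rw [abs_of_nonneg hba]
    calc CΩ / H ^ 2 * (b - a) ≤ CΩ / H ^ 2 * (A * (3 + A ^ 2)) := by
          gcongr; linarith
      _ = _ := by ring
  · obtain ⟨D, hD, hDη⟩ := hd.prim
    have := abs_integral_comp_mul_le (lam := |τ| * |u| / A) (c := A ^ 2) (Ω := Ω)
      (θ := fun t => x - τ - ρ (t + τ) * ρi t * u) (θ' := fun t => -(κ' τ t * u)) h.lt.le hD hDη
      hd.bdd (fun t ht => by
        simpa using ((h.κ_deriv t ht τ hτL).mul_const u).const_sub (x - τ))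
      (by positivity) (fun t ht => by
        rw [abs_neg, abs_mul, mul_div_right_comm]
        gcongr
        exact h.κ_ge t ht τ hτL) (fun t ht s hs => by
        have e : -(κ' τ t * u) - -(κ' τ s * u) = -((κ' τ t - κ' τ s) * u) := by ring
        rw [e, abs_neg, abs_mul]
        calc |κ' τ t - κ' τ s| * |u| ≤ (A * |τ| * |t - s|) * |u| := by
              gcongr; exact h.κ_lip t ht s hs τ hτL
          _ = _ := by field_simp) hΩ (by positivity)
    refine this.trans ?_
    calc 1 / N * (CΩ / H ^ 2) / (|τ| * |u| / A) * (2 + (1 + A ^ 2) * (b - a))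
        ≤ 1 / N * (CΩ / H ^ 2) / (|τ| * |u| / A) * (2 + (1 + A ^ 2) * 1) := by gcongr
      _ = _ := by field_simp; ring

end PhaseData

namespace PhaseData

variable {A a b : ℝ} {φ ψ p qi ρ ρi : ℝ → ℝ} {κ' : ℝ → ℝ → ℝ}

lemma abs_le_of_weight_ne_zero {H : ℝ} {w f : ℝ → ℝ} (hA : 0 < A) (hw : ScaleWeight H w)
    (hf : ∀ t, 1 / A ≤ |f t|) {v t : ℝ} (h : w (v * f t) ≠ 0) : |v| ≤ A * H := by
  by_contra hlt
  refine h (hw.supp _ ?_)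
  rw [abs_mul]
  have hH := hw.pos
  calc H = (A * H) * (1 / A) := by field_simp
    _ < |v| * (1 / A) := by gcongr; exact not_le.1 hlt
    _ ≤ _ := by gcongr; exact hf t

/-- The linearised correlation as an integral over a fixed parameter space. -/
lemma linearised_eq (h : PhaseData A a b φ ψ p qi ρ ρi κ') {H N : ℝ} {w d g : ℝ → ℝ}
    (hw : ScaleWeight H w) (hd : Oscillating N d) (hg : UnitBump g) :
    ∫ k, ∫ t, ∫ x, w k * (ψ t * ψ t * (d x * d (x - p t * k) *
      (g (x + t) * g (x + t + (1 - p t) * k)))) =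
    ∫ z : ℝ × ℝ, g z.2 * g (z.2 + z.1) *
      ∫ t, ampl ψ qi w z.1 t * (d (z.2 - t) * d (z.2 - t - ρ t * z.1)) := by
  have hψc := h.ψ_bl.continuous
  have hqc := h.qi_bl.continuous
  have hpc := h.p_cont
  have hρc := h.ρ_cont
  have hwc := hw.continuous
  have hdc := hd.cont
  have hgc := hg.cont
  have hH := hw.pos
  have hA := h.pos
  have hAH : 0 < A * H := by positivity
  have := neg_abs_le a; have := le_abs_self b; have := abs_nonneg a; have := abs_nonneg b
  have hf : BoxSupported fun k t x => w k * (ψ t * ψ t * (d x * d (x - p t * k) *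
      (g (x + t) * g (x + t + (1 - p t) * k)))) := by
    refine ⟨by fun_prop, H + |a| + |b| + 2, fun k t x hne => ?_⟩
    simp only [mul_ne_zero_iff] at hne
    have h1 : |k| ≤ H := not_lt.1 fun hlt => hne.1 (hw.supp k hlt)
    have h2 := h.ψ_supp t hne.2.1.1
    have h3 := hd.supp x hne.2.2.1.1
    refine ⟨by linarith, abs_le.2 ⟨?_, ?_⟩, abs_le.2 ⟨?_, ?_⟩⟩ <;>
      linarith [h2.1, h2.2, h3.1, h3.2]
  have hG : BoxSupported fun v z t => g z * g (z + v) *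
      (ampl ψ qi w v t * (d (z - t) * d (z - t - ρ t * v))) := by
    refine ⟨by unfold ampl; fun_prop, A * H + |a| + |b| + 2, fun v z t hne => ?_⟩
    simp only [mul_ne_zero_iff, ampl] at hne
    have h1 : |v| ≤ A * H := abs_le_of_weight_ne_zero hA hw h.qi_ge hne.2.1.2
    have h2 := h.ψ_supp t (pow_ne_zero_iff (two_ne_zero) |>.1 hne.2.1.1.1)
    have h3 := hg.supp z hne.1.1
    refine ⟨by linarith, abs_le.2 ⟨?_, ?_⟩, abs_le.2 ⟨?_, ?_⟩⟩ <;>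
      linarith [h2.1, h2.2, h3.1, h3.2]
  rw [hf.integral_swap]
  simp_rw [← integral_const_mul]
  rw [← hG.integral_last]
  refine integral_congr_ae (Filter.Eventually.of_forall fun t => ?_)
  simp only
  have hq : qi t ≠ 0 := right_ne_zero_of_mul_eq_one (h.q_mul t)
  have key := Measure.integral_comp_mul_right (fun k => ∫ x, w k * (ψ t * ψ t *
    (d x * d (x - p t * k) * (g (x + t) * g (x + t + (1 - p t) * k))))) (qi t)
  have h2 : ∀ I : ℝ, I = |qi t| * (|(qi t)⁻¹| • I) := fun I => by
    have : |qi t| ≠ 0 := abs_ne_zero.2 hq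
    rw [abs_inv, smul_eq_mul]; field_simp
  rw [h2 (∫ k, ∫ x, w k * (ψ t * ψ t * (d x * d (x - p t * k) *
    (g (x + t) * g (x + t + (1 - p t) * k))))), ← key, ← integral_const_mul]
  refine integral_congr_ae (Filter.Eventually.of_forall fun v => ?_)
  simp only
  rw [← integral_const_mul, ← integral_sub_right_eq_self _ t]
  refine integral_congr_ae (Filter.Eventually.of_forall fun z => ?_)
  simp only [ampl]
  have e1 : (1 - p t) * (v * qi t) = v := by
    rw [mul_comm v, ← mul_assoc, h.q_mul, one_mul]
  have e2 : p t * (v * qi t) = ρ t * v := by rw [h.ρ_eq]; ring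
  rw [sub_add_cancel, e1, e2]
  ring

lemma exists_linearised_bound (h : PhaseData A a b φ ψ p qi ρ ρi κ') :
    ∃ C, 0 ≤ C ∧ ∀ H w N d g, ScaleWeight H w → 1 ≤ N → Oscillating N d → UnitBump g →
      (∫ k, ∫ t, ∫ x, w k * (ψ t * ψ t * (d x * d (x - p t * k) *
        (g (x + t) * g (x + t + (1 - p t) * k))))) ^ 2 ≤
      C * (N ^ (-(1 / 2) : ℝ) * H ^ (-(1 / 2) : ℝ)) := by
  have hA := h.pos
  obtain ⟨C, hC, hosc⟩ := h.exists_oscillatory_bound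
  refine ⟨384 * A ^ 2 * C, by positivity, fun H w N d g hw hN hd hg => ?_⟩
  have hH := hw.pos
  have hψc := h.ψ_bl.continuous
  have hqc := h.qi_bl.continuous
  have hpc := h.p_cont
  have hρc := h.ρ_cont
  have hwc := hw.continuous
  have hdc := hd.cont
  have hgc := hg.cont
  have hN0 : 0 < N := zero_lt_one.trans_le hN
  have hAH : 0 < A * H := by positivity
  have := neg_abs_le a; have := le_abs_self b; have := abs_nonneg a; have := abs_nonneg b
  have hlt := h.lt
  have hlen := h.len
  rw [h.linearised_eq hw hd hg]
  have hsupp : ∀ v z t, ampl ψ qi w v t * (d (z - t) * d (z - t - ρ t * v)) ≠ 0 →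
      |v| ≤ A * H ∧ z ∈ Set.Icc (a - 1) (b + 2) ∧ t ∈ Set.Icc a b := by
    intro v z t hne
    simp only [mul_ne_zero_iff, ampl] at hne
    have h1 : |v| ≤ A * H := abs_le_of_weight_ne_zero hA hw h.qi_ge hne.1.2
    have h2 := h.ψ_supp t (pow_ne_zero_iff (two_ne_zero) |>.1 hne.1.1.1)
    have h3 := hd.supp _ hne.2.1
    exact ⟨h1, ⟨by linarith [h2.1, h3.1], by linarith [h2.2, h3.2]⟩, h2⟩
  have cs := sq_integral_integral_le (g := fun z => g z.2 * g (z.2 + z.1))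
    (Ξ := fun z t => ampl ψ qi w z.1 t * (d (z.2 - t) * d (z.2 - t - ρ t * z.1)))
    (S := Set.Icc (-(A * H)) (A * H) ×ˢ Set.Icc (a - 1) (b + 2)) (V := 8 * (A * H))
    (by fun_prop) (fun z => by
      rw [abs_mul]; exact mul_le_one₀ (hg.bdd _) (abs_nonneg _) (hg.bdd _))
    (by unfold ampl; fun_prop)
    (hasCompactSupport_of_box (A * H + |a| + |b| + 2) fun v z t hne => by
      obtain ⟨h1, h2, h3⟩ := hsupp v z t hne
      refine ⟨by linarith, abs_le.2 ⟨?_, ?_⟩, abs_le.2 ⟨?_, ?_⟩⟩ <;>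
        linarith [h2.1, h2.2, h3.1, h3.2])
    (isCompact_Icc.prod isCompact_Icc) (fun z t hz => by
      by_contra hne
      obtain ⟨h1, h2, -⟩ := hsupp _ _ _ hne
      exact hz ⟨abs_le.1 h1, h2⟩) (by
      rw [measureReal_def, Measure.volume_eq_prod, Measure.prod_prod, ENNReal.toReal_mul,
        Real.volume_Icc, Real.volume_Icc, ENNReal.toReal_ofReal (by linarith),
        ENNReal.toReal_ofReal (by linarith)]
      nlinarith) (by positivity)
  refine cs.trans ?_
  have quad := abs_quad_correlation_le (R := A * (A * H)) hψc hqc hρc h.ρi_bl.continuous hwc hdc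
    h.ρ_mul h.ψ_supp hlen hd.supp hd.bdd (by positivity) (fun u t hne => by
      have h1 := abs_le_of_weight_ne_zero hA hw h.qi_ge hne
      have h2 : |u| = |u * ρi t| * |ρ t| := by
        rw [← abs_mul, mul_assoc, mul_comm (ρi t), h.ρ_mul, mul_one]
      rw [h2]
      calc |u * ρi t| * |ρ t| ≤ (A * H) * A := by gcongr; exact h.ρ_bdd t
        _ = _ := by ring) (hosc H w N d hw hN hd)
  have e1 : (A * (A * H)) ^ (1 / 2 : ℝ) = A * H ^ (1 / 2 : ℝ) := by
    rw [← mul_assoc, Real.mul_rpow (by positivity) hH.le, ← Real.sqrt_eq_rpow (A * A),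
      Real.sqrt_mul_self hA.le]
  have e2 : H ^ (-(1 / 2) : ℝ) = H ^ (1 / 2 : ℝ) / H := by
    rw [eq_div_iff hH.ne', ← Real.rpow_add_one hH.ne']
    norm_num
  calc _ ≤ 8 * (A * H) * (C / H ^ 2 * N ^ (-(1 / 2) : ℝ) * 4 *
      (4 * (A * (A * H)) ^ (1 / 2 : ℝ)) * 3) := by
        gcongr
        exact (le_abs_self _).trans quad
    _ = _ := by
      rw [e1, e2]; field_simp; ring

end PhaseData

namespace PhaseData

variable {A a b : ℝ} {φ ψ p qi ρ ρi : ℝ → ℝ} {κ' : ℝ → ℝ → ℝ}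

/-- Replacing the curve by its tangent line over windows of length `H`. -/
lemma abs_correlation_sub_linearised_le (h : PhaseData A a b φ ψ p qi ρ ρi κ') {H N : ℝ}
    {w d g : ℝ → ℝ} (hw : ScaleWeight H w) (hw0 : ∀ k, 0 ≤ w k) (hw1 : ∫ k, w k = 1)
    (hH : H ≤ b - a) (hN : 1 ≤ N) (hd : Oscillating N d) (hg : UnitBump g)
    (hgl : ∀ x y, |g x - g y| ≤ N * |x - y|) :
    |(∫ k, w k * ∫ t, ∫ y, (ψ t * (d (y - φ t) * g (y + t - φ t))) *
        (ψ (t + k) * (d (y - φ (t + k)) * g (y + (t + k) - φ (t + k))))) -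
      ∫ k, ∫ t, ∫ x, w k * (ψ t * ψ t * (d x * d (x - p t * k) *
        (g (x + t) * g (x + t + (1 - p t) * k))))| ≤ 9 * A ^ 3 * (H + N * H ^ 2) := by
  have hψc := h.ψ_bl.continuous
  have hφc := h.φ_cont
  have hpc := h.p_cont
  have hwc := hw.continuous
  have hdc := hd.cont
  have hgc := hg.cont
  have hH0 := hw.pos
  have hA := h.pos
  have hA1 := h.one_le
  have hlt := h.lt
  have hlen := h.len
  have := neg_abs_le a; have := le_abs_self b; have := abs_nonneg a; have := abs_nonneg b
  set f₀ : ℝ → ℝ → ℝ → ℝ := fun k t x => w k * (ψ t * ψ t * (d x * d (x - p t * k) *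
      (g (x + t) * g (x + t + (1 - p t) * k)))) with hf₀
  set f₁ : ℝ → ℝ → ℝ → ℝ := fun k t x => w k * (ψ t * ψ (t + k) *
      (d x * d (x + φ t - φ (t + k)) * (g (x + t) * g (x + φ t + (t + k) - φ (t + k))))) with hf₁
  have box : ∀ k t x, (w k ≠ 0 ∧ ψ t ≠ 0 ∧ d x ≠ 0) →
      |k| ≤ H ∧ t ∈ Set.Icc a b ∧ x ∈ Set.Icc (-1) 2 := fun k t x ⟨h1, h2, h3⟩ =>
    ⟨not_lt.1 fun hlt => h1 (hw.supp k hlt), h.ψ_supp t h2, hd.supp x h3⟩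
  have box' : ∀ k t x, (w k ≠ 0 ∧ ψ t ≠ 0 ∧ d x ≠ 0) → |k| ≤ H + |a| + |b| + 2 ∧
      |t| ≤ H + |a| + |b| + 2 ∧ |x| ≤ H + |a| + |b| + 2 := fun k t x hne => by
    obtain ⟨h1, h2, h3⟩ := box k t x hne
    refine ⟨by linarith, abs_le.2 ⟨?_, ?_⟩, abs_le.2 ⟨?_, ?_⟩⟩ <;>
      linarith [h2.1, h2.2, h3.1, h3.2]
  have b₀ : BoxSupported f₀ := ⟨by simp only [hf₀]; fun_prop, _, fun k t x hne => box' k t x (by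
    simp only [hf₀, mul_ne_zero_iff] at hne; tauto)⟩
  have b₁ : BoxSupported f₁ := ⟨by simp only [hf₁]; fun_prop, _, fun k t x hne => box' k t x (by
    simp only [hf₁, mul_ne_zero_iff] at hne; tauto)⟩
  have e1 : (∫ k, w k * ∫ t, ∫ y, (ψ t * (d (y - φ t) * g (y + t - φ t))) *
        (ψ (t + k) * (d (y - φ (t + k)) * g (y + (t + k) - φ (t + k))))) =
      ∫ k, ∫ t, ∫ x, f₁ k t x := by
    refine integral_congr_ae (Filter.Eventually.of_forall fun k => ?_)
    simp only
    rw [← integral_const_mul]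
    refine integral_congr_ae (Filter.Eventually.of_forall fun t => ?_)
    simp only
    rw [← integral_const_mul, ← integral_add_right_eq_self _ (φ t)]
    refine integral_congr_ae (Filter.Eventually.of_forall fun x => ?_)
    simp only [hf₁, add_sub_cancel_right]
    have : x + φ t + t - φ t = x + t := by ring
    rw [this]
    ring
  rw [e1, ← b₀.integral_prod_eq, ← b₁.integral_prod_eq, ← integral_sub b₁.integrable b₀.integrable]
  have hi : ∀ l r : ℝ, Integrable ((Set.Icc l r).indicator fun _ => (1 : ℝ)) := fun l r =>
    (integrableOn_const (by simp)).integrable_indicator measurableSet_Icc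
  have hv : ∀ l r : ℝ, l ≤ r → ∫ x, (Set.Icc l r).indicator (fun _ => (1 : ℝ)) x = r - l :=
    fun l r hlr => by
      rw [integral_indicator measurableSet_Icc]; simp [hlr]
  have hwi : Integrable w := by
    by_contra hni
    rw [integral_undef hni] at hw1
    exact zero_ne_one hw1
  set ε := A * (A * H) + A * A * (N * (A * H ^ 2)) + A * A * (N * (A * H ^ 2)) with hε
  have hε0 : 0 ≤ ε := by positivity
  have key := abs_integral_prod_le
    (F := fun q : (ℝ × ℝ) × ℝ => f₁ q.1.1 q.1.2 q.2 - f₀ q.1.1 q.1.2 q.2)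
    (hwi.const_mul ε) (hi a b) (hi (-1) 2) (Filter.Eventually.of_forall fun q => ?_)
  · refine key.trans ?_
    rw [integral_const_mul, hw1, hv a b hlt.le, hv (-1) 2 (by norm_num)]
    have h2 : ε ≤ 3 * A ^ 3 * (H + N * H ^ 2) := by
      have : A * (A * H) ≤ A ^ 3 * H := by
        have := mul_le_mul_of_nonneg_left hA1 (by positivity : 0 ≤ A ^ 2 * H)
        nlinarith
      have : 0 ≤ A ^ 3 * H := by positivity
      have : 0 ≤ A ^ 3 * (N * H ^ 2) := by positivity
      rw [hε]
      nlinarith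
    have h3 : 0 ≤ b - a := by linarith
    calc ε * 1 * (b - a) * (2 - -1) ≤ ε * 1 * 1 * (2 - -1) := by gcongr
      _ = 3 * ε := by ring
      _ ≤ _ := by linarith
  · obtain ⟨⟨k, t⟩, x⟩ := q
    simp only
    by_cases hne : w k ≠ 0 ∧ ψ t ≠ 0 ∧ d x ≠ 0
    · obtain ⟨h1, h2, h3⟩ := box k t x hne
      rw [Set.indicator_of_mem h2, Set.indicator_of_mem h3, mul_one, mul_one]
      have hk2 : k ^ 2 ≤ H ^ 2 := by rw [← sq_abs]; gcongr
      have hlin := h.lin t h2 k (h1.trans hH)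
      have hψ' : |ψ (t + k) - ψ t| ≤ A * H := by
        refine (h.ψ_bl.2 _ _).trans ?_
        rw [add_sub_cancel_left]; gcongr
      have hlin2 : N * |φ (t + k) - φ t - p t * k| ≤ N * (A * H ^ 2) := by
        gcongr
        exact hlin.trans (by gcongr)
      have hd' : |d (x + φ t - φ (t + k)) - d (x - p t * k)| ≤ N * (A * H ^ 2) := by
        refine (hd.lip _ _).trans (le_trans (le_of_eq ?_) hlin2)
        rw [← abs_neg]; ring_nf
      have hg' : |g (x + φ t + (t + k) - φ (t + k)) - g (x + t + (1 - p t) * k)|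
          ≤ N * (A * H ^ 2) := by
        refine (hgl _ _).trans (le_trans (le_of_eq ?_) hlin2)
        rw [← abs_neg]; ring_nf
      set d₁ := d (x + φ t - φ (t + k))
      set d₀ := d (x - p t * k)
      set g₁ := g (x + φ t + (t + k) - φ (t + k))
      set g₀ := g (x + t + (1 - p t) * k)
      have e2 : f₁ k t x - f₀ k t x = w k * (ψ t * (d x * g (x + t)) *
          ((ψ (t + k) - ψ t) * (d₁ * g₁) + ψ t * g₁ * (d₁ - d₀) + ψ t * d₀ * (g₁ - g₀))) := by
        simp only [hf₁, hf₀]; ring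
      rw [e2, abs_mul, abs_of_nonneg (hw0 k), mul_comm ε]
      refine mul_le_mul_of_nonneg_left ?_ (hw0 k)
      rw [abs_mul]
      have hd1 := hd.bdd
      have hg1 := hg.bdd
      have hψ1 := h.ψ_bl.1
      have f1 : |ψ t * (d x * g (x + t))| ≤ A := by
        rw [abs_mul, abs_mul]
        calc |ψ t| * (|d x| * |g (x + t)|) ≤ A * (1 * 1) := by
              gcongr; exacts [hψ1 t, hd1 _, hg1 _]
          _ = A := by ring
      have f2 : |(ψ (t + k) - ψ t) * (d₁ * g₁) + ψ t * g₁ * (d₁ - d₀) + ψ t * d₀ * (g₁ - g₀)| ≤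
          A * H + A * (N * (A * H ^ 2)) + A * (N * (A * H ^ 2)) := by
        refine (abs_add_three _ _ _).trans ?_
        simp only [abs_mul]
        calc |ψ (t + k) - ψ t| * (|d₁| * |g₁|) + |ψ t| * |g₁| * |d₁ - d₀| + |ψ t| * |d₀| * |g₁ - g₀|
            ≤ (A * H) * (1 * 1) + A * 1 * (N * (A * H ^ 2)) + A * 1 * (N * (A * H ^ 2)) := by
              gcongr
              exacts [hd1 _, hg1 _, hψ1 t, hg1 _, hψ1 t, hd1 _]
          _ = _ := by ring
      calc _ ≤ A * (A * H + A * (N * (A * H ^ 2)) + A * (N * (A * H ^ 2))) :=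
            mul_le_mul f1 f2 (abs_nonneg _) hA.le
        _ = ε := by rw [hε]; ring
    · have e2 : f₁ k t x - f₀ k t x = 0 := by
        have : w k = 0 ∨ ψ t = 0 ∨ d x = 0 := by tauto
        simp only [hf₁, hf₀]
        rcases this with h0 | h0 | h0 <;> simp [h0]
      rw [e2, abs_zero]
      have := hw0 k
      refine mul_nonneg (mul_nonneg (by positivity) ?_) ?_ <;>
        exact Set.indicator_nonneg (fun _ _ => zero_le_one) _

/-- Smoothing: the trilinear form decays in the frequency of `d`. -/
theorem exists_smoothing (h : PhaseData A a b φ ψ p qi ρ ρi κ') :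
    ∃ C, 0 ≤ C ∧ ∀ N d g g', 1 ≤ N → Oscillating N d → UnitBump g → UnitBump g' →
      (∀ x y, |g x - g y| ≤ N * |x - y|) →
      |∫ t, ψ t * ∫ x, d x * g (x + t) * g' (x + φ t)| ≤ C * N ^ (-(1 / 24) : ℝ) := by
  obtain ⟨C, hC, hlinb⟩ := h.exists_linearised_bound
  have hA := h.pos
  have hlt := h.lt
  have hlen := h.len
  set L := b - a with hL
  have hL0 : 0 < L := by linarith
  set C₁ := C * L ^ (-(1 / 2) : ℝ) with hC₁
  have hC₁0 : 0 ≤ C₁ := by positivity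
  refine ⟨Real.sqrt (4 * (2 + A) * (Real.sqrt C₁ + 18 * A ^ 3)), by positivity,
    fun N d g g' hN hd hg hg' hgl => ?_⟩
  have hN0 : 0 < N := zero_lt_one.trans_le hN
  set H := L * N ^ (-(2 / 3) : ℝ) with hHd
  have hNle : N ^ (-(2 / 3) : ℝ) ≤ 1 := Real.rpow_le_one_of_one_le_of_nonpos hN (by norm_num)
  have hH0 : 0 < H := by positivity
  have hHL : H ≤ L := mul_le_of_le_one_right hL0.le hNle
  have hψc := h.ψ_bl.continuous
  have hφc := h.φ_cont
  have hdc := hd.cont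
  have hgc := hg.cont
  have hg'c := hg'.cont
  set F : ℝ → ℝ → ℝ := fun t y => ψ t * (d (y - φ t) * g (y + t - φ t)) with hF
  set E := N ^ (-(1 / 12) : ℝ) with hE
  have hE0 : 0 < E := by positivity
  have vdc := sq_integral_le_of_shift_correlation (F := F) (g := g') (χ := tent H) (a := a) (b := b)
    (H := H) (R := 2 + A) (S := (Real.sqrt C₁ + 18 * A ^ 3) * E)
    (by simp only [hF, Function.uncurry_def]; fun_prop) (by positivity) (fun t y hne => by
      simp only [hF, mul_ne_zero_iff] at hne
      have h1 := hd.supp _ hne.2.1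
      have h2 := abs_le.1 (h.φ_bdd t)
      exact ⟨h.ψ_supp t hne.1, abs_le.2 ⟨by linarith [h1.1], by linarith [h1.2]⟩⟩)
    hlt.le hlen hH0 (hHL.trans hlen) hg'c hg'.bdd tent_continuous tent_nonneg
    (fun x hx => tent_support hH0 x hx) (tent_integral hH0) (fun s hs => ?_)
  · have e0 : ∫ t, ψ t * ∫ x, d x * g (x + t) * g' (x + φ t) = ∫ t, ∫ y, F t y * g' y := by
      refine integral_congr_ae (Filter.Eventually.of_forall fun t => ?_)
      simp only
      rw [← integral_const_mul, ← integral_sub_right_eq_self _ (φ t)]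
      refine integral_congr_ae (Filter.Eventually.of_forall fun y => ?_)
      simp only [hF]
      rw [sub_add_cancel, sub_add_eq_add_sub]
      ring
    rw [e0]
    have hEs : E = (N ^ (-(1 / 24) : ℝ)) ^ 2 := by
      rw [hE, ← Real.rpow_natCast, ← Real.rpow_mul hN0.le]; norm_num
    refine abs_le_of_sq_le_sq ?_ (by positivity)
    refine vdc.trans (le_of_eq ?_)
    rw [mul_pow, Real.sq_sqrt (by positivity), hEs]
    ring
  · set w : ℝ → ℝ := fun k => tent H (k + s) with hw
    have hws : ScaleWeight H w := by
      refine ⟨hH0, fun k hk => ?_, fun k => ?_, fun k l => ?_⟩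
      · by_contra hne
        have h1 := tent_support hH0 _ hne
        have : |k| ≤ H := abs_le.2 ⟨by linarith [h1.1, hs.2], by linarith [h1.2, hs.1]⟩
        linarith
      · rw [abs_of_nonneg (tent_nonneg _)]
        refine (tent_le hH0 _).trans ?_
        gcongr; norm_num
      · simpa [hw] using tent_lip hH0 (k + s) (l + s)
    have hw1 : ∫ k, w k = 1 := by
      rw [hw, integral_add_right_eq_self (fun k => tent H k) s, tent_integral hH0]
    have d1 := h.abs_correlation_sub_linearised_le hws (fun k => tent_nonneg _) hw1 hHL hN hd hg hgl
    have d2 := hlinb H w N d g hws hN hd hg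
    set S₀ := ∫ k, ∫ t, ∫ x, w k * (ψ t * ψ t * (d x * d (x - p t * k) *
        (g (x + t) * g (x + t + (1 - p t) * k))))
    have e1 : C * (N ^ (-(1 / 2) : ℝ) * H ^ (-(1 / 2) : ℝ)) = C₁ * E ^ 2 := by
      rw [hHd, Real.mul_rpow hL0.le (by positivity), ← Real.rpow_mul hN0.le, hC₁, hE,
        ← Real.rpow_natCast, ← Real.rpow_mul hN0.le]
      have : N ^ (-(1 / 2) : ℝ) * N ^ (-(2 / 3) * -(1 / 2) : ℝ) = N ^ (-(1 / 12) * (2 : ℕ) : ℝ) := by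
        rw [← Real.rpow_add hN0]; norm_num
      rw [← this]; ring
    have d3 : |S₀| ≤ Real.sqrt C₁ * E := by
      refine abs_le_of_sq_le_sq ?_ (by positivity)
      rw [mul_pow, Real.sq_sqrt hC₁0, ← e1]
      exact d2
    have d4 : H ≤ E := by
      refine (mul_le_of_le_one_left (by positivity) hlen).trans ?_
      exact Real.rpow_le_rpow_of_exponent_le hN (by norm_num)
    have d5 : N * H ^ 2 ≤ E := by
      have : N * H ^ 2 = L ^ 2 * N ^ (-(1 / 3) : ℝ) := by
        rw [hHd, mul_pow, ← Real.rpow_natCast (N ^ _), ← Real.rpow_mul hN0.le]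
        have : N * N ^ (-(2 / 3) * (2 : ℕ) : ℝ) = N ^ (-(1 / 3) : ℝ) := by
          nth_rewrite 1 [← Real.rpow_one N]
          rw [← Real.rpow_add hN0]; norm_num
        rw [← this]; ring
      rw [this]
      refine (mul_le_of_le_one_left (by positivity) (pow_le_one₀ hL0.le hlen)).trans ?_
      exact Real.rpow_le_rpow_of_exponent_le hN (by norm_num)
    have d6 : 9 * A ^ 3 * (H + N * H ^ 2) ≤ 9 * A ^ 3 * (E + E) := by gcongr
    have d7 := abs_sub_abs_le_abs_sub (∫ k, w k * ∫ t, ∫ y, F t y * F (t + k) y) S₀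
    have d8 := d7.trans d1
    calc |∫ k, w k * ∫ t, ∫ y, F t y * F (t + k) y| ≤ Real.sqrt C₁ * E + 9 * A ^ 3 * (E + E) := by
          linarith
      _ = _ := by ring

end PhaseData

/-- Truncation to the interval of radius `δ` about `s₀`. -/
noncomputable def clamp (s₀ δ t : ℝ) : ℝ := max (s₀ - δ) (min (s₀ + δ) t)

section clamp

variable {s₀ δ : ℝ}

lemma clamp_mem (hδ : 0 ≤ δ) (t : ℝ) : clamp s₀ δ t ∈ Set.Icc (s₀ - δ) (s₀ + δ) :=
  ⟨le_max_left _ _, max_le (by linarith) (min_le_left _ _)⟩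

lemma clamp_of_mem {t : ℝ} (ht : t ∈ Set.Icc (s₀ - δ) (s₀ + δ)) : clamp s₀ δ t = t := by
  rw [clamp, min_eq_right ht.2, max_eq_right ht.1]

lemma clamp_lip (t s : ℝ) : |clamp s₀ δ t - clamp s₀ δ s| ≤ |t - s| :=
  ((abs_max_sub_max_le_max _ _ _ _).trans (by simp)).trans
    ((abs_min_sub_min_le_max (s₀ + δ) t (s₀ + δ) s).trans (by simp))

lemma BddLip.comp_clamp {A : ℝ} {f : ℝ → ℝ} (hδ : 0 ≤ δ) (hA : 0 ≤ A)
    (h : ∀ x ∈ Set.Icc (s₀ - δ) (s₀ + δ), |f x| ≤ A ∧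
      ∀ y ∈ Set.Icc (s₀ - δ) (s₀ + δ), |f x - f y| ≤ A * |x - y|) :
    BddLip A fun t => f (clamp s₀ δ t) :=
  ⟨fun t => (h _ (clamp_mem hδ t)).1, fun t s =>
    ((h _ (clamp_mem hδ t)).2 _ (clamp_mem hδ s)).trans
      (mul_le_mul_of_nonneg_left (clamp_lip t s) hA)⟩

lemma eventually_clamp_eq {t : ℝ} (ht : t ∈ Set.Ioo (s₀ - δ) (s₀ + δ)) :
    ∀ᶠ s in nhds t, clamp s₀ δ s = s := by
  filter_upwards [Ioo_mem_nhds ht.1 ht.2] with s hs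
  exact clamp_of_mem ⟨hs.1.le, hs.2.le⟩

end clamp

lemma exists_Icc_of_eventually {P : ℝ → Prop} {s₀ : ℝ} (h : ∀ᶠ s in nhds s₀, P s) :
    ∀ᶠ δ in nhdsWithin (0 : ℝ) (Set.Ioi 0), ∀ x ∈ Set.Icc (s₀ - δ) (s₀ + δ), P x := by
  obtain ⟨ε, hε, h⟩ := Metric.eventually_nhds_iff.1 h
  filter_upwards [Ioo_mem_nhdsGT hε] with δ hδ x hx
  refine h ?_
  rw [Real.dist_eq, abs_lt]
  exact ⟨by linarith [hx.1, hδ.2], by linarith [hx.2, hδ.2]⟩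

lemma AnalyticAt.exists_bound_lip {f : ℝ → ℝ} {s₀ : ℝ} (hf : AnalyticAt ℝ f s₀) :
    ∃ A, 0 ≤ A ∧ ∀ᶠ δ in nhdsWithin (0 : ℝ) (Set.Ioi 0), ∀ x ∈ Set.Icc (s₀ - δ) (s₀ + δ),
      |f x| ≤ A ∧ ∀ y ∈ Set.Icc (s₀ - δ) (s₀ + δ), |f x - f y| ≤ A * |x - y| := by
  obtain ⟨K, U, hU, hK⟩ := (hf.contDiffAt (n := 1)).exists_lipschitzOnWith
  have h1 : ∀ᶠ s in nhds s₀, |f s| < |f s₀| + 1 :=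
    hf.continuousAt.abs.eventually (gt_mem_nhds (lt_add_one _))
  refine ⟨|f s₀| + 1 + K, by positivity, ?_⟩
  filter_upwards [exists_Icc_of_eventually h1, exists_Icc_of_eventually hU] with δ hδ1 hδ2 x hx
  have hK0 : (0 : ℝ) ≤ K := K.2
  refine ⟨(hδ1 x hx).le.trans (by linarith), fun y hy => ?_⟩
  refine (hK.dist_le_mul x (hδ2 x hx) y (hδ2 y hy)).trans ?_
  rw [Real.dist_eq]
  gcongr
  linarith [abs_nonneg (f s₀)]

lemma abs_sub_sub_mul_le {f f' : ℝ → ℝ} {m K x y : ℝ}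
    (h : ∀ u ∈ Set.uIcc x y, HasDerivAt f (f' u) u ∧ |f' u - m| ≤ K) :
    |f y - f x - m * (y - x)| ≤ K * |y - x| := by
  have := (convex_uIcc x y).norm_image_sub_le_of_norm_hasDerivWithin_le
    (f := fun u => f u - m * u) (f' := fun u => f' u - m) (C := K)
    (fun u hu => ((h u hu).1.sub ((hasDerivAt_id u).const_mul m)).hasDerivWithinAt.congr_deriv
      (by simp)) (fun u hu => (h u hu).2)
    Set.left_mem_uIcc Set.right_mem_uIcc
  rw [Real.norm_eq_abs, Real.norm_eq_abs] at this
  convert this using 2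
  ring

lemma abs_mul_sub_mul_le {u u' v v' U U' V V' : ℝ} (hU : |u| ≤ U) (hU' : |u - u'| ≤ U')
    (hV : |v'| ≤ V) (hV' : |v - v'| ≤ V') : |u * v - u' * v'| ≤ U * V' + U' * V := by
  have : u * v - u' * v' = u * (v - v') + (u - u') * v' := by ring
  rw [this]
  refine (abs_add_le _ _).trans ?_
  rw [abs_mul, abs_mul]
  have := (abs_nonneg _).trans hU
  have := (abs_nonneg _).trans hU'
  gcongr

theorem exists_smoothing_of_curve {φ p l l₁ : ℝ → ℝ} {s₀ : ℝ} (hφ : AnalyticAt ℝ φ s₀)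
    (hp : AnalyticAt ℝ p s₀) (hl : AnalyticAt ℝ l s₀) (hl₁ : AnalyticAt ℝ l₁ s₀)
    (hp0 : p s₀ ≠ 0) (hp1 : 1 - p s₀ ≠ 0) (hl0 : l₁ s₀ ≠ 0)
    (hφ' : ∀ᶠ s in nhds s₀, HasDerivAt φ (p s) s)
    (hρ' : ∀ᶠ s in nhds s₀,
      HasDerivAt (fun s => p s * (1 - p s)⁻¹) (p s * (1 - p s)⁻¹ * l s) s)
    (hl' : ∀ᶠ s in nhds s₀, HasDerivAt l (l₁ s) s) :
    ∃ δ, 0 < δ ∧ ∀ a b B ψ, a < b → Set.Icc a b ⊆ Set.Icc (s₀ - δ) (s₀ + δ) → BddLip B ψ →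
      (∀ s, ψ s ≠ 0 → s ∈ Set.Icc a b) → ∃ C, 0 ≤ C ∧ ∀ N d g g', 1 ≤ N → Oscillating N d →
        UnitBump g → UnitBump g' → (∀ x y, |g x - g y| ≤ N * |x - y|) →
        |∫ t, ψ t * ∫ x, d x * g (x + t) * g' (x + φ t)| ≤ C * N ^ (-(1 / 24) : ℝ) := by
  have hqi : AnalyticAt ℝ (fun s => (1 - p s)⁻¹) s₀ := (analyticAt_const.sub hp).inv hp1
  have hρ : AnalyticAt ℝ (fun s => p s * (1 - p s)⁻¹) s₀ := hp.mul hqi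
  set ρ := fun s => p s * (1 - p s)⁻¹ with hρd
  have hρ0 : ρ s₀ ≠ 0 := mul_ne_zero hp0 (inv_ne_zero hp1)
  have hρi : AnalyticAt ℝ (fun s => (ρ s)⁻¹) s₀ := hρ.inv hρ0
  have hc : 0 < |l₁ s₀| := abs_pos.2 hl0
  have hl1c : ∀ᶠ s in nhds s₀, |l₁ s - l₁ s₀| ≤ |l₁ s₀| / 2 := by
    have : ContinuousAt (fun s => |l₁ s - l₁ s₀|) s₀ :=
      (hl₁.continuousAt.sub continuousAt_const).abs
    exact this.eventually (Iic_mem_nhds (by simp [hl0]))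
  have hpe : ∀ᶠ s in nhds s₀, p s ≠ 0 := hp.continuousAt.eventually_ne hp0
  have hqe : ∀ᶠ s in nhds s₀, 1 - p s ≠ 0 :=
    (continuousAt_const.sub hp.continuousAt).eventually_ne hp1
  have hall := (hφ'.and (hρ'.and (hl'.and (hl1c.and (hpe.and hqe)))))
  obtain ⟨A₁, hA₁, e₁⟩ := hφ.exists_bound_lip
  obtain ⟨A₂, hA₂, e₂⟩ := hp.exists_bound_lip
  obtain ⟨A₃, hA₃, e₃⟩ := hl.exists_bound_lip
  obtain ⟨A₄, hA₄, e₄⟩ := hl₁.exists_bound_lip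
  obtain ⟨A₅, hA₅, e₅⟩ := hqi.exists_bound_lip
  obtain ⟨A₆, hA₆, e₆⟩ := hρ.exists_bound_lip
  obtain ⟨A₇, hA₇, e₇⟩ := hρi.exists_bound_lip
  obtain ⟨δ, hδall, f₁, f₂, f₃, f₄, f₅, f₆, f₇, hδ⟩ := ((exists_Icc_of_eventually hall).and
    (e₁.and (e₂.and (e₃.and (e₄.and (e₅.and (e₆.and (e₇.and
      (Ioo_mem_nhdsGT (show (0 : ℝ) < 1 by norm_num)))))))))).exists
  have hδ0 : 0 < δ := hδ.1
  set c := clamp s₀ δ with hcd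
  refine ⟨δ / 4, by positivity, fun a b B ψ hab hsub hψ hψs => ?_⟩
  have hB := hψ.nonneg
  have hmem : ∀ t ∈ Set.Icc a b, t ∈ Set.Ioo (s₀ - δ) (s₀ + δ) := fun t ht => by
    have := hsub ht
    exact ⟨by linarith [this.1], by linarith [this.2]⟩
  have hlen : b - a ≤ δ / 2 := by
    have h1 := hsub (Set.left_mem_Icc.2 hab.le)
    have h2 := hsub (Set.right_mem_Icc.2 hab.le)
    linarith [h1.1, h2.2]
  have hmem' : ∀ t ∈ Set.Icc a b, ∀ k, |k| ≤ b - a → t + k ∈ Set.Ioo (s₀ - δ) (s₀ + δ) := by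
    intro t ht k hk
    have := hsub ht
    have := abs_le.1 (hk.trans hlen)
    constructor <;> linarith [(hsub ht).1, (hsub ht).2]
  have hceq : ∀ t ∈ Set.Ioo (s₀ - δ) (s₀ + δ), c t = t := fun t ht =>
    clamp_of_mem ⟨ht.1.le, ht.2.le⟩
  have hsm : ∀ {t}, t ∈ Set.Ioo (s₀ - δ) (s₀ + δ) → t ∈ Set.Icc (s₀ - δ) (s₀ + δ) :=
    fun ht => ⟨ht.1.le, ht.2.le⟩
  have hcm := clamp_mem (s₀ := s₀) hδ0.le
  have g₁ := BddLip.comp_clamp hδ0.le hA₁ f₁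
  have g₂ := BddLip.comp_clamp hδ0.le hA₂ f₂
  have g₅ := BddLip.comp_clamp hδ0.le hA₅ f₅
  have g₆ := BddLip.comp_clamp hδ0.le hA₆ f₆
  have g₇ := BddLip.comp_clamp hδ0.le hA₇ f₇
  set m := |l₁ s₀| with hm
  have hseg : ∀ x ∈ Set.Ioo (s₀ - δ) (s₀ + δ), ∀ y ∈ Set.Ioo (s₀ - δ) (s₀ + δ),
      ∀ u ∈ Set.uIcc x y, u ∈ Set.Ioo (s₀ - δ) (s₀ + δ) := fun x hx y hy u hu =>
    (Set.ordConnected_Ioo.uIcc_subset hx hy) hu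
  have hlge : ∀ x ∈ Set.Ioo (s₀ - δ) (s₀ + δ), ∀ y ∈ Set.Ioo (s₀ - δ) (s₀ + δ),
      m / 2 * |y - x| ≤ |l y - l x| := by
    intro x hx y hy
    have := abs_sub_sub_mul_le (f := l) (f' := l₁) (m := l₁ s₀) (K := m / 2) (x := x) (y := y)
      fun u hu => by
        have := hδall u (hsm (hseg x hx y hy u hu))
        exact ⟨this.2.2.1, this.2.2.2.1⟩
    have h2 := abs_sub_abs_le_abs_sub (l₁ s₀ * (y - x)) (l y - l x)
    rw [abs_sub_comm (l₁ s₀ * _), abs_mul, ← hm] at h2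
    linarith
  set A := 1 + B + A₁ + A₂ + A₅ + A₆ + A₇ + A₆ * A₇ * (2 / m) + (A₆ * A₇ * A₄ +
    2 * A₆ * A₇ * A₄) with hA
  have hX1 : 0 ≤ A₆ * A₇ * (2 / m) := by positivity
  have hX2 : 0 ≤ A₆ * A₇ * A₄ + 2 * A₆ * A₇ * A₄ := by positivity
  have hA0 : 0 < A := by positivity
  have hρρ : ∀ t, ρ (c t) * (ρ (c t))⁻¹ = 1 := fun t => by
    have := hδall _ (hcm t)
    exact mul_inv_cancel₀ (mul_ne_zero this.2.2.2.2.1 (inv_ne_zero this.2.2.2.2.2))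
  let κ : ℝ → ℝ → ℝ := fun τ t => ρ (c (t + τ)) * (ρ (c t))⁻¹ * (l (t + τ) - l t)
  have key : PhaseData A a b (fun t => φ (c t)) ψ (fun t => p (c t)) (fun t => (1 - p (c t))⁻¹)
      (fun t => ρ (c t)) (fun t => (ρ (c t))⁻¹) κ := by
    refine ⟨by linarith, hab, by linarith [hδ.2], g₁.continuous,
      fun t => (g₁.1 t).trans (by linarith), fun t ht k hk => ?_, hψ.mono (by linarith), hψs,
      g₂.continuous, fun t => ?_, g₅.mono (by linarith), g₆.continuous,
      fun t => (g₆.1 t).trans (by linarith), g₇.mono (by linarith), fun t => ?_, hρρ,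
      fun t => rfl, fun t ht τ hτ => ?_, fun t ht τ hτ => ?_, fun t ht s hs τ hτ => ?_⟩
    · have h1 := hmem t ht
      have h2 := hmem' t ht k hk
      have := abs_sub_sub_mul_le (f := φ) (f' := p) (m := p t) (K := A₂ * |k|) (x := t)
        (y := t + k) fun u hu => by
          have h3 := hsm (hseg _ h1 _ h2 u hu)
          refine ⟨(hδall u h3).1, ((f₂ u h3).2 t (hsm h1)).trans ?_⟩
          refine mul_le_mul_of_nonneg_left ?_ hA₂
          simpa only [add_sub_cancel_left] using Set.abs_sub_left_of_mem_uIcc hu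
      simp only [hceq _ h1, hceq _ h2]
      rw [add_sub_cancel_left] at this
      refine this.trans ?_
      rw [mul_assoc, ← abs_mul, abs_mul_self, ← sq]
      gcongr
      linarith
    · refine (abs_sub _ _).trans ?_
      rw [abs_one]
      linarith [g₂.1 t]
    · exact mul_inv_cancel₀ (hδall _ (hcm t)).2.2.2.2.2
    · have h1 := hmem t ht
      have h2 := hmem' t ht τ hτ
      have d1 : HasDerivAt (fun s => ρ (s + τ)) (ρ (t + τ) * l (t + τ)) t :=
        HasDerivAt.comp_add_const t τ (hδall _ (hsm h2)).2.1
      have d2 := (hδall _ (hsm h1)).2.1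
      have hne := mul_ne_zero (hδall _ (hsm h1)).2.2.2.2.1
        (inv_ne_zero (hδall _ (hsm h1)).2.2.2.2.2)
      have d3 := d1.mul (d2.inv hne)
      have d4 : HasDerivAt (fun s => ρ (s + τ) * (ρ s)⁻¹) (κ τ t) t := by
        refine d3.congr_deriv ?_
        simp only [κ, hceq _ h1, hceq _ h2]
        change ρ t ≠ 0 at hne
        change ρ (t + τ) * l (t + τ) * (ρ t)⁻¹ + ρ (t + τ) * (-(ρ t * l t) / ρ t ^ 2) = _
        field_simp
        ring
      refine d4.congr_of_eventuallyEq ?_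
      have t1 : Filter.Tendsto (fun s => s + τ) (nhds t) (nhds (t + τ)) :=
        (continuous_add_const τ).tendsto t
      filter_upwards [eventually_clamp_eq h1, t1.eventually (eventually_clamp_eq h2)] with s i1 i2
      simp only [hcd, i1, i2]
    · have h1 := hmem t ht
      have h2 := hmem' t ht τ hτ
      have h3 := hlge _ h1 _ h2
      rw [add_sub_cancel_left] at h3
      have h4 : 1 ≤ |ρ (c (t + τ)) * (ρ (c t))⁻¹| * (A₆ * A₇) := by
        have h5 : ρ (c (t + τ)) * (ρ (c t))⁻¹ * (ρ (c t) * (ρ (c (t + τ)))⁻¹) = 1 := by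
          rw [← one_mul (1 : ℝ)]
          nth_rewrite 1 [← hρρ (t + τ)]
          nth_rewrite 1 [← hρρ t]
          ring
        rw [← abs_one, ← h5, abs_mul _ (ρ (c t) * _), abs_mul (ρ (c t))]
        gcongr
        exacts [g₆.1 t, g₇.1 (t + τ)]
      simp only [κ]
      rw [abs_mul, div_le_iff₀ hA0]
      calc |τ| ≤ |τ| * (|ρ (c (t + τ)) * (ρ (c t))⁻¹| * (A₆ * A₇)) :=
            le_mul_of_one_le_right (abs_nonneg _) h4
        _ = |ρ (c (t + τ)) * (ρ (c t))⁻¹| * (m / 2 * |τ|) * (A₆ * A₇ * (2 / m)) := by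
            field_simp
        _ ≤ _ := by
            gcongr
            linarith
    · have h1 := hmem t ht
      have h2 := hmem s hs
      have h3 := hmem' t ht τ hτ
      have h4 := hmem' s hs τ hτ
      have hv : |l (s + τ) - l s| ≤ A₄ * |τ| := by
        have := abs_sub_sub_mul_le (f := l) (f' := l₁) (m := 0) (K := A₄) (x := s)
          (y := s + τ) fun u hu => by
            have h5 := hsm (hseg _ h2 _ h4 u hu)
            refine ⟨(hδall u h5).2.2.1, ?_⟩
            rw [sub_zero]
            exact (f₄ u h5).1
        simpa using this
      have hvv : |(l (t + τ) - l t) - (l (s + τ) - l s)| ≤ A₄ * |τ| * |t - s| := by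
        refine abs_sub_sub_mul_le (f := fun u => l (u + τ) - l u)
          (f' := fun u => l₁ (u + τ) - l₁ u) (m := 0) (K := A₄ * |τ|) (x := s)
          (y := t) (fun u hu => ?_) |>.trans' (by simp)
        have hu' : u ∈ Set.Icc a b := Set.ordConnected_Icc.uIcc_subset hs ht hu
        have h5 := hsm (hmem u hu')
        have h6 := hsm (hmem' u hu' τ hτ)
        refine ⟨(HasDerivAt.comp_add_const u τ (hδall _ h6).2.2.1).sub (hδall _ h5).2.2.1, ?_⟩
        have := (f₄ _ h6).2 _ h5
        rwa [add_sub_cancel_left, ← sub_zero (l₁ (u + τ) - l₁ u)] at this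
      have hu : |ρ (c (t + τ)) * (ρ (c t))⁻¹| ≤ A₆ * A₇ := by
        rw [abs_mul]
        gcongr
        exacts [g₆.1 _, g₇.1 _]
      have huu := ((g₆.comp_add_const τ).mul g₇).2 t s
      simp only [κ]
      refine (abs_mul_sub_mul_le hu huu hv hvv).trans ?_
      calc A₆ * A₇ * (A₄ * |τ| * |t - s|) + 2 * A₆ * A₇ * |t - s| * (A₄ * |τ|) =
            (A₆ * A₇ * A₄ + 2 * A₆ * A₇ * A₄) * |τ| * |t - s| := by ring
        _ ≤ _ := by
            gcongr
            linarith
  obtain ⟨C, hC, hC'⟩ := key.exists_smoothing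
  refine ⟨C, hC, fun N d g g' hN hd hg hg' hgl => ?_⟩
  refine (hC' N d g g' hN hd hg hg' hgl).trans' (le_of_eq ?_)
  congr 2
  ext t
  by_cases ht : ψ t = 0
  · simp [ht]
  · simp only [hceq _ (hmem t (hψs t ht))]

lemma Polynomial.analyticAt_eval (P : ℝ[X]) (x : ℝ) : AnalyticAt ℝ (fun x => P.eval x) x := by
  simpa using (analyticAt_id (𝕜 := ℝ) (z := x)).aeval_polynomial P

lemma Polynomial.exists_local_inverse (W : ℝ[X]) {t₀ : ℝ} (h : W.derivative.eval t₀ ≠ 0) :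
    ∃ κ : ℝ → ℝ, AnalyticAt ℝ κ (W.eval t₀) ∧ κ (W.eval t₀) = t₀ ∧
      (∀ᶠ s in nhds (W.eval t₀), W.eval (κ s) = s ∧ W.derivative.eval (κ s) ≠ 0 ∧
        HasDerivAt κ (W.derivative.eval (κ s))⁻¹ s) ∧
      ∀ᶠ t in nhds t₀, κ (W.eval t) = t := by
  have hs := (W.hasStrictDerivAt t₀).hasStrictFDerivAt_equiv h
  have hc : ContDiffAt ℝ ⊤ (fun x => W.eval x) t₀ := (W.analyticAt_eval t₀).contDiffAt
  set κ := hs.localInverse with hκ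
  have hκc : ContDiffAt ℝ ⊤ κ (W.eval t₀) := hc.to_localInverse hs.hasFDerivAt (by simp)
  have hκ0 : κ (W.eval t₀) = t₀ := hc.localInverse_apply_image hs.hasFDerivAt (by simp)
  refine ⟨κ, hκc.analyticAt, hκ0, ?_, hs.eventually_left_inverse⟩
  have h1 : ∀ᶠ s in nhds (W.eval t₀), W.eval (κ s) = s := hs.eventually_right_inverse
  have h2 : ∀ᶠ s in nhds (W.eval t₀), W.derivative.eval (κ s) ≠ 0 := by
    have : ContinuousAt (fun s => W.derivative.eval (κ s)) (W.eval t₀) :=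
      W.derivative.continuous.continuousAt.comp hκc.continuousAt
    exact this.eventually_ne (by rwa [hκ0])
  filter_upwards [h1, h2, h1.eventually_nhds, hκc.analyticAt.eventually_analyticAt] with s a b c d
  exact ⟨a, b, HasDerivAt.of_local_left_inverse d.continuousAt (W.hasDerivAt _) b c⟩

lemma abs_intervalIntegral_eq_abs_integral {F : ℝ → ℝ} {u v : ℝ}
    (h : ∀ s, F s ≠ 0 → s ∈ Set.uIoc u v) : |∫ s in u..v, F s| = |∫ s, F s| := by
  rw [intervalIntegral.abs_integral_eq_abs_integral_uIoc,
    setIntegral_eq_integral_of_forall_compl_eq_zero fun s hs => by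
      by_contra h'
      exact hs (h s h')]

lemma continuous_trilinear {d g g' : ℝ → ℝ} {u v : ℝ → ℝ} (hd : Continuous d)
    (hds : ∀ x, d x ≠ 0 → x ∈ Set.Icc (-1) 2) (hg : Continuous g) (hg' : Continuous g')
    (hu : Continuous u) (hv : Continuous v) :
    Continuous fun s => ∫ x, d x * g (x + u s) * g' (x + v s) := by
  have : (fun s => ∫ x, d x * g (x + u s) * g' (x + v s)) =
      fun s => ∫ x in Set.Icc (-1) 2, d x * g (x + u s) * g' (x + v s) := by
    ext s
    refine (setIntegral_eq_integral_of_forall_compl_eq_zero fun x hx => ?_).symm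
    have : d x = 0 := by
      by_contra h
      exact hx (hds x h)
    simp [this]
  rw [this]
  exact continuous_parametric_integral_of_continuous (by fun_prop) isCompact_Icc

/-- A triangular bump. -/
noncomputable def bump (t₀ r t : ℝ) : ℝ := max 0 (r - |t - t₀|)

section bump

variable {t₀ r : ℝ}

lemma bump_nonneg (t : ℝ) : 0 ≤ bump t₀ r t := le_max_left _ _

lemma bump_continuous : Continuous (bump t₀ r) := by unfold bump; fun_prop

lemma bump_supp {t : ℝ} (h : bump t₀ r t ≠ 0) : t ∈ Set.Ioo (t₀ - r) (t₀ + r) := by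
  have : 0 < r - |t - t₀| := by
    by_contra h'
    exact h (max_eq_left (not_lt.1 h'))
  have := abs_lt.1 (sub_pos.1 this)
  constructor <;> linarith

lemma bump_le (hr : 0 ≤ r) (t : ℝ) : bump t₀ r t ≤ r :=
  max_le hr (by linarith [abs_nonneg (t - t₀)])

lemma bump_lip (t s : ℝ) : |bump t₀ r t - bump t₀ r s| ≤ |t - s| := by
  refine (abs_max_sub_max_le_max _ _ _ _).trans ?_
  rw [sub_self, abs_zero, max_eq_right (abs_nonneg _), sub_sub_sub_cancel_left, abs_sub_comm t s]
  refine (abs_abs_sub_abs_le _ _).trans_eq ?_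
  congr 1
  ring

end bump

/-- Numerator of the logarithmic derivative of `Q' / (W' - Q')` along the curve. -/
noncomputable def curvNum (W Q : ℝ[X]) : ℝ[X] :=
  derivative (derivative Q) * (derivative W - derivative Q) -
    derivative Q * (derivative (derivative W) - derivative (derivative Q))

/-- Denominator of the logarithmic derivative of `Q' / (W' - Q')` along the curve. -/
noncomputable def curvDen (W Q : ℝ[X]) : ℝ[X] :=
  derivative W * derivative Q * (derivative W - derivative Q)

/-- The curvature polynomial of a pair. -/
noncomputable def curvPoly (W Q : ℝ[X]) : ℝ[X] :=
  derivative (curvNum W Q) * curvDen W Q - curvNum W Q * derivative (curvDen W Q)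

theorem exists_smoothing_of_pair (W Q : ℝ[X]) {t₀ : ℝ} (hm : (curvDen W Q).eval t₀ ≠ 0)
    (hR : (curvPoly W Q).eval t₀ ≠ 0) :
    ∃ r₀, 0 < r₀ ∧ ∀ r, 0 < r → r ≤ r₀ → ∃ C, 0 ≤ C ∧ ∀ N d g g', 1 ≤ N → Oscillating N d →
      UnitBump g → UnitBump g' → (∀ x y, |g x - g y| ≤ N * |x - y|) →
      |∫ t, bump t₀ r t * ∫ x, d x * g (x + W.eval t) * g' (x + Q.eval t)| ≤
        C * N ^ (-(1 / 24) : ℝ) := by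
  have hm' := hm
  simp only [curvDen, eval_mul, eval_sub, mul_ne_zero_iff] at hm'
  obtain ⟨⟨hW, hQ⟩, hD⟩ := hm'
  obtain ⟨κ, hκa, hκ0, hκr, hκl⟩ := W.exists_local_inverse hW
  set s₀ := W.eval t₀ with hs₀
  have han : ∀ P : ℝ[X], AnalyticAt ℝ (fun s => P.eval (κ s)) s₀ := fun P =>
    (P.analyticAt_eval _).comp hκa
  have hne : ∀ P : ℝ[X], P.eval t₀ ≠ 0 → ∀ᶠ s in nhds s₀, P.eval (κ s) ≠ 0 := fun P hP =>
    (han P).continuousAt.eventually_ne (by rwa [hκ0])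
  have hder : ∀ᶠ s in nhds s₀, ∀ P : ℝ[X], HasDerivAt (fun s => P.eval (κ s))
      (P.derivative.eval (κ s) * (W.derivative.eval (κ s))⁻¹) s := by
    filter_upwards [hκr] with s hs P
    exact (P.hasDerivAt _).comp s hs.2.2
  have hW0 : W.derivative.eval (κ s₀) ≠ 0 := by rwa [hκ0]
  have hQ0 : Q.derivative.eval (κ s₀) ≠ 0 := by rwa [hκ0]
  have hD0 : W.derivative.eval (κ s₀) - Q.derivative.eval (κ s₀) ≠ 0 := by rwa [hκ0]
  have hm0 : (curvDen W Q).eval (κ s₀) ≠ 0 := by rwa [hκ0]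
  obtain ⟨δ, hδ, hsm⟩ := exists_smoothing_of_curve (s₀ := s₀) (φ := fun s => Q.eval (κ s))
    (p := fun s => Q.derivative.eval (κ s) * (W.derivative.eval (κ s))⁻¹)
    (l := fun s => (curvNum W Q).eval (κ s) * ((curvDen W Q).eval (κ s))⁻¹)
    (l₁ := fun s => (curvPoly W Q).eval (κ s) * ((curvDen W Q).eval (κ s) ^ 2)⁻¹ *
      (W.derivative.eval (κ s))⁻¹)
    (han Q) ((han _).mul ((han _).inv hW0)) ((han _).mul ((han _).inv hm0))
    (((han _).mul (((han _).pow 2).inv (pow_ne_zero 2 hm0))).mul ((han _).inv hW0))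
    (mul_ne_zero hQ0 (inv_ne_zero hW0))
    (by
      intro h
      apply hD0
      field_simp at h
      rwa [mul_zero] at h)
    (by
      rw [hκ0] at hm0 hW0 ⊢
      exact mul_ne_zero (mul_ne_zero hR (inv_ne_zero (pow_ne_zero 2 hm0))) (inv_ne_zero hW0))
    (by
      filter_upwards [hder] with s hs
      exact hs Q)
    (by
      have hev := (hne _ hW).and ((hne _ hQ).and (hne (derivative W - derivative Q)
        (by simpa using hD)))
      have hev' := hev.eventually_nhds
      filter_upwards [hder, hev', hev] with s hs h1 h2
      have e1 : (fun s => Q.derivative.eval (κ s) * (W.derivative.eval (κ s))⁻¹ *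
          (1 - Q.derivative.eval (κ s) * (W.derivative.eval (κ s))⁻¹)⁻¹) =ᶠ[nhds s]
          fun s => Q.derivative.eval (κ s) / (derivative W - derivative Q).eval (κ s) := by
        filter_upwards [h1] with u hu
        obtain ⟨u1, u2, u3⟩ := hu
        rw [eval_sub] at u3 ⊢
        have : 1 - Q.derivative.eval (κ u) * (W.derivative.eval (κ u))⁻¹ =
          (W.derivative.eval (κ u) - Q.derivative.eval (κ u)) / W.derivative.eval (κ u) := by
          field_simp
        rw [this]
        field_simp
      rw [e1.eq_of_nhds]
      refine (((hs _).div (hs (derivative W - derivative Q)) h2.2.2).congr_deriv ?_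
        ).congr_of_eventuallyEq e1
      obtain ⟨u1, u2, u3⟩ := h2
      simp only [curvNum, curvDen, eval_mul, eval_sub, derivative_sub] at u3 ⊢
      field_simp)
    (by
      filter_upwards [hder, hne _ hm, hne _ hW] with s hs h1 h2
      refine ((hs _).mul ((hs (curvDen W Q)).inv h1)).congr_deriv ?_
      simp only [curvPoly, eval_mul, eval_sub, Pi.inv_apply]
      field_simp
      ring)
  obtain ⟨K₁, hK₁, k₁⟩ := hκa.exists_bound_lip
  obtain ⟨K₂, hK₂, k₂⟩ := ((han W.derivative).inv hW0).exists_bound_lip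
  obtain ⟨K₃, hK₃, k₃⟩ := (han Q).exists_bound_lip
  obtain ⟨η, ⟨f₁, f₂, f₃, hηr⟩, hη⟩ := ((k₁.and (k₂.and (k₃.and
    (exists_Icc_of_eventually hκr)))).and (Ioo_mem_nhdsGT hδ)).exists
  have hη0 : 0 < η := hη.1
  set c := clamp s₀ η with hc
  have hcm := clamp_mem (s₀ := s₀) hη0.le
  have g₁ := BddLip.comp_clamp hη0.le hK₁ f₁
  have g₂ := BddLip.comp_clamp hη0.le hK₂ f₂
  have g₃ := BddLip.comp_clamp hη0.le hK₃ f₃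
  have hloc : ∀ᶠ t in nhds t₀, κ (W.eval t) = t ∧ W.eval t ∈ Set.Icc (s₀ - η) (s₀ + η) ∧
      W.derivative.eval t ≠ 0 := by
    refine hκl.and (Filter.Eventually.and ?_ (W.derivative.continuous.continuousAt.eventually_ne hW))
    exact W.continuous.continuousAt.eventually
      (Icc_mem_nhds (sub_lt_self s₀ hη0) (lt_add_of_pos_right s₀ hη0))
  obtain ⟨r₀, hr₀l, hr₀⟩ := ((exists_Icc_of_eventually hloc).and
    (self_mem_nhdsWithin (a := (0 : ℝ)) (s := Set.Ioi 0))).exists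
  refine ⟨r₀, hr₀, fun r hr hrr => ?_⟩
  have hloc : ∀ t ∈ Set.Icc (t₀ - r) (t₀ + r), κ (W.eval t) = t ∧
      W.eval t ∈ Set.Icc (s₀ - η) (s₀ + η) ∧ W.derivative.eval t ≠ 0 := fun t ht =>
    hr₀l t ⟨by linarith [ht.1], by linarith [ht.2]⟩
  set u := t₀ - r with hu
  set v := t₀ + r with hv
  have huv : u < v := by linarith
  have huv' : u ≤ v := huv.le
  have hinj : Set.InjOn (fun t => W.eval t) (Set.Icc u v) := fun x hx y hy hxy => by
    rw [← (hloc x hx).1, ← (hloc y hy).1]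
    exact congrArg κ hxy
  have hmono := W.continuous.continuousOn.strictMonoOn_of_injOn_Icc' huv' hinj
  have hum := Set.left_mem_Icc.2 huv'
  have hvm := Set.right_mem_Icc.2 huv'
  set a := min (W.eval u) (W.eval v) with ha
  set b := max (W.eval u) (W.eval v) with hb
  have hab : a < b := by
    rw [ha, hb, min_lt_max]
    exact fun h => huv.ne (hinj hum hvm h)
  have hWm : ∀ t ∈ Set.Ioo u v, W.eval t ∈ Set.Ioo a b := by
    intro t ht
    have htm : t ∈ Set.Icc u v := ⟨ht.1.le, ht.2.le⟩
    rcases hmono with h | h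
    · have h1 := h hum htm ht.1
      have h2 := h htm hvm ht.2
      exact ⟨(min_le_left _ _).trans_lt h1, h2.trans_le (le_max_right _ _)⟩
    · have h1 := h hum htm ht.1
      have h2 := h htm hvm ht.2
      exact ⟨(min_le_right _ _).trans_lt h2, h1.trans_le (le_max_left _ _)⟩
  have haI : s₀ - η ≤ a := le_min (hloc u hum).2.1.1 (hloc v hvm).2.1.1
  have hbI : b ≤ s₀ + η := max_le (hloc u hum).2.1.2 (hloc v hvm).2.1.2
  have hceq : ∀ s, c s ∈ Set.Ioo a b → c s = s := by
    intro s hs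
    have h1 : s₀ - η < c s := haI.trans_lt hs.1
    have h2 : c s < s₀ + η := hs.2.trans_le hbI
    simp only [hc, clamp] at h1 h2 ⊢
    have h3 := (lt_max_iff.1 h1).resolve_left (lt_irrefl _)
    rw [max_eq_right h3.le] at h2 ⊢
    exact min_eq_right ((min_lt_iff.1 h2).resolve_left (lt_irrefl _)).le
  set ψ : ℝ → ℝ := fun s => bump t₀ r (κ (c s)) * (W.derivative.eval (κ (c s)))⁻¹ with hψ
  have hbl : BddLip (r + K₁) fun s => bump t₀ r (κ (c s)) := by
    refine ⟨fun s => ?_, fun s t => (bump_lip _ _).trans ((g₁.2 s t).trans ?_)⟩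
    · rw [abs_of_nonneg (bump_nonneg _)]
      exact (bump_le hr.le _).trans (by linarith)
    · gcongr
      linarith
  have hψbl := hbl.mul g₂
  have hψs : ∀ s, ψ s ≠ 0 → s ∈ Set.Ioo a b := by
    intro s hs
    have h1 := bump_supp (left_ne_zero_of_mul hs)
    have h2 := hWm _ h1
    rw [(hηr _ (hcm s)).1] at h2
    have h3 : c s ∈ Set.Ioo a b := h2
    rwa [← hceq s h3]
  obtain ⟨C, hC, hC'⟩ := hsm a b _ ψ hab
    (Set.Icc_subset_Icc (by linarith [hη.2]) (by linarith [hη.2])) hψbl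
    fun s hs => Set.Ioo_subset_Icc_self (hψs s hs)
  refine ⟨C, hC, fun N d g g' hN hd hg hg' hgl => ?_⟩
  refine (hC' N d g g' hN hd hg hg' hgl).trans' (le_of_eq ?_)
  set F : ℝ → ℝ := fun s => ψ s * ∫ x, d x * g (x + s) * g' (x + Q.eval (κ (c s))) with hF
  have hFc : Continuous F := by
    refine hψbl.continuous.mul (continuous_trilinear hd.cont hd.supp hg.cont hg'.cont
      continuous_id g₃.continuous)
  have e1 : ∫ s, ψ s * ∫ x, d x * g (x + s) * g' (x + Q.eval (κ s)) = ∫ s, F s := by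
    congr 1
    ext s
    by_cases h : ψ s = 0
    · simp [F, h]
    · have := hψs s h
      have h2 : c s = s := clamp_of_mem ⟨haI.trans this.1.le, this.2.le.trans hbI⟩
      simp only [F, h2]
  have e2 := intervalIntegral.integral_comp_mul_deriv (a := u) (b := v)
    (fun t _ => W.hasDerivAt t) W.derivative.continuous.continuousOn hFc
  have e3 : ∫ t in u..v, (F ∘ fun t => W.eval t) t * W.derivative.eval t =
      ∫ t in u..v, bump t₀ r t * ∫ x, d x * g (x + W.eval t) * g' (x + Q.eval t) := by
    refine intervalIntegral.integral_congr fun t ht => ?_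
    rw [Set.uIcc_of_le huv'] at ht
    obtain ⟨h1, h2, h3⟩ := hloc t ht
    have h4 : c (W.eval t) = W.eval t := clamp_of_mem h2
    simp only [F, ψ, Function.comp, h4, h1]
    field_simp
  rw [e1, ← abs_intervalIntegral_eq_abs_integral (u := u) (v := v), ← e3, e2,
    abs_intervalIntegral_eq_abs_integral]
  · intro s hs
    have := hψs s (left_ne_zero_of_mul hs)
    exact ⟨this.1, this.2.le⟩
  · intro t ht
    have := bump_supp (left_ne_zero_of_mul ht)
    rw [Set.uIoc_of_le huv']
    exact Set.Ioo_subset_Ioc_self this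

lemma natDegree_eq_of_wronskian_eq_zero {f g : ℝ[X]} (hf : f ≠ 0) (hg : g ≠ 0)
    (h : derivative f * g = f * derivative g) : f.natDegree = g.natDegree := by
  by_cases hf' : derivative f = 0
  · have hg' : derivative g = 0 := by
      rw [hf', zero_mul] at h
      exact (mul_eq_zero.1 h.symm).resolve_left hf
    rw [derivative_eq_zero.1 hf', derivative_eq_zero.1 hg']
  have := congrArg leadingCoeff h
  rw [leadingCoeff_mul, leadingCoeff_mul, leadingCoeff_derivative, leadingCoeff_derivative] at this
  have h1 := leadingCoeff_ne_zero.2 hf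
  have h2 := leadingCoeff_ne_zero.2 hg
  have h3 : (f.natDegree : ℝ) * (f.leadingCoeff * g.leadingCoeff) =
    g.natDegree * (f.leadingCoeff * g.leadingCoeff) := by linarith
  exact_mod_cast mul_right_cancel₀ (mul_ne_zero h1 h2) h3

lemma exists_eq_C_mul_of_wronskian_eq_zero {f g : ℝ[X]} (hg : g ≠ 0)
    (h : derivative f * g = f * derivative g) : ∃ c : ℝ, f = C c * g := by
  set c := f.coeff g.natDegree / g.leadingCoeff with hc
  refine ⟨c, ?_⟩
  by_contra hne
  have h0 : f - C c * g ≠ 0 := sub_ne_zero.2 hne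
  have hd := natDegree_eq_of_wronskian_eq_zero h0 hg (by
    rw [derivative_sub, derivative_C_mul]
    linear_combination h)
  refine leadingCoeff_ne_zero.2 h0 ?_
  have := leadingCoeff_ne_zero.2 hg
  rw [leadingCoeff, hd, coeff_sub, coeff_C_mul, hc, coeff_natDegree]
  field_simp
  ring

/-- No nontrivial combination of the derivatives of `W` and `Q` vanishes. -/
def DerivIndep (W Q : ℝ[X]) : Prop :=
  ∀ a b : ℝ, C a * derivative W + C b * derivative Q = 0 → a = 0 ∧ b = 0

namespace DerivIndep

variable {W Q : ℝ[X]}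

lemma curvDen_ne_zero (h : DerivIndep W Q) : curvDen W Q ≠ 0 := by
  refine mul_ne_zero (mul_ne_zero (fun h0 => ?_) fun h0 => ?_) fun h0 => ?_
  · simpa using (h 1 0 (by simp [h0])).1
  · simpa using (h 0 1 (by simp [h0])).2
  · simpa using (h 1 (-1) (by simpa [sub_eq_add_neg] using h0)).1

lemma curvNum_ne_zero (h : DerivIndep W Q) : curvNum W Q ≠ 0 := by
  intro h0
  have hD := right_ne_zero_of_mul h.curvDen_ne_zero
  obtain ⟨c, hc⟩ := exists_eq_C_mul_of_wronskian_eq_zero (f := derivative Q) hD (by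
    rw [derivative_sub]
    exact sub_eq_zero.1 h0)
  have := h (-c) (1 + c) (by
    rw [C_neg, C_add, C_1]
    linear_combination hc)
  linarith [this.1, this.2]

lemma curvPoly_ne_zero (h : DerivIndep W Q) : curvPoly W Q ≠ 0 := by
  intro h0
  have hd := natDegree_eq_of_wronskian_eq_zero h.curvNum_ne_zero h.curvDen_ne_zero
    (sub_eq_zero.1 h0)
  have hm := h.curvDen_ne_zero
  have hn := h.curvNum_ne_zero
  rw [curvDen, natDegree_mul (left_ne_zero_of_mul hm) (right_ne_zero_of_mul hm),
    natDegree_mul (left_ne_zero_of_mul (left_ne_zero_of_mul hm))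
      (right_ne_zero_of_mul (left_ne_zero_of_mul hm))] at hd
  have hnE : curvNum W Q = derivative (derivative Q) * (derivative W - derivative Q) -
      derivative Q * derivative (derivative W - derivative Q) := by
    rw [derivative_sub, curvNum]
  rw [hnE] at hn hd
  generalize derivative Q = A at hn hd
  generalize derivative W - A = D at hn hd
  have key : ∀ f g : ℝ[X], derivative f * g ≠ 0 →
      (derivative f * g).natDegree + 1 ≤ f.natDegree + g.natDegree := by
    intro f g hfg
    have h1 : f.natDegree ≠ 0 := fun h1 => by
      rw [derivative_of_natDegree_zero h1, zero_mul] at hfg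
      exact hfg rfl
    have h2 := natDegree_derivative_lt h1
    have h3 := natDegree_mul_le (p := derivative f) (q := g)
    omega
  have h3 := natDegree_sub_le (derivative A * D) (A * derivative D)
  by_cases h1 : derivative A * D = 0
  · by_cases h2 : A * derivative D = 0
    · exact hn (by rw [h1, h2, sub_zero])
    · have := key D A (by rwa [mul_comm])
      rw [mul_comm (derivative D)] at this
      rw [h1, natDegree_zero] at h3
      rw [h1] at hd
      omega
  · have h4 := key A D h1
    by_cases h2 : A * derivative D = 0
    · rw [h2, natDegree_zero] at h3
      rw [h2] at hd
      omega
    · have := key D A (by rwa [mul_comm])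
      rw [mul_comm (derivative D)] at this
      omega

end DerivIndep

lemma derivIndep_of_linearIndep {P₁ P₂ : ℝ[X]}
    (hind : ∀ a b : ℝ, a • P₁ + b • P₂ = 0 → a = 0 ∧ b = 0)
    (h01 : P₁.eval 0 = 0) (h02 : P₂.eval 0 = 0) : DerivIndep P₁ P₂ := by
  intro a b h
  refine hind a b ?_
  have h1 : derivative (a • P₁ + b • P₂) = 0 := by
    rw [derivative_add, derivative_smul, derivative_smul, smul_eq_C_mul, smul_eq_C_mul, h]
  rw [eq_C_of_derivative_eq_zero h1, coeff_zero_eq_eval_zero]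
  simp [h01, h02]

lemma exists_eval_ne_zero {S : ℝ[X]} {η : ℝ} (hη : 0 < η) (hS : S ≠ 0) :
    ∃ t ∈ Set.Ioo 0 η, S.eval t ≠ 0 := by
  obtain ⟨t, ht, htS⟩ := (Set.Ioo_infinite hη).exists_notMem_finset S.roots.toFinset
  exact ⟨t, ht, fun h => htS (by simpa [hS] using h)⟩

lemma exists_good_point {P₁ P₂ : ℝ[X]} (h : DerivIndep P₁ P₂) {η : ℝ} (hη : 0 < η) :
    ∃ t₀ ∈ Set.Ioo 0 η, ((curvDen P₁ P₂).eval t₀ ≠ 0 ∧ (curvPoly P₁ P₂).eval t₀ ≠ 0) ∧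
      ((curvDen (-P₁) (P₂ - P₁)).eval t₀ ≠ 0 ∧ (curvPoly (-P₁) (P₂ - P₁)).eval t₀ ≠ 0) ∧
      ((curvDen (-P₂) (P₁ - P₂)).eval t₀ ≠ 0 ∧ (curvPoly (-P₂) (P₁ - P₂)).eval t₀ ≠ 0) := by
  have h2 : DerivIndep (-P₁) (P₂ - P₁) := fun a b hab => by
    have := h (-a - b) b (by
      rw [derivative_neg, derivative_sub] at hab
      rw [C_sub, C_neg]
      linear_combination hab)
    constructor <;> linarith [this.1, this.2]
  have h3 : DerivIndep (-P₂) (P₁ - P₂) := fun a b hab => by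
    have := h b (-a - b) (by
      rw [derivative_neg, derivative_sub] at hab
      rw [C_sub, C_neg]
      linear_combination hab)
    constructor <;> linarith [this.1, this.2]
  have hS0 : (curvDen P₁ P₂ * curvPoly P₁ P₂) * (curvDen (-P₁) (P₂ - P₁) *
      curvPoly (-P₁) (P₂ - P₁)) * (curvDen (-P₂) (P₁ - P₂) * curvPoly (-P₂) (P₁ - P₂)) ≠ 0 :=
    mul_ne_zero (mul_ne_zero (mul_ne_zero h.curvDen_ne_zero h.curvPoly_ne_zero)
      (mul_ne_zero h2.curvDen_ne_zero h2.curvPoly_ne_zero))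
      (mul_ne_zero h3.curvDen_ne_zero h3.curvPoly_ne_zero)
  obtain ⟨t, ht, htS⟩ := exists_eval_ne_zero hη hS0
  rw [eval_mul, eval_mul, eval_mul, eval_mul, eval_mul] at htS
  have h4 := left_ne_zero_of_mul htS
  have h5 := left_ne_zero_of_mul h4
  have h6 := right_ne_zero_of_mul h4
  have h7 := right_ne_zero_of_mul htS
  exact ⟨t, ht, ⟨left_ne_zero_of_mul h5, right_ne_zero_of_mul h5⟩,
    ⟨left_ne_zero_of_mul h6, right_ne_zero_of_mul h6⟩,
    left_ne_zero_of_mul h7, right_ne_zero_of_mul h7⟩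

/-- The trilinear form counting polynomial configurations with `t` near `t₀`. -/
noncomputable def triForm (P₁ P₂ : ℝ[X]) (t₀ r : ℝ) (u v w : ℝ → ℝ) : ℝ :=
  ∫ t, bump t₀ r t * ∫ x, u x * v (x + P₁.eval t) * w (x + P₂.eval t)

/-- A Lipschitz bump on `[-1, 2]`. -/
structure LipBump (N : ℝ) (g : ℝ → ℝ) : Prop where
  unit : UnitBump g
  lip : ∀ x y, |g x - g y| ≤ N * |x - y|

lemma triForm_smul (P₁ P₂ : ℝ[X]) (t₀ r c : ℝ) (u v w : ℝ → ℝ) :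
    triForm P₁ P₂ t₀ r (fun x => c * u x) (fun x => c * v x) (fun x => c * w x) =
      c ^ 3 * triForm P₁ P₂ t₀ r u v w := by
  rw [triForm, triForm, ← integral_const_mul (c ^ 3)]
  refine integral_congr_ae (Filter.Eventually.of_forall fun t => ?_)
  dsimp only
  rw [mul_left_comm, ← integral_const_mul (c ^ 3)]
  refine congrArg _ (integral_congr_ae (Filter.Eventually.of_forall fun x => ?_))
  dsimp only
  ring

theorem exists_triForm_bound_unit {P₁ P₂ : ℝ[X]} (h : DerivIndep P₁ P₂) {η : ℝ} (hη : 0 < η) :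
    ∃ t₀ r C, 0 < r ∧ r < t₀ ∧ t₀ + r < η ∧ 0 ≤ C ∧ ∀ N d g g', 1 ≤ N → Oscillating N d →
      LipBump N g → LipBump N g' →
      |triForm P₁ P₂ t₀ r d g g'| ≤ C * N ^ (-(1 / 24) : ℝ) ∧
      |triForm P₁ P₂ t₀ r g d g'| ≤ C * N ^ (-(1 / 24) : ℝ) ∧
      |triForm P₁ P₂ t₀ r g g' d| ≤ C * N ^ (-(1 / 24) : ℝ) := by
  obtain ⟨t₀, ⟨ht0, htη⟩, ⟨a1, b1⟩, ⟨a2, b2⟩, a3, b3⟩ := exists_good_point h hη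
  obtain ⟨r₁, hr₁, H₁⟩ := exists_smoothing_of_pair _ _ a1 b1
  obtain ⟨r₂, hr₂, H₂⟩ := exists_smoothing_of_pair _ _ a2 b2
  obtain ⟨r₃, hr₃, H₃⟩ := exists_smoothing_of_pair _ _ a3 b3
  obtain ⟨r, ⟨⟨⟨h1, h2⟩, h3⟩, h4, h5⟩, hr⟩ : ∃ r, (((r < r₁ ∧ r < r₂) ∧ r < r₃) ∧ r < t₀ ∧
      r < η - t₀) ∧ 0 < r := by
    have : 0 < min (min (min r₁ r₂) r₃) (min t₀ (η - t₀)) := by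
      have := sub_pos.2 htη
      positivity
    obtain ⟨r, hr, hr'⟩ := exists_between this
    simp only [lt_min_iff] at hr'
    exact ⟨r, hr', hr⟩
  obtain ⟨C₁, hC₁, H₁⟩ := H₁ r hr h1.le
  obtain ⟨C₂, hC₂, H₂⟩ := H₂ r hr h2.le
  obtain ⟨C₃, hC₃, H₃⟩ := H₃ r hr h3.le
  refine ⟨t₀, r, C₁ + C₂ + C₃, hr, h4, by linarith, by positivity,
    fun N d g g' hN hd hg hg' => ?_⟩
  have hN0 : 0 ≤ N ^ (-(1 / 24) : ℝ) := by positivity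
  refine ⟨(H₁ N d g g' hN hd hg.unit hg'.unit hg.lip).trans ?_,
    le_trans (le_of_eq ?_) ((H₂ N d g g' hN hd hg.unit hg'.unit hg.lip).trans
      (?_ : _ ≤ (C₁ + C₂ + C₃) * N ^ (-(1 / 24) : ℝ))),
    le_trans (le_of_eq ?_) ((H₃ N d g g' hN hd hg.unit hg'.unit hg.lip).trans
      (?_ : _ ≤ (C₁ + C₂ + C₃) * N ^ (-(1 / 24) : ℝ)))⟩
  · gcongr; linarith
  · rw [triForm]
    congr 2
    ext t
    rw [← integral_add_right_eq_self
      (fun x => d x * g (x + (-P₁).eval t) * g' (x + (P₂ - P₁).eval t)) (P₁.eval t)]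
    congr 2
    ext x
    simp only [eval_neg, eval_sub]
    rw [add_neg_cancel_right, add_assoc x, add_sub_cancel]
    ring
  · gcongr; linarith
  · rw [triForm]
    congr 2
    ext t
    rw [← integral_add_right_eq_self
      (fun x => d x * g (x + (-P₂).eval t) * g' (x + (P₁ - P₂).eval t)) (P₂.eval t)]
    congr 2
    ext x
    simp only [eval_neg, eval_sub]
    rw [add_neg_cancel_right, add_assoc x, add_sub_cancel]
    ring
  · gcongr; linarith

/-- The average of `f` over the interval from `x` to `x + c`. -/
noncomputable def avg (c : ℝ) (f : ℝ → ℝ) (x : ℝ) : ℝ := ∫ s in (0 : ℝ)..1, f (x + c * s)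

section avg

variable {c : ℝ} {f g : ℝ → ℝ}

lemma intervalIntegrable_avg (hf : Continuous f) (x : ℝ) :
    IntervalIntegrable (fun s => f (x + c * s)) volume 0 1 :=
  (hf.comp (by fun_prop)).intervalIntegrable _ _

lemma avg_continuous (hf : Continuous f) : Continuous (avg c f) :=
  intervalIntegral.continuous_parametric_intervalIntegral_of_continuous' (by fun_prop) _ _

lemma avg_sub (hf : Continuous f) (hg : Continuous g) (x : ℝ) :
    avg c (fun y => f y - g y) x = avg c f x - avg c g x :=
  intervalIntegral.integral_sub (intervalIntegrable_avg hf x) (intervalIntegrable_avg hg x)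

lemma avg_mono (hf : Continuous f) (hg : Continuous g) {x : ℝ}
    (h : ∀ s ∈ Set.Icc (0 : ℝ) 1, f (x + c * s) ≤ g (x + c * s)) : avg c f x ≤ avg c g x :=
  intervalIntegral.integral_mono_on zero_le_one (intervalIntegrable_avg hf x)
    (intervalIntegrable_avg hg x) h

lemma avg_const (a x : ℝ) : avg c (fun _ => a) x = a := by simp [avg]

lemma avg_const_mul (a x : ℝ) : avg c (fun y => a * f y) x = a * avg c f x :=
  intervalIntegral.integral_const_mul _ _

lemma abs_avg_sub_le (hf : Continuous f) {x a K : ℝ}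
    (h : ∀ s ∈ Set.Icc (0 : ℝ) 1, |f (x + c * s) - a| ≤ K) : |avg c f x - a| ≤ K := by
  have h1 := avg_mono (c := c) (x := x) hf continuous_const (g := fun _ => a + K) fun s hs => by
    linarith [(abs_le.1 (h s hs)).2]
  have h2 := avg_mono (c := c) (x := x) continuous_const (f := fun _ => a - K) hf fun s hs => by
    linarith [(abs_le.1 (h s hs)).1]
  rw [avg_const] at h1 h2
  exact abs_le.2 ⟨by linarith, by linarith⟩

lemma avg_nonneg {x : ℝ} (h : ∀ y, 0 ≤ f y) : 0 ≤ avg c f x :=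
  intervalIntegral.integral_nonneg zero_le_one fun _ _ => h _

lemma exists_of_avg_ne_zero {x : ℝ} (h : avg c f x ≠ 0) :
    ∃ s ∈ Set.Icc (0 : ℝ) 1, f (x + c * s) ≠ 0 := by
  by_contra! h'
  refine h ?_
  rw [avg, intervalIntegral.integral_congr (g := fun _ => (0 : ℝ)) fun s hs => ?_]
  · simp
  · exact h' s (by simpa using hs)

lemma avg_neg (x : ℝ) : avg (-c) f (x + c) = avg c f x := by
  have h := intervalIntegral.integral_comp_sub_left (a := 0) (b := 1) (fun s => f (x + c * s)) 1
  rw [sub_self, sub_zero] at h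
  rw [avg, avg, ← h]
  congr 1
  ext s
  congr 1
  ring

lemma avg_eq_div (hc : c ≠ 0) (x : ℝ) : avg c f x = c⁻¹ * ∫ y in x..(x + c), f y := by
  rw [avg, intervalIntegral.integral_comp_add_mul (fun y => f y) hc]
  simp

lemma hasDerivAt_avg (hf : Continuous f) (hc : c ≠ 0) (x : ℝ) :
    HasDerivAt (avg c f) (c⁻¹ * (f (x + c) - f x)) x := by
  have h0 : ∀ z, HasDerivAt (fun u => ∫ y in (0 : ℝ)..u, f y) (f z) z := fun z =>
    intervalIntegral.integral_hasDerivAt_right (hf.intervalIntegrable _ _)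
      (hf.stronglyMeasurableAtFilter _ _) hf.continuousAt
  have h1 := ((HasDerivAt.comp_add_const x c (h0 (x + c))).sub (h0 x)).const_mul c⁻¹
  refine h1.congr_of_eventuallyEq (Filter.Eventually.of_forall fun z => ?_)
  dsimp only
  rw [avg_eq_div hc]
  congr 1
  exact (intervalIntegral.integral_interval_sub_left (hf.intervalIntegrable _ _)
    (hf.intervalIntegrable _ _)).symm

lemma avg_deriv {F : ℝ → ℝ} (hf : Continuous f) (hF : ∀ x, HasDerivAt F (f x) x) (hc : c ≠ 0)
    (x : ℝ) : avg c f x = c⁻¹ * (F (x + c) - F x) := by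
  rw [avg_eq_div hc, intervalIntegral.integral_eq_sub_of_hasDerivAt (fun y _ => hF y)
    (hf.intervalIntegrable _ _)]

lemma sq_avg_le (hf : Continuous f) (x : ℝ) : avg c f x ^ 2 ≤ avg c (fun y => f y ^ 2) x := by
  set m := avg c f x with hm
  have h := avg_mono (c := c) (x := x) (f := fun y => 2 * m * f y - m ^ 2) (g := fun y => f y ^ 2)
    (by fun_prop) (by fun_prop) fun s _ => by nlinarith [sq_nonneg (f (x + c * s) - m)]
  rw [avg_sub (f := fun y => 2 * m * f y) (by fun_prop) continuous_const, avg_const_mul,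
    avg_const, ← hm] at h
  linarith

lemma integral_intervalIntegral_swap_of_support {k : ℝ → ℝ → ℝ}
    (hk : Continuous fun p : ℝ × ℝ => k p.1 p.2) {R : ℝ}
    (hs : ∀ x, ∀ s ∈ Set.Icc (0 : ℝ) 1, k x s ≠ 0 → x ∈ Set.Ioc (-R) R) :
    ∫ x, ∫ s in (0 : ℝ)..1, k x s = ∫ s in (0 : ℝ)..1, ∫ x, k x s := by
  have h1 : ∫ x, ∫ s in (0 : ℝ)..1, k x s = ∫ x in Set.Ioc (-R) R, ∫ s in (0 : ℝ)..1, k x s := by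
    refine (setIntegral_eq_integral_of_forall_compl_eq_zero fun x hx => ?_).symm
    rw [intervalIntegral.integral_congr (g := fun _ => (0 : ℝ)) fun s hs' => ?_]
    · simp
    · by_contra h
      exact hx (hs x s (by simpa using hs') h)
  have h2 : ∫ s in (0 : ℝ)..1, ∫ x, k x s = ∫ s in (0 : ℝ)..1, ∫ x in Set.Ioc (-R) R, k x s := by
    refine intervalIntegral.integral_congr fun s hs' => ?_
    refine (setIntegral_eq_integral_of_forall_compl_eq_zero fun x hx => ?_).symm
    by_contra h
    exact hx (hs x s (by simpa using hs') h)
  rw [h1, h2]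
  simp only [intervalIntegral.integral_of_le zero_le_one]
  refine integral_integral_swap ?_
  rw [Measure.prod_restrict, ← Measure.volume_eq_prod]
  have : IntegrableOn (fun p : ℝ × ℝ => k p.1 p.2) (Set.Icc (-R) R ×ˢ Set.Icc 0 1) :=
    hk.continuousOn.integrableOn_compact (isCompact_Icc.prod isCompact_Icc)
  exact this.mono_set (Set.prod_mono Set.Ioc_subset_Icc_self Set.Ioc_subset_Icc_self)

lemma integral_avg_mul (hf : Continuous f) (hg : Continuous g) {R : ℝ}
    (hgs : ∀ x, g x ≠ 0 → x ∈ Set.Ioc (-R) R) :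
    ∫ x, avg c f x * g x = ∫ x, f x * avg (-c) g x := by
  have h1 : ∀ x, avg c f x * g x = ∫ s in (0 : ℝ)..1, f (x + c * s) * g x := fun x =>
    (intervalIntegral.integral_mul_const _ _).symm
  have h2 : ∀ x, f x * avg (-c) g x = ∫ s in (0 : ℝ)..1, f x * g (x + -c * s) := fun x =>
    (intervalIntegral.integral_const_mul _ _).symm
  simp only [h1, h2]
  rw [integral_intervalIntegral_swap_of_support (R := R) (by fun_prop) fun x s _ h =>
    hgs x (right_ne_zero_of_mul h), integral_intervalIntegral_swap_of_support (R := R + |c|)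
    (by fun_prop) fun x s hs h => ?_]
  · refine intervalIntegral.integral_congr fun s _ => ?_
    rw [← integral_sub_right_eq_self _ (c * s)]
    congr 1
    ext x
    rw [sub_add_cancel, neg_mul, sub_eq_add_neg]
  · have h3 := hgs _ (right_ne_zero_of_mul h)
    have h4 : |c * s| ≤ |c| := by
      rw [abs_mul, abs_of_nonneg hs.1]
      exact mul_le_of_le_one_right (abs_nonneg _) hs.2
    have h5 := abs_le.1 h4
    rw [neg_mul] at h3
    constructor <;> linarith [h3.1, h3.2]

end avg

/-- `F` is the distribution function of a probability measure on `[0, 1]` and is Hölder continuous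
of exponent `α` with constant `C`. -/
structure HolderCDF (C α : ℝ) (F : ℝ → ℝ) : Prop where
  const_pos : 0 < C
  exp_pos : 0 < α
  exp_le_one : α ≤ 1
  mono : Monotone F
  zero : ∀ x ≤ 0, F x = 0
  one : ∀ x, 1 ≤ x → F x = 1
  holder : ∀ x y, |x - y| ≤ 1 → |F x - F y| ≤ C * |x - y| ^ α

/-- The mollification of `F` by a tent of width `δ`. -/
noncomputable def smooth (δ : ℝ) (F : ℝ → ℝ) : ℝ → ℝ := avg (-δ) (avg δ F)

/-- The derivative of the mollification of `F` by a tent of width `δ`. -/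
noncomputable def dens (δ : ℝ) (F : ℝ → ℝ) (x : ℝ) : ℝ := δ⁻¹ * (avg δ F x - avg (-δ) F x)

lemma hasDerivAt_smooth {F : ℝ → ℝ} (hF : Continuous F) {δ : ℝ} (hδ : δ ≠ 0) (x : ℝ) :
    HasDerivAt (smooth δ F) (dens δ F x) x := by
  refine (hasDerivAt_avg (avg_continuous (c := δ) hF) (neg_ne_zero.2 hδ) x).congr_deriv ?_
  have h := avg_neg (c := δ) (f := F) (x + -δ)
  rw [neg_add_cancel_right] at h
  rw [← h, dens, inv_neg]
  ring

lemma dens_continuous {F : ℝ → ℝ} (hF : Continuous F) (δ : ℝ) : Continuous (dens δ F) :=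
  continuous_const.mul ((avg_continuous hF).sub (avg_continuous hF))

namespace HolderCDF

variable {C α δ : ℝ} {F : ℝ → ℝ}

lemma abs_sub_le (h : HolderCDF C α F) {x y r : ℝ} (hr : r ≤ 1) (hxy : |x - y| ≤ r) :
    |F x - F y| ≤ C * r ^ α :=
  (h.holder x y (hxy.trans hr)).trans <| mul_le_mul_of_nonneg_left
    (Real.rpow_le_rpow (abs_nonneg _) hxy h.exp_pos.le) h.const_pos.le

protected lemma continuous (h : HolderCDF C α F) : Continuous F := by
  rw [continuous_iff_continuousAt]
  intro x
  rw [ContinuousAt, tendsto_iff_norm_sub_tendsto_zero]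
  have h1 : Filter.Tendsto (fun y => C * |y - x| ^ α) (nhds x) (nhds 0) := by
    have : ContinuousAt (fun y => C * |y - x| ^ α) x := by
      refine continuousAt_const.mul (ContinuousAt.rpow_const (by fun_prop) (Or.inr h.exp_pos.le))
    have h2 := this.tendsto
    simpa [Real.zero_rpow h.exp_pos.ne'] using h2
  refine squeeze_zero' (Filter.Eventually.of_forall fun _ => norm_nonneg _) ?_ h1
  filter_upwards [Metric.closedBall_mem_nhds x one_pos] with y hy
  exact h.holder y x hy

lemma nonneg (h : HolderCDF C α F) (x : ℝ) : 0 ≤ F x := by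
  rw [← h.zero (min x 0) (min_le_right _ _)]
  exact h.mono (min_le_left _ _)

lemma abs_avg_sub_le (h : HolderCDF C α F) (hδ : |δ| ≤ 1) (x : ℝ) :
    |avg δ F x - F x| ≤ C * |δ| ^ α := by
  refine _root_.abs_avg_sub_le h.continuous fun s hs => h.abs_sub_le hδ ?_
  rw [add_sub_cancel_left, abs_mul, abs_of_nonneg hs.1]
  exact mul_le_of_le_one_right (abs_nonneg _) hs.2

lemma abs_smooth_sub_le (h : HolderCDF C α F) (hδ : 0 < δ) (hδ1 : δ ≤ 1) (x : ℝ) :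
    |smooth δ F x - F x| ≤ C * δ ^ α := by
  refine _root_.abs_avg_sub_le (avg_continuous h.continuous) fun s hs =>
    _root_.abs_avg_sub_le h.continuous fun s' hs' => h.abs_sub_le hδ1 ?_
  have : x + -δ * s + δ * s' - x = δ * (s' - s) := by ring
  rw [this, abs_mul, abs_of_pos hδ]
  exact mul_le_of_le_one_right hδ.le (abs_le.2 ⟨by linarith [hs.2, hs'.1], by linarith [hs.1, hs'.2]⟩)

lemma le_avg (h : HolderCDF C α F) (hδ : 0 < δ) (x : ℝ) : F x ≤ avg δ F x := by
  have := avg_mono (c := δ) (x := x) (f := fun _ => F x) continuous_const h.continuous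
    fun s hs => h.mono (by nlinarith [mul_nonneg hδ.le hs.1])
  rwa [avg_const] at this

lemma avg_le (h : HolderCDF C α F) (hδ : 0 < δ) (x : ℝ) : avg δ F x ≤ F (x + δ) := by
  have := avg_mono (c := δ) (x := x) (g := fun _ => F (x + δ)) h.continuous continuous_const
    fun s hs => h.mono (by nlinarith [mul_le_of_le_one_right hδ.le hs.2])
  rwa [avg_const] at this

lemma avg_neg_le (h : HolderCDF C α F) (hδ : 0 < δ) (x : ℝ) : avg (-δ) F x ≤ F x := by
  have h1 := h.avg_le hδ (x - δ)
  rw [← avg_neg] at h1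
  simpa using h1

lemma le_avg_neg (h : HolderCDF C α F) (hδ : 0 < δ) (x : ℝ) : F (x - δ) ≤ avg (-δ) F x := by
  have h1 := h.le_avg hδ (x - δ)
  rw [← avg_neg] at h1
  simpa using h1

lemma dens_nonneg (h : HolderCDF C α F) (hδ : 0 < δ) (x : ℝ) : 0 ≤ dens δ F x :=
  mul_nonneg (inv_nonneg.2 hδ.le) (by linarith [h.le_avg hδ x, h.avg_neg_le hδ x])

lemma dens_le (h : HolderCDF C α F) (hδ : 0 < δ) (hδ1 : δ ≤ 1) (x : ℝ) :
    dens δ F x ≤ 2 * C * δ ^ (α - 1) := by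
  have h1 := h.abs_avg_sub_le (δ := δ) (by rwa [abs_of_pos hδ]) x
  have h2 := h.abs_avg_sub_le (δ := -δ) (by rwa [abs_neg, abs_of_pos hδ]) x
  rw [abs_neg] at h2
  rw [abs_of_pos hδ] at h1 h2
  rw [dens, Real.rpow_sub_one hδ.ne', inv_mul_le_iff₀ hδ]
  have : δ * (2 * C * (δ ^ α / δ)) = 2 * (C * δ ^ α) := by field_simp
  rw [this]
  linarith [(abs_le.1 h1).2, (abs_le.1 h2).1]

lemma avg_lip (h : HolderCDF C α F) (hδ : δ ≠ 0) (hδ1 : |δ| ≤ 1) (x y : ℝ) :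
    |avg δ F x - avg δ F y| ≤ C * |δ| ^ (α - 1) * |x - y| := by
  have := abs_sub_sub_mul_le (f := avg δ F) (x := y) (y := x) (m := 0)
    (K := C * |δ| ^ (α - 1)) fun u _ => ⟨hasDerivAt_avg h.continuous hδ u, by
      rw [sub_zero, abs_mul, abs_inv, Real.rpow_sub_one (abs_pos.2 hδ).ne',
        inv_mul_le_iff₀ (abs_pos.2 hδ)]
      have h1 := h.abs_sub_le (x := u + δ) (y := u) hδ1 (by simp)
      have h2 : |δ| * (C * (|δ| ^ α / |δ|)) = C * |δ| ^ α := by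
        field_simp [abs_pos.2 hδ]
      rwa [h2]⟩
  simpa using this

lemma dens_lip (h : HolderCDF C α F) (hδ : 0 < δ) (hδ1 : δ ≤ 1) (x y : ℝ) :
    |dens δ F x - dens δ F y| ≤ 2 * C * δ ^ (α - 1) / δ * |x - y| := by
  have h1 := h.avg_lip (δ := δ) hδ.ne' (by rwa [abs_of_pos hδ]) x y
  have h2 := h.avg_lip (δ := -δ) (neg_ne_zero.2 hδ.ne') (by rwa [abs_neg, abs_of_pos hδ]) x y
  rw [abs_neg] at h2
  rw [abs_of_pos hδ] at h1 h2
  have h3 : dens δ F x - dens δ F y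
      = δ⁻¹ * ((avg δ F x - avg δ F y) - (avg (-δ) F x - avg (-δ) F y)) := by
    simp only [dens]; ring
  rw [h3, abs_mul, abs_of_pos (inv_pos.2 hδ), inv_mul_le_iff₀ hδ]
  have h4 : δ * (2 * C * δ ^ (α - 1) / δ * |x - y|) = 2 * (C * δ ^ (α - 1) * |x - y|) := by
    field_simp
  rw [h4]
  linarith [abs_sub (avg δ F x - avg δ F y) (avg (-δ) F x - avg (-δ) F y)]

lemma lt_of_dens_ne_zero (h : HolderCDF C α F) (hδ : 0 < δ) {x : ℝ} (hx : dens δ F x ≠ 0) :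
    F (x - δ) < F (x + δ) := by
  by_contra! h'
  refine hx (le_antisymm ?_ (h.dens_nonneg hδ x))
  exact mul_nonpos_of_nonneg_of_nonpos (inv_nonneg.2 hδ.le)
    (by linarith [h.avg_le hδ x, h.le_avg_neg hδ x])

lemma dens_supp (h : HolderCDF C α F) (hδ : 0 < δ) (hδ1 : δ ≤ 1) {x : ℝ} (hx : dens δ F x ≠ 0) :
    x ∈ Set.Icc (-1 : ℝ) 2 := by
  have h1 := h.lt_of_dens_ne_zero hδ hx
  constructor <;> by_contra! h2
  · rw [h.zero (x + δ) (by linarith)] at h1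
    exact absurd h1 (h.nonneg _).not_gt
  · rw [h.one (x - δ) (by linarith), h.one (x + δ) (by linarith)] at h1
    exact lt_irrefl _ h1

lemma dens_integral (h : HolderCDF C α F) (hδ : 0 < δ) (hδ1 : δ ≤ 1) : ∫ x, dens δ F x = 1 := by
  have h1 : ∫ x in Set.Icc (-1 : ℝ) 2, dens δ F x = ∫ x, dens δ F x :=
    setIntegral_eq_integral_of_forall_compl_eq_zero fun x hx => by
      by_contra h'
      exact hx (h.dens_supp hδ hδ1 h')
  rw [← h1, integral_Icc_eq_integral_Ioc, ← intervalIntegral.integral_of_le (by norm_num),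
    intervalIntegral.integral_eq_sub_of_hasDerivAt
      (fun x _ => hasDerivAt_smooth h.continuous hδ.ne' x)
      ((dens_continuous h.continuous δ).intervalIntegrable _ _)]
  have h2 : smooth δ F 2 - 1 = 0 := by
    refine abs_nonpos_iff.1 (_root_.abs_avg_sub_le (avg_continuous h.continuous) fun s hs =>
      _root_.abs_avg_sub_le h.continuous fun s' hs' => ?_)
    rw [h.one, sub_self, abs_zero]
    nlinarith [mul_le_of_le_one_right hδ.le hs.2, mul_nonneg hδ.le hs'.1]
  have h3 : smooth δ F (-1) - 0 = 0 := by
    refine abs_nonpos_iff.1 (_root_.abs_avg_sub_le (avg_continuous h.continuous) fun s hs =>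
      _root_.abs_avg_sub_le h.continuous fun s' hs' => ?_)
    rw [h.zero, sub_self, abs_zero]
    nlinarith [mul_le_of_le_one_right hδ.le hs'.2, mul_nonneg hδ.le hs.1]
  linarith

/-- Consecutive densities, after normalisation, differ by an oscillating function. -/
lemma oscillating_dens (h : HolderCDF C α F) (hδ : 0 < δ) (hδ1 : δ ≤ 1 / 2) :
    Oscillating (2 / δ) (fun x => (8 * C * δ ^ (α - 1))⁻¹ * (dens δ F x - dens (2 * δ) F x)) ∧
    LipBump (2 / δ) (fun x => (8 * C * δ ^ (α - 1))⁻¹ * dens δ F x) ∧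
    LipBump (2 / δ) (fun x => (8 * C * δ ^ (α - 1))⁻¹ * dens (2 * δ) F x) := by
  have hC := h.const_pos
  have hp : 0 < δ ^ (α - 1) := Real.rpow_pos_of_pos hδ _
  have hp2 : (2 * δ) ^ (α - 1) ≤ δ ^ (α - 1) :=
    Real.rpow_le_rpow_of_nonpos hδ (by linarith) (by linarith [h.exp_le_one])
  have hδ2 : 0 < 2 * δ := by linarith
  have hδ21 : 2 * δ ≤ 1 := by linarith
  set A := δ ^ (α - 1) with hA
  have hM : 0 < (8 * C * A)⁻¹ := by positivity
  have b1 : ∀ x, dens δ F x ≤ 2 * C * A := h.dens_le hδ (by linarith)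
  have b2 : ∀ x, dens (2 * δ) F x ≤ 2 * C * A := fun x =>
    (h.dens_le hδ2 hδ21 x).trans (by gcongr)
  have n1 := h.dens_nonneg hδ
  have n2 := h.dens_nonneg hδ2
  have l1 : ∀ x y, |dens δ F x - dens δ F y| ≤ 2 * C * A / δ * |x - y| :=
    h.dens_lip hδ (by linarith)
  have l2 : ∀ x y, |dens (2 * δ) F x - dens (2 * δ) F y| ≤ 2 * C * A / δ * |x - y| := fun x y =>
    (h.dens_lip hδ2 hδ21 x y).trans (by gcongr; linarith)
  have c1 := dens_continuous h.continuous δ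
  have c2 := dens_continuous h.continuous (2 * δ)
  have s1 : ∀ x, dens δ F x ≠ 0 → x ∈ Set.Icc (-1 : ℝ) 2 := fun x => h.dens_supp hδ (by linarith)
  have s2 : ∀ x, dens (2 * δ) F x ≠ 0 → x ∈ Set.Icc (-1 : ℝ) 2 := fun x => h.dens_supp hδ2 hδ21
  have lip_aux : ∀ z t : ℝ, 0 ≤ t → |z| ≤ 2 * (2 * C * A / δ * t) →
      |(8 * C * A)⁻¹ * z| ≤ 2 / δ * t := fun z t ht hz => by
    rw [abs_mul, abs_of_pos hM, inv_mul_le_iff₀ (by positivity)]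
    refine hz.trans ?_
    have e : 8 * C * A * (2 / δ * t) = 16 * (C * A / δ * t) := by ring
    have e' : 2 * (2 * C * A / δ * t) = 4 * (C * A / δ * t) := by ring
    have : 0 ≤ C * A / δ * t := by positivity
    rw [e, e']; linarith
  have bdd_aux : ∀ z : ℝ, |z| ≤ 2 * C * A → |(8 * C * A)⁻¹ * z| ≤ 1 := fun z hz => by
    rw [abs_mul, abs_of_pos hM, inv_mul_le_iff₀ (by positivity)]
    nlinarith [mul_pos hC hp]
  have lipBump : ∀ f : ℝ → ℝ, Continuous f → (∀ x, f x ≠ 0 → x ∈ Set.Icc (-1 : ℝ) 2) →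
      (∀ x, 0 ≤ f x) → (∀ x, f x ≤ 2 * C * A) →
      (∀ x y, |f x - f y| ≤ 2 * C * A / δ * |x - y|) →
      LipBump (2 / δ) (fun x => (8 * C * A)⁻¹ * f x) := fun f hc hs hn hb hl =>
    { unit := 
      { cont := by fun_prop
        supp := fun x hx => hs x (right_ne_zero_of_mul hx)
        bdd := fun x => bdd_aux _ (by rw [abs_of_nonneg (hn x)]; exact hb x) }
      lip := fun x y => by
        rw [← mul_sub]
        refine lip_aux _ _ (abs_nonneg _) ((hl x y).trans ?_)
        have : 0 ≤ 2 * C * A / δ * |x - y| := by positivity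
        linarith }
  refine ⟨?_, lipBump _ c1 s1 n1 b1 l1, lipBump _ c2 s2 n2 b2 l2⟩
  refine
    { cont := by fun_prop
      supp := fun x hx => ?_
      bdd := fun x => bdd_aux _ (abs_le.2 ⟨by linarith [n1 x, b2 x], by linarith [n2 x, b1 x]⟩)
      lip := fun x y => ?_
      prim := ⟨fun x => (8 * C * A)⁻¹ * (smooth δ F x - smooth (2 * δ) F x), fun x =>
        ((hasDerivAt_smooth h.continuous hδ.ne' x).sub
          (hasDerivAt_smooth h.continuous hδ2.ne' x)).const_mul _, fun x => ?_⟩ }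
  · by_contra hx'
    refine hx ?_
    have e1 : dens δ F x = 0 := by by_contra h'; exact hx' (s1 x h')
    have e2 : dens (2 * δ) F x = 0 := by by_contra h'; exact hx' (s2 x h')
    simp [e1, e2]
  · rw [← mul_sub]
    refine lip_aux _ _ (abs_nonneg _) ?_
    have e : dens δ F x - dens (2 * δ) F x - (dens δ F y - dens (2 * δ) F y) =
      (dens δ F x - dens δ F y) - (dens (2 * δ) F x - dens (2 * δ) F y) := by ring
    rw [e]
    linarith [abs_sub (dens δ F x - dens δ F y) (dens (2 * δ) F x - dens (2 * δ) F y), l1 x y,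
      l2 x y]
  · have a1 := h.abs_smooth_sub_le hδ (by linarith) x
    have a2 := h.abs_smooth_sub_le hδ2 hδ21 x
    have p1 : δ ^ α = A * δ := by
      rw [hA, Real.rpow_sub_one hδ.ne']; field_simp
    have p2 : (2 * δ) ^ α ≤ A * (2 * δ) := by
      rw [show (2 * δ) ^ α = (2 * δ) ^ (α - 1) * (2 * δ) by
        rw [Real.rpow_sub_one hδ2.ne']; field_simp]
      gcongr
    rw [abs_mul, abs_of_pos hM, inv_mul_le_iff₀ (by positivity), one_div_div]
    have a3 : C * (2 * δ) ^ α ≤ C * (A * (2 * δ)) := by gcongr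
    rw [p1] at a1
    have : |smooth δ F x - smooth (2 * δ) F x| ≤ C * (A * δ) + C * (A * (2 * δ)) := by
      have e : smooth δ F x - smooth (2 * δ) F x
        = (smooth δ F x - F x) - (smooth (2 * δ) F x - F x) := by ring
      rw [e]
      linarith [abs_sub (smooth δ F x - F x) (smooth (2 * δ) F x - F x)]
    have e : 8 * C * A * (δ / 2) = 4 * (C * (A * δ)) := by ring
    have e' : C * (A * (2 * δ)) = 2 * (C * (A * δ)) := by ring
    rw [e]; rw [e'] at this
    have : 0 ≤ C * (A * δ) := by positivity
    linarith

end HolderCDF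

section triForm

variable {P₁ P₂ : ℝ[X]} {t₀ r : ℝ} {u u' v v' w w' f g : ℝ → ℝ}

/-- A continuous function supported in `[-1, 2]`. -/
structure IsBump (u : ℝ → ℝ) : Prop where
  cont : Continuous u
  supp : ∀ x, u x ≠ 0 → x ∈ Set.Icc (-1 : ℝ) 2

lemma IsBump.sub (hu : IsBump u) (hv : IsBump v) : IsBump fun x => u x - v x where
  cont := hu.cont.sub hv.cont
  supp x hx := by
    by_contra h
    have h1 : u x = 0 := by by_contra h'; exact h (hu.supp x h')
    have h2 : v x = 0 := by by_contra h'; exact h (hv.supp x h')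
    simp [h1, h2] at hx

lemma integrable_of_supp {a b : ℝ} (hu : Continuous u)
    (hs : ∀ x, u x ≠ 0 → x ∈ Set.Icc a b) : Integrable u :=
  hu.integrable_of_hasCompactSupport (HasCompactSupport.intro isCompact_Icc fun x hx => by
    by_contra h'
    exact hx (hs x h'))

lemma IsBump.integrable (hu : IsBump u) : Integrable u := integrable_of_supp hu.cont hu.supp

lemma IsBump.mul (hu : IsBump u) (hv : Continuous v) : IsBump fun x => u x * v x where
  cont := hu.cont.mul hv
  supp x hx := hu.supp x (left_ne_zero_of_mul hx)

lemma IsBump.trilinear (hu : IsBump u) (hv : Continuous v) (hw : Continuous w) (p q : ℝ) :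
    IsBump fun x => u x * v (x + p) * w (x + q) :=
  (hu.mul (v := fun x => v (x + p)) (by fun_prop)).mul (v := fun x => w (x + q)) (by fun_prop)

lemma continuous_inner_triForm (hu : IsBump u) (hv : Continuous v) (hw : Continuous w) :
    Continuous fun t => ∫ x, u x * v (x + P₁.eval t) * w (x + P₂.eval t) :=
  continuous_trilinear hu.cont hu.supp hv hw P₁.continuous P₂.continuous

lemma integrable_bump_mul (hf : Continuous f) : Integrable fun t => bump t₀ r t * f t :=
  integrable_of_supp (a := t₀ - r) (b := t₀ + r) (bump_continuous.mul hf) fun _ ht =>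
    Set.Ioo_subset_Icc_self (bump_supp (left_ne_zero_of_mul ht))

lemma integrable_bump : Integrable (bump t₀ r) := by
  simpa using integrable_bump_mul (t₀ := t₀) (r := r) (f := fun _ => 1) continuous_const

lemma bump_integral_pos (hr : 0 < r) : 0 < ∫ t, bump t₀ r t := by
  refine bump_continuous.integral_pos_of_hasCompactSupport_nonneg_nonzero
    (HasCompactSupport.intro (isCompact_Icc (a := t₀ - r) (b := t₀ + r)) fun t ht => ?_)
    (fun t => bump_nonneg t) (x := t₀) ?_
  · by_contra h'
    exact ht (Set.Ioo_subset_Icc_self (bump_supp h'))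
  · simp [bump, hr.le, hr.ne']

lemma triForm_sub_left (hu : IsBump u) (hu' : IsBump u') (hv : Continuous v) (hw : Continuous w) :
    triForm P₁ P₂ t₀ r u v w - triForm P₁ P₂ t₀ r u' v w =
      triForm P₁ P₂ t₀ r (fun x => u x - u' x) v w := by
  rw [triForm, triForm, triForm, ← integral_sub
    (integrable_bump_mul (continuous_inner_triForm hu hv hw))
    (integrable_bump_mul (continuous_inner_triForm hu' hv hw))]
  refine integral_congr_ae (Filter.Eventually.of_forall fun t => ?_)
  dsimp only
  rw [← mul_sub, ← integral_sub (hu.trilinear hv hw _ _).integrable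
    (hu'.trilinear hv hw _ _).integrable]
  refine congrArg _ (integral_congr_ae (Filter.Eventually.of_forall fun x => ?_))
  dsimp only
  ring

lemma triForm_sub_mid (hu : IsBump u) (hv : Continuous v) (hv' : Continuous v')
    (hw : Continuous w) :
    triForm P₁ P₂ t₀ r u v w - triForm P₁ P₂ t₀ r u v' w =
      triForm P₁ P₂ t₀ r u (fun x => v x - v' x) w := by
  rw [triForm, triForm, triForm, ← integral_sub
    (integrable_bump_mul (continuous_inner_triForm hu hv hw))
    (integrable_bump_mul (continuous_inner_triForm hu hv' hw))]
  refine integral_congr_ae (Filter.Eventually.of_forall fun t => ?_)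
  dsimp only
  rw [← mul_sub, ← integral_sub (hu.trilinear hv hw _ _).integrable
    (hu.trilinear hv' hw _ _).integrable]
  refine congrArg _ (integral_congr_ae (Filter.Eventually.of_forall fun x => ?_))
  dsimp only
  ring

lemma triForm_sub_right (hu : IsBump u) (hv : Continuous v) (hw : Continuous w)
    (hw' : Continuous w') :
    triForm P₁ P₂ t₀ r u v w - triForm P₁ P₂ t₀ r u v w' =
      triForm P₁ P₂ t₀ r u v (fun x => w x - w' x) := by
  rw [triForm, triForm, triForm, ← integral_sub
    (integrable_bump_mul (continuous_inner_triForm hu hv hw))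
    (integrable_bump_mul (continuous_inner_triForm hu hv hw'))]
  refine integral_congr_ae (Filter.Eventually.of_forall fun t => ?_)
  dsimp only
  rw [← mul_sub, ← integral_sub (hu.trilinear hv hw _ _).integrable
    (hu.trilinear hv hw' _ _).integrable]
  refine congrArg _ (integral_congr_ae (Filter.Eventually.of_forall fun x => ?_))
  dsimp only
  ring

lemma triForm_diag_sub (hf : IsBump f) (hg : IsBump g) :
    triForm P₁ P₂ t₀ r f f f - triForm P₁ P₂ t₀ r g g g =
      triForm P₁ P₂ t₀ r (fun x => f x - g x) f f + triForm P₁ P₂ t₀ r g (fun x => f x - g x) f +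
        triForm P₁ P₂ t₀ r g g (fun x => f x - g x) := by
  rw [← triForm_sub_left hf hg hf.cont hf.cont, ← triForm_sub_mid hg hf.cont hg.cont hf.cont,
    ← triForm_sub_right hg hg.cont hf.cont hg.cont]
  ring

lemma abs_triForm_le {K : ℝ}
    (h : ∀ t, |∫ x, u x * v (x + P₁.eval t) * w (x + P₂.eval t)| ≤ K) :
    |triForm P₁ P₂ t₀ r u v w| ≤ K * ∫ t, bump t₀ r t := by
  rw [triForm, ← integral_const_mul K, ← Real.norm_eq_abs]
  refine norm_integral_le_of_norm_le (integrable_bump.const_mul K)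
    (Filter.Eventually.of_forall fun t => ?_)
  rw [Real.norm_eq_abs, abs_mul, abs_of_nonneg (bump_nonneg t), mul_comm]
  exact mul_le_mul_of_nonneg_right (h t) (bump_nonneg t)

lemma le_triForm {K : ℝ} (hu : IsBump u) (hv : Continuous v) (hw : Continuous w)
    (h : ∀ t ∈ Set.Ioo (t₀ - r) (t₀ + r),
      K ≤ ∫ x, u x * v (x + P₁.eval t) * w (x + P₂.eval t)) :
    K * ∫ t, bump t₀ r t ≤ triForm P₁ P₂ t₀ r u v w := by
  rw [triForm, ← integral_const_mul K]
  refine integral_mono (integrable_bump.const_mul K)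
    (integrable_bump_mul (continuous_inner_triForm hu hv hw)) fun t => ?_
  dsimp only
  by_cases ht : bump t₀ r t = 0
  · simp [ht]
  · rw [mul_comm]
    exact mul_le_mul_of_nonneg_left (h t (bump_supp ht)) (bump_nonneg t)

lemma exists_of_triForm_pos (h : 0 < triForm P₁ P₂ t₀ r u v w) :
    ∃ t ∈ Set.Ioo (t₀ - r) (t₀ + r), ∃ x,
      u x ≠ 0 ∧ v (x + P₁.eval t) ≠ 0 ∧ w (x + P₂.eval t) ≠ 0 := by
  by_contra! h'
  refine h.ne' ?_
  rw [triForm]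
  refine integral_eq_zero_of_ae (Filter.Eventually.of_forall fun t => ?_)
  by_cases ht : bump t₀ r t = 0
  · simp [ht]
  · have : ∫ x, u x * v (x + P₁.eval t) * w (x + P₂.eval t) = 0 := by
      refine integral_eq_zero_of_ae (Filter.Eventually.of_forall fun x => ?_)
      by_cases h1 : u x = 0
      · simp [h1]
      by_cases h2 : v (x + P₁.eval t) = 0
      · simp [h2]
      simp [h' t (bump_supp ht) x h1 h2]
    simp [this]

/-- The trilinear form is Lipschitz in `L¹` on bounded functions. -/
lemma abs_triForm_diag_sub_le {M : ℝ} (hf : IsBump f) (hg : IsBump g) (hfM : ∀ x, |f x| ≤ M)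
    (hgM : ∀ x, |g x| ≤ M) :
    |triForm P₁ P₂ t₀ r f f f - triForm P₁ P₂ t₀ r g g g| ≤
      3 * (M ^ 2 * ∫ x, |f x - g x|) * ∫ t, bump t₀ r t := by
  have hM : 0 ≤ M := (abs_nonneg _).trans (hfM 0)
  have hd := (hf.sub hg).integrable.abs
  have key : ∀ (k : ℝ → ℝ) (p : ℝ), (∀ x, |k x| ≤ M ^ 2 * |f (x + p) - g (x + p)|) →
      |∫ x, k x| ≤ M ^ 2 * ∫ x, |f x - g x| := fun k p hk => by
    rw [← integral_add_right_eq_self (fun x => |f x - g x|) p, ← integral_const_mul (M ^ 2),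
      ← Real.norm_eq_abs]
    exact norm_integral_le_of_norm_le ((hd.comp_add_right p).const_mul _)
      (Filter.Eventually.of_forall hk)
  have bd : ∀ a b c : ℝ, |a| ≤ M → |b| ≤ M → |a| * |b| * |c| ≤ M ^ 2 * |c| := fun a b c ha hb => by
    rw [sq]; gcongr
  rw [triForm_diag_sub hf hg]
  have h1 : |triForm P₁ P₂ t₀ r (fun x => f x - g x) f f| ≤ _ := abs_triForm_le fun t =>
    key _ 0 fun x => by
      rw [abs_mul, abs_mul, mul_assoc, mul_comm, add_zero]
      exact bd _ _ _ (hfM _) (hfM _)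
  have h2 : |triForm P₁ P₂ t₀ r g (fun x => f x - g x) f| ≤ _ := abs_triForm_le fun t =>
    key _ (P₁.eval t) fun x => by
      rw [abs_mul, abs_mul, mul_right_comm]
      exact bd _ _ _ (hgM _) (hfM _)
  have h3 : |triForm P₁ P₂ t₀ r g g (fun x => f x - g x)| ≤ _ := abs_triForm_le fun t =>
    key _ (P₂.eval t) fun x => by
      rw [abs_mul, abs_mul]
      exact bd _ _ _ (hgM _) (hgM _)
  refine (abs_add_three _ _ _).trans ?_
  linarith

/-- A Lipschitz probability density correlates with its small translates. -/
lemma le_integral_mul_translates {M K η p q : ℝ} (hf : IsBump f) (h0 : ∀ x, 0 ≤ f x)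
    (hM : ∀ x, f x ≤ M) (hK : ∀ x y, |f x - f y| ≤ K * |x - y|) (h1 : ∫ x, f x = 1)
    (hp : |p| ≤ η) (hq : |q| ≤ η) (hK0 : 0 ≤ K) :
    1 / 9 - 2 * M * K * η ≤ ∫ x, f x * f (x + p) * f (x + q) := by
  have hsupp : ∀ k : ℝ → ℝ, IsBump k → ∫ x in Set.Icc (-1 : ℝ) 2, k x = ∫ x, k x := fun k hk =>
    setIntegral_eq_integral_of_forall_compl_eq_zero fun x hx => by
      by_contra h'
      exact hx (hk.supp x h')
  have hM0 : 0 ≤ M := (h0 0).trans (hM 0)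
  have hη : 0 ≤ η := (abs_nonneg p).trans hp
  have hT := hf.trilinear hf.cont hf.cont p q
  rw [← hsupp _ hT]
  have hconst : ∫ x in Set.Icc (-1 : ℝ) 2, ((1 / 3 - 2 * M * K * η) * f x - 2 / 27) =
      1 / 9 - 2 * M * K * η := by
    rw [integral_sub (hf.integrable.const_mul _).integrableOn
      (continuous_const.integrableOn_Icc), integral_const_mul, hsupp _ hf, h1]
    norm_num
    ring
  rw [← hconst]
  refine setIntegral_mono ((hf.integrable.const_mul _).integrableOn.sub
    (continuous_const.integrableOn_Icc)) hT.integrable.integrableOn fun x => ?_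
  dsimp only
  have e1 : f x - K * η ≤ f (x + p) := by
    have := (hK x (x + p)).trans (mul_le_mul_of_nonneg_left (by simpa using hp) hK0)
    linarith [(abs_le.1 this).2]
  have e2 : f x - K * η ≤ f (x + q) := by
    have := (hK x (x + q)).trans (mul_le_mul_of_nonneg_left (by simpa using hq) hK0)
    linarith [(abs_le.1 this).2]
  have hKη : 0 ≤ K * η := by positivity
  have e3 : f x ^ 2 - 2 * M * (K * η) ≤ f (x + p) * f (x + q) := by
    rcases le_total (f x) (K * η) with h | h
    · nlinarith [mul_nonneg (h0 (x + p)) (h0 (x + q)), h0 x, hM x,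
        mul_le_mul (hM x) h (h0 x) hM0, mul_nonneg hM0 hKη]
    · nlinarith [mul_le_mul e1 e2 (by linarith) (h0 _), mul_le_mul_of_nonneg_right (hM x) hKη,
        sq_nonneg (K * η)]
  have e4 := mul_le_mul_of_nonneg_left e3 (h0 x)
  nlinarith [mul_nonneg (sq_nonneg (f x - 1 / 3)) (by linarith [h0 x] : 0 ≤ f x + 2 / 3)]

end triForm

namespace HolderCDF

variable {C α δ : ℝ} {F : ℝ → ℝ}

lemma isBump (h : HolderCDF C α F) (hδ : 0 < δ) (hδ1 : δ ≤ 1) : IsBump (dens δ F) where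
  cont := dens_continuous h.continuous δ
  supp _ hx := h.dens_supp hδ hδ1 hx

lemma abs_triForm_dens_sub_le (h : HolderCDF C α F) (hδ : 0 < δ) (hδ1 : δ ≤ 1 / 2)
    (hα : 3 * (1 - α) ≤ 1 / 48) {P₁ P₂ : ℝ[X]} {t₀ r A : ℝ} (hA0 : 0 ≤ A)
    (hA : ∀ N d g g', 1 ≤ N → Oscillating N d → LipBump N g → LipBump N g' →
      |triForm P₁ P₂ t₀ r d g g'| ≤ A * N ^ (-(1 / 24) : ℝ) ∧
      |triForm P₁ P₂ t₀ r g d g'| ≤ A * N ^ (-(1 / 24) : ℝ) ∧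
      |triForm P₁ P₂ t₀ r g g' d| ≤ A * N ^ (-(1 / 24) : ℝ)) :
    |triForm P₁ P₂ t₀ r (dens δ F) (dens δ F) (dens δ F) -
      triForm P₁ P₂ t₀ r (dens (2 * δ) F) (dens (2 * δ) F) (dens (2 * δ) F)| ≤
      1536 * C ^ 3 * A * δ ^ (1 / 48 : ℝ) := by
  obtain ⟨ho, h1, h2⟩ := h.oscillating_dens hδ hδ1
  have hC := h.const_pos
  have hp : 0 < δ ^ (α - 1) := Real.rpow_pos_of_pos hδ _
  have hM : 0 < 8 * C * δ ^ (α - 1) := by positivity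
  have hN : 1 ≤ 2 / δ := by rw [le_div_iff₀ hδ]; linarith
  have k1 := (hA _ _ _ _ hN ho h1 h1).1
  have k2 := (hA _ _ _ _ hN ho h2 h1).2.1
  have k3 := (hA _ _ _ _ hN ho h2 h2).2.2
  rw [triForm_smul, abs_mul, abs_of_pos (by positivity), inv_pow,
    inv_mul_le_iff₀ (by positivity)] at k1 k2 k3
  rw [triForm_diag_sub (h.isBump hδ (by linarith)) (h.isBump (by linarith) (by linarith))]
  refine (abs_add_three _ _ _).trans (((add_le_add (add_le_add k1 k2) k3)).trans ?_)
  have e1 : (2 / δ) ^ (-(1 / 24) : ℝ) ≤ δ ^ (1 / 24 : ℝ) := by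
    rw [Real.rpow_neg (by positivity), ← Real.inv_rpow (by positivity), inv_div]
    exact Real.rpow_le_rpow (by positivity) (by linarith) (by norm_num)
  have e2 : (δ ^ (α - 1)) ^ 3 * δ ^ (1 / 24 : ℝ) ≤ δ ^ (1 / 48 : ℝ) := by
    rw [← Real.rpow_natCast, ← Real.rpow_mul hδ.le, ← Real.rpow_add hδ]
    refine Real.rpow_le_rpow_of_exponent_ge hδ (by linarith) ?_
    push_cast
    linarith
  calc _ = 1536 * C ^ 3 * A * ((δ ^ (α - 1)) ^ 3 * (2 / δ) ^ (-(1 / 24) : ℝ)) := by ring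
    _ ≤ 1536 * C ^ 3 * A * ((δ ^ (α - 1)) ^ 3 * δ ^ (1 / 24 : ℝ)) := by gcongr
    _ ≤ _ := by gcongr

end HolderCDF

section energy

variable {f : ℝ → ℝ} {a b c δ : ℝ}

lemma avg_supp (hs : ∀ x, f x ≠ 0 → x ∈ Set.Icc a b) {x : ℝ} (hx : avg c f x ≠ 0) :
    x ∈ Set.Icc (a - |c|) (b + |c|) := by
  obtain ⟨s, hs1, hs2⟩ := exists_of_avg_ne_zero hx
  have h1 : |c * s| ≤ |c| := by
    rw [abs_mul, abs_of_nonneg hs1.1]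
    exact mul_le_of_le_one_right (abs_nonneg _) hs1.2
  have h2 := abs_le.1 h1
  have h3 := hs _ hs2
  exact ⟨by linarith [h3.1], by linarith [h3.2]⟩

lemma integral_avg (hf : Continuous f) (hs : ∀ x, f x ≠ 0 → x ∈ Set.Icc a b) :
    ∫ x, avg c f x = ∫ x, f x := by
  unfold avg
  rw [integral_intervalIntegral_swap_of_support (R := |a| + |b| + |c| + 1) (by fun_prop)
    fun x s hs1 hs2 => ?_]
  · simp_rw [integral_add_right_eq_self f]
    simp
  · have h1 : |c * s| ≤ |c| := by
      rw [abs_mul, abs_of_nonneg hs1.1]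
      exact mul_le_of_le_one_right (abs_nonneg _) hs1.2
    have h2 := abs_le.1 h1
    have h3 := hs _ hs2
    constructor <;> linarith [h3.1, h3.2, neg_abs_le a, le_abs_self b, abs_nonneg a, abs_nonneg b]

lemma smooth_continuous (hf : Continuous f) : Continuous (smooth δ f) :=
  avg_continuous (avg_continuous hf)

lemma smooth_supp (hδ : |δ| ≤ 1 / 2) (hs : ∀ x, f x ≠ 0 → x ∈ Set.Icc (-1 : ℝ) 2) {x : ℝ}
    (hx : smooth δ f x ≠ 0) : x ∈ Set.Icc (-2 : ℝ) 3 := by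
  have := avg_supp (fun y hy => avg_supp hs hy) hx
  rw [abs_neg] at this
  exact ⟨by linarith [this.1], by linarith [this.2]⟩

lemma integral_smooth (hf : Continuous f) (hs : ∀ x, f x ≠ 0 → x ∈ Set.Icc (-1 : ℝ) 2) :
    ∫ x, smooth δ f x = ∫ x, f x := by
  rw [smooth, integral_avg (avg_continuous hf) fun y hy => avg_supp hs hy, integral_avg hf hs]

/-- Mollification is close to orthogonal projection: the defect is controlled by the energies. -/
lemma integral_sq_sub_smooth_le (hf : IsBump f) (hδ : |δ| ≤ 1 / 2) :
    ∫ x, (f x - smooth δ f x) ^ 2 ≤ (∫ x, f x ^ 2) - ∫ x, smooth δ f x ^ 2 := by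
  have hfc := hf.cont
  have hgc : Continuous (smooth δ f) := smooth_continuous hf.cont
  have hac : Continuous (avg δ f) := avg_continuous hf.cont
  have haS : ∀ x, avg δ f x ≠ 0 → _ := fun x hx => avg_supp (c := δ) hf.supp hx
  have i1 : Integrable fun x => f x ^ 2 := integrable_of_supp (a := -1) (b := 2) (by fun_prop)
    fun x hx => hf.supp x (by aesop)
  have i2 : Integrable fun x => smooth δ f x ^ 2 :=
    integrable_of_supp (a := -2) (b := 3) (by fun_prop)
      fun x hx => smooth_supp hδ hf.supp (by aesop)
  have i3 : Integrable fun x => smooth δ f x * f x :=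
    integrable_of_supp (a := -1) (b := 2) (by fun_prop) fun x hx => hf.supp x (right_ne_zero_of_mul hx)
  have e1 : ∫ x, smooth δ f x * f x = ∫ x, avg δ f x ^ 2 := by
    rw [smooth, integral_avg_mul (R := 3) hac hf.cont fun x hx => ?_]
    · simp only [neg_neg, sq]
    · have := hf.supp x hx
      constructor <;> linarith [this.1, this.2]
  have e2 : ∫ x, smooth δ f x ^ 2 ≤ ∫ x, avg δ f x ^ 2 := by
    have hS : ∀ x, avg δ f x ^ 2 ≠ 0 → _ := fun x hx => haS x (by aesop)
    rw [← integral_avg (c := -δ) (f := fun x => avg δ f x ^ 2) (by fun_prop) hS]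
    exact integral_mono i2 (integrable_of_supp (avg_continuous (by fun_prop))
      fun x hx => avg_supp hS hx) fun x => sq_avg_le hac x
  have e3 : ∀ x, (f x - smooth δ f x) ^ 2 =
      f x ^ 2 - 2 * (smooth δ f x * f x) + smooth δ f x ^ 2 := fun x => by ring
  simp_rw [e3]
  have i4 : Integrable fun x => f x ^ 2 - 2 * (smooth δ f x * f x) := i1.sub (i3.const_mul 2)
  rw [integral_add i4 i2, integral_sub i1 (i3.const_mul 2), integral_const_mul]
  linarith

lemma smooth_eq_dens {H : ℝ → ℝ} (hf : Continuous f) (hH : ∀ x, HasDerivAt H (f x) x)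
    (hδ : δ ≠ 0) (x : ℝ) : smooth δ f x = dens δ H x := by
  have hHc : Continuous H := continuous_iff_continuousAt.2 fun x => (hH x).continuousAt
  have h1 : avg δ f = fun y => δ⁻¹ * (H (y + δ) - H y) := funext fun y => avg_deriv hf hH hδ y
  rw [smooth, h1, avg_const_mul, avg_sub (f := fun y => H (y + δ)) (by fun_prop) hHc, dens,
    ← avg_neg (c := δ) (f := H) x]
  congr 2
  unfold avg
  congr 1
  ext s
  ring_nf

end energy

namespace HolderCDF

variable {C α δ δ' : ℝ} {F : ℝ → ℝ}

lemma abs_smooth_dens_sub_le (h : HolderCDF C α F) (hδ' : 0 < δ') (hδ'1 : δ' ≤ 1) (hδ : 0 < δ)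
    (x : ℝ) : |smooth δ (dens δ' F) x - dens δ F x| ≤ 2 * C * δ' ^ α / δ := by
  have hF := h.continuous
  have hS : Continuous (smooth δ' F) := smooth_continuous hF
  rw [smooth_eq_dens (dens_continuous hF δ') (hasDerivAt_smooth hF hδ'.ne') hδ.ne']
  have e : ∀ c, |avg c (smooth δ' F) x - avg c F x| ≤ C * δ' ^ α := fun c => by
    rw [← avg_sub hS hF, ← sub_zero (avg c _ x)]
    refine _root_.abs_avg_sub_le (hS.sub hF) fun s _ => ?_
    rw [sub_zero]
    exact h.abs_smooth_sub_le hδ' hδ'1 _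
  have e2 : dens δ (smooth δ' F) x - dens δ F x = δ⁻¹ * ((avg δ (smooth δ' F) x - avg δ F x) -
      (avg (-δ) (smooth δ' F) x - avg (-δ) F x)) := by
    simp only [dens]; ring
  rw [e2, abs_mul, abs_of_pos (inv_pos.2 hδ), inv_mul_le_iff₀ hδ]
  have e3 : δ * (2 * C * δ' ^ α / δ) = 2 * (C * δ' ^ α) := by field_simp
  rw [e3]
  linarith [abs_sub (avg δ (smooth δ' F) x - avg δ F x) (avg (-δ) (smooth δ' F) x - avg (-δ) F x),
    e δ, e (-δ)]

lemma dens_energy_le (h : HolderCDF C α F) (hδ : 0 < δ) (hδ1 : δ ≤ 1) {M : ℝ}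
    (hM : ∀ x, dens δ F x ≤ M) : ∫ x, dens δ F x ^ 2 ≤ M := by
  have hb := h.isBump hδ hδ1
  have : ∫ x, dens δ F x ^ 2 ≤ ∫ x, M * dens δ F x :=
    integral_mono (by simpa only [sq] using (hb.mul hb.cont).integrable)
      (hb.integrable.const_mul M) fun x => by
        dsimp only
        rw [sq]
        exact mul_le_mul_of_nonneg_right (hM x) (h.dens_nonneg hδ x)
  rwa [integral_const_mul, h.dens_integral hδ hδ1, mul_one] at this

/-- An energy increment bound for the `L¹` distance between densities at two scales. -/
lemma integral_abs_dens_sub_le (h : HolderCDF C α F) (hδ' : 0 < δ') (hδ'1 : δ' ≤ 1) (hδ : 0 < δ)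
    (hδ1 : δ ≤ 1 / 2) {κ l : ℝ} (hκ : 2 * C * δ' ^ α / δ ≤ κ) (hl : 0 < l) :
    ∫ x, |dens δ' F x - dens δ F x| ≤
      ((∫ x, dens δ' F x ^ 2) - (∫ x, dens δ F x ^ 2) + 2 * κ) / (2 * l) + 5 * l / 2 + 5 * κ := by
  have hb := h.isBump hδ (by linarith)
  have hb' := h.isBump hδ' hδ'1
  have hδa : |δ| ≤ 1 / 2 := by rwa [abs_of_pos hδ]
  have hfc := hb.cont
  have hfc' := hb'.cont
  set f := dens δ F with hf
  set f' := dens δ' F with hf'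
  set g := smooth δ f' with hg
  have hgc : Continuous g := smooth_continuous hb'.cont
  have hgs : ∀ x, g x ≠ 0 → x ∈ Set.Icc (-2 : ℝ) 3 := fun x hx => smooth_supp hδa hb'.supp hx
  have hgf : ∀ x, |g x - f x| ≤ κ := fun x => (h.abs_smooth_dens_sub_le hδ' hδ'1 hδ x).trans hκ
  have wide : Set.Icc (-1 : ℝ) 2 ⊆ Set.Icc (-2 : ℝ) 3 := Set.Icc_subset_Icc (by norm_num) (by norm_num)
  have hg2 : Integrable fun x => g x ^ 2 := integrable_of_supp (by fun_prop)
      fun x hx => hgs x (by aesop)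
  have hgi : Integrable g := integrable_of_supp hgc hgs
  have hf2 : Integrable fun x => f x ^ 2 := by simpa only [sq] using (hb.mul hb.cont).integrable
  have hg0 : ∀ x, 0 ≤ g x := fun x => avg_nonneg fun y => avg_nonneg fun z => h.dens_nonneg hδ' z
  have hf0 : ∀ x, 0 ≤ f x := h.dens_nonneg hδ
  have E1 : (∫ x, f x ^ 2) - 2 * κ ≤ ∫ x, g x ^ 2 := by
    have : ∫ x, (f x ^ 2 - κ * (f x + g x)) ≤ ∫ x, g x ^ 2 :=
      integral_mono (hf2.sub ((hb.integrable.add hgi).const_mul κ)) hg2 fun x => by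
        dsimp only
        nlinarith [mul_le_mul_of_nonneg_right (abs_le.1 (hgf x)).1 (add_nonneg (hf0 x) (hg0 x))]
    have i1 : Integrable fun x => κ * (f x + g x) := (hb.integrable.add hgi).const_mul κ
    rw [integral_sub hf2 i1, integral_const_mul,
      integral_add hb.integrable hgi, h.dens_integral hδ (by linarith), hg,
      integral_smooth hb'.cont hb'.supp, h.dens_integral hδ' hδ'1] at this
    linarith
  have E2 : ∫ x, (f' x - g x) ^ 2 ≤ _ := integral_sq_sub_smooth_le hb' hδa
  have hd2 : Integrable fun x => (f' x - g x) ^ 2 :=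
    integrable_of_supp (a := -2) (b := 3) (by fun_prop) fun x hx => by
      by_contra h'
      have a1 : f' x = 0 := by by_contra h''; exact h' (wide (hb'.supp x h''))
      have a2 : g x = 0 := by by_contra h''; exact h' (hgs x h'')
      simp [a1, a2] at hx
  have E3 : ∫ x, |f' x - f x| = ∫ x in Set.Icc (-2 : ℝ) 3, |f' x - f x| := by
    refine (setIntegral_eq_integral_of_forall_compl_eq_zero fun x hx => ?_).symm
    have a1 : f' x = 0 := by by_contra h''; exact hx (wide (hb'.supp x h''))
    have a2 : f x = 0 := by by_contra h''; exact hx (wide (hb.supp x h''))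
    simp [a1, a2]
  have E4 : ∫ x in Set.Icc (-2 : ℝ) 3, |f' x - f x| ≤
      ∫ x in Set.Icc (-2 : ℝ) 3, ((2 * l)⁻¹ * (f' x - g x) ^ 2 + (l / 2 + κ)) := by
    refine setIntegral_mono (hb'.sub hb).integrable.abs.integrableOn
      ((hd2.const_mul _).integrableOn.add continuous_const.integrableOn_Icc) fun x => ?_
    dsimp only
    have a1 : |f' x - f x| ≤ |f' x - g x| + |g x - f x| := _root_.abs_sub_le _ _ _
    have a2 : |f' x - g x| ≤ (2 * l)⁻¹ * (f' x - g x) ^ 2 + l / 2 := by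
      rw [← sq_abs]
      have e : (2 * l)⁻¹ * |f' x - g x| ^ 2 + l / 2 - |f' x - g x| =
        (2 * l)⁻¹ * (|f' x - g x| - l) ^ 2 := by field_simp; ring
      have : 0 ≤ (2 * l)⁻¹ * (|f' x - g x| - l) ^ 2 := by positivity
      linarith
    linarith [hgf x]
  have E5 : ∫ x in Set.Icc (-2 : ℝ) 3, ((2 * l)⁻¹ * (f' x - g x) ^ 2 + (l / 2 + κ)) ≤
      (2 * l)⁻¹ * (∫ x, (f' x - g x) ^ 2) + 5 * (l / 2 + κ) := by
    rw [integral_add (hd2.const_mul _).integrableOn continuous_const.integrableOn_Icc,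
      integral_const_mul]
    refine add_le_add (mul_le_mul_of_nonneg_left (setIntegral_le_integral hd2
      (Filter.Eventually.of_forall fun x => sq_nonneg _)) (by positivity)) (le_of_eq ?_)
    norm_num
  rw [E3]
  refine (E4.trans E5).trans ?_
  have E6 : (2 * l)⁻¹ * (∫ x, (f' x - g x) ^ 2) ≤
      ((∫ x, f' x ^ 2) - (∫ x, f x ^ 2) + 2 * κ) / (2 * l) := by
    rw [inv_mul_le_iff₀ (by positivity), mul_div_cancel₀ _ (by positivity)]
    linarith
  linarith

end HolderCDF

/-- A compactness argument: approximate configurations yield an exact one. -/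
lemma exists_config_of_approx {P₁ P₂ : ℝ[X]} {E : Set ℝ} (hE : IsClosed E) (hne : E.Nonempty)
    {a b : ℝ} (ha : 0 < a) (h : ∀ s > 0, ∃ x ∈ Set.Icc (-1 : ℝ) 2, ∃ t ∈ Set.Icc a b,
      Metric.infDist x E ≤ s ∧ Metric.infDist (x + P₁.eval t) E ≤ s ∧
      Metric.infDist (x + P₂.eval t) E ≤ s) :
    ∃ x ∈ E, ∃ t : ℝ, 0 < t ∧ x + P₁.eval t ∈ E ∧ x + P₂.eval t ∈ E := by
  have hK : IsCompact (Set.Icc (-1 : ℝ) 2 ×ˢ Set.Icc a b) := isCompact_Icc.prod isCompact_Icc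
  have hKn : (Set.Icc (-1 : ℝ) 2 ×ˢ Set.Icc a b).Nonempty := by
    obtain ⟨x, hx, t, ht, -⟩ := h 1 one_pos
    exact ⟨(x, t), hx, ht⟩
  have hc : Continuous fun p : ℝ × ℝ => Metric.infDist p.1 E +
      Metric.infDist (p.1 + P₁.eval p.2) E + Metric.infDist (p.1 + P₂.eval p.2) E := by
    have h1 : Continuous fun p : ℝ × ℝ => P₁.eval p.2 := P₁.continuous.comp continuous_snd
    have h2 : Continuous fun p : ℝ × ℝ => P₂.eval p.2 := P₂.continuous.comp continuous_snd
    have h3 := Metric.continuous_infDist_pt E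
    exact ((h3.comp continuous_fst).add (h3.comp (continuous_fst.add h1))).add
      (h3.comp (continuous_fst.add h2))
  obtain ⟨⟨x, t⟩, ⟨-, ht⟩, hmin⟩ := hK.exists_isMinOn hKn hc.continuousOn
  have hz : Metric.infDist x E + Metric.infDist (x + P₁.eval t) E +
      Metric.infDist (x + P₂.eval t) E ≤ 0 := by
    refine le_of_forall_pos_le_add fun s hs => ?_
    obtain ⟨y, hy, u, hu, h1, h2, h3⟩ := h (s / 3) (by positivity)
    have := hmin (show (y, u) ∈ _ from ⟨hy, hu⟩)
    simp only [Set.mem_ofPred_eq] at this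
    linarith
  have n1 := Metric.infDist_nonneg (s := E) (x := x)
  have n2 := Metric.infDist_nonneg (s := E) (x := x + P₁.eval t)
  have n3 := Metric.infDist_nonneg (s := E) (x := x + P₂.eval t)
  refine ⟨x, (hE.mem_iff_infDist_zero hne).2 (by linarith), t, ha.trans_le ht.1,
    (hE.mem_iff_infDist_zero hne).2 (by linarith), (hE.mem_iff_infDist_zero hne).2 (by linarith)⟩

namespace HolderCDF

variable {C α δ δ' : ℝ} {F : ℝ → ℝ}

lemma infDist_le (h : HolderCDF C α F) (hδ : 0 < δ) {E : Set ℝ}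
    (hE : ∀ x y, F x < F y → ∃ z ∈ E, z ∈ Set.Icc x y) {x : ℝ} (hx : dens δ F x ≠ 0) :
    Metric.infDist x E ≤ δ := by
  obtain ⟨z, hz, h1, h2⟩ := hE _ _ (h.lt_of_dens_ne_zero hδ hx)
  refine (Metric.infDist_le_dist_of_mem hz).trans ?_
  rw [Real.dist_eq]
  exact abs_le.2 ⟨by linarith, by linarith⟩

/-- The densities count configurations positively at all dyadically smaller scales. -/
lemma triForm_dens_pos (h : HolderCDF C α F) (hδ : 0 < δ) (hδ1 : δ ≤ 1 / 2)
    (hα : 3 * (1 - α) ≤ 1 / 48) {P₁ P₂ : ℝ[X]} {t₀ r A : ℝ} (hA0 : 0 ≤ A)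
    (hA : ∀ N d g g', 1 ≤ N → Oscillating N d → LipBump N g → LipBump N g' →
      |triForm P₁ P₂ t₀ r d g g'| ≤ A * N ^ (-(1 / 24) : ℝ) ∧
      |triForm P₁ P₂ t₀ r g d g'| ≤ A * N ^ (-(1 / 24) : ℝ) ∧
      |triForm P₁ P₂ t₀ r g g' d| ≤ A * N ^ (-(1 / 24) : ℝ))
    (hpos : 1536 * C ^ 3 * A * δ ^ (1 / 48 : ℝ) / (1 - (1 / 2) ^ (1 / 48 : ℝ)) <
      triForm P₁ P₂ t₀ r (dens δ F) (dens δ F) (dens δ F)) (j : ℕ) :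
    0 < triForm P₁ P₂ t₀ r (dens (δ * (1 / 2) ^ j) F) (dens (δ * (1 / 2) ^ j) F)
      (dens (δ * (1 / 2) ^ j) F) := by
  set T : ℝ → ℝ := fun δ => triForm P₁ P₂ t₀ r (dens δ F) (dens δ F) (dens δ F) with hT
  have hC := h.const_pos
  have hq0 : (0 : ℝ) ≤ (1 / 2) ^ (1 / 48 : ℝ) := by positivity
  have hq1 : (1 / 2 : ℝ) ^ (1 / 48 : ℝ) < 1 :=
    Real.rpow_lt_one (by norm_num) (by norm_num) (by norm_num)
  set q : ℝ := (1 / 2) ^ (1 / 48 : ℝ) with hq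
  set A' : ℝ := 1536 * C ^ 3 * A with hA'
  have hA'0 : 0 ≤ A' := by positivity
  have hδp : 0 < δ ^ (1 / 48 : ℝ) := by positivity
  set S := A' * δ ^ (1 / 48 : ℝ) / (1 - q) with hS
  have hS0 : 0 ≤ S := div_nonneg (by positivity) (by linarith)
  have hSq : S * (1 - q) = A' * δ ^ (1 / 48 : ℝ) := div_mul_cancel₀ _ (by linarith)
  have key : ∀ j : ℕ, T δ - S * (1 - q ^ j) ≤ T (δ * (1 / 2) ^ j) := fun j => by
    induction j with
    | zero => simp
    | succ j ih =>
      have hd : 0 < δ * (1 / 2) ^ (j + 1) := by positivity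
      have hd1 : δ * (1 / 2) ^ (j + 1) ≤ 1 / 2 := by
        have : (1 / 2 : ℝ) ^ (j + 1) ≤ 1 := pow_le_one₀ (by norm_num) (by norm_num)
        nlinarith
      have h1 := h.abs_triForm_dens_sub_le hd hd1 hα hA0 hA
      have e1 : 2 * (δ * (1 / 2) ^ (j + 1)) = δ * (1 / 2) ^ j := by ring
      have e2 : (δ * (1 / 2) ^ (j + 1)) ^ (1 / 48 : ℝ) = δ ^ (1 / 48 : ℝ) * q ^ (j + 1) := by
        rw [Real.mul_rpow hδ.le (by positivity), hq, ← Real.rpow_natCast, ← Real.rpow_natCast,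
          ← Real.rpow_mul (by norm_num), ← Real.rpow_mul (by norm_num), mul_comm (1 / 48 : ℝ)]
      rw [e1, e2] at h1
      change |T _ - T _| ≤ A' * _ at h1
      have h2 : A' * (δ ^ (1 / 48 : ℝ) * q ^ (j + 1)) ≤ S * (1 - q) * q ^ j := by
        rw [hSq, ← mul_assoc]
        exact mul_le_mul_of_nonneg_left (pow_le_pow_of_le_one hq0 hq1.le (Nat.le_succ j))
          (by positivity)
      have e3 : S * (1 - q ^ (j + 1)) = S * (1 - q ^ j) + S * (1 - q) * q ^ j := by ring
      rw [e3]
      linarith [(abs_le.1 h1).1]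
  have h1 : 0 ≤ S * q ^ j := by positivity
  have h2 := key j
  change 0 < T _
  change S < T δ at hpos
  linarith

end HolderCDF

/-- Given a scale `δ`, there is a smaller scale `δ'` such that either the energy increases by a
fixed amount between the two scales, or a configuration exists. -/
lemma exists_scale {P₁ P₂ : ℝ[X]} (hI : DerivIndep P₁ P₂) (h01 : P₁.eval 0 = 0)
    (h02 : P₂.eval 0 = 0) {C : ℝ} (hC : 0 < C) :
    ∃ ε > 0, ∀ δ : ℝ, 0 < δ → δ ≤ 1 / 4 → ∃ δ', 0 < δ' ∧ δ' ≤ δ ∧ ∀ α F, HolderCDF C α F →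
      3 * (1 - α) ≤ 1 / 48 → δ' ^ (α - 1) ≤ 2 →
      (∫ x, dens δ' F x ^ 2) - (∫ x, dens δ F x ^ 2) ≤ ε → ∀ E : Set ℝ, IsClosed E → E.Nonempty →
      (∀ x y, F x < F y → ∃ z ∈ E, z ∈ Set.Icc x y) →
      ∃ x ∈ E, ∃ t : ℝ, 0 < t ∧ x + P₁.eval t ∈ E ∧ x + P₂.eval t ∈ E := by
  set M : ℝ := 4 * C with hM
  have hM0 : 0 < M := by positivity
  set τ : ℝ := 1 / (108 * M ^ 2) with hτ
  have hτ0 : 0 < τ := by positivity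
  refine ⟨τ ^ 2 / 20, by positivity, fun δ hδ hδ1 => ?_⟩
  set η' : ℝ := 1 / (72 * M * (M / δ)) with hη'
  have hη'0 : 0 < η' := by positivity
  obtain ⟨η, hη, hη1⟩ : ∃ η > 0, ∀ t : ℝ, |t| < η → |P₁.eval t| ≤ η' ∧ |P₂.eval t| ≤ η' := by
    have h1 : ∀ P : ℝ[X], P.eval 0 = 0 → ∀ᶠ t in nhds (0 : ℝ), |P.eval t| ≤ η' := fun P hP => by
      have : Filter.Tendsto (fun t => |P.eval t|) (nhds 0) (nhds 0) := by
        have := (P.continuous.abs).tendsto 0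
        simpa [hP] using this
      exact (this.eventually_lt_const hη'0).mono fun _ h => h.le
    obtain ⟨η, hη, h⟩ := Metric.eventually_nhds_iff.1 ((h1 P₁ h01).and (h1 P₂ h02))
    exact ⟨η, hη, fun t ht => h (by simpa using ht)⟩
  obtain ⟨t₀, r, A, hr, hrt, htη, hA0, hA⟩ := exists_triForm_bound_unit hI hη
  have hb := bump_integral_pos (t₀ := t₀) hr
  set b := ∫ t, bump t₀ r t with hbdef
  have hq1 : (1 / 2 : ℝ) ^ (1 / 48 : ℝ) < 1 :=
    Real.rpow_lt_one (by norm_num) (by norm_num) (by norm_num)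
  set q : ℝ := (1 / 2) ^ (1 / 48 : ℝ) with hq
  set κ : ℝ := min (τ ^ 2 / 40) (τ / 20) with hκ
  have hκ0 : 0 < κ := by positivity
  obtain ⟨δ', hδ'0, hδ'δ, hδ'κ, hδ'S⟩ : ∃ δ', 0 < δ' ∧ δ' ≤ δ ∧ 4 * C * δ' / δ ≤ κ ∧
      1536 * C ^ 3 * A * δ' ^ (1 / 48 : ℝ) / (1 - q) < b / 18 := by
    have t1 : Filter.Tendsto (fun d : ℝ => 4 * C * d / δ) (nhdsWithin 0 (Set.Ioi 0)) (nhds 0) := by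
      have : Continuous fun d : ℝ => 4 * C * d / δ := by fun_prop
      simpa using (this.tendsto 0).mono_left nhdsWithin_le_nhds
    have t2 : Filter.Tendsto (fun d : ℝ => 1536 * C ^ 3 * A * d ^ (1 / 48 : ℝ) / (1 - q))
        (nhdsWithin 0 (Set.Ioi 0)) (nhds 0) := by
      have : ContinuousAt (fun d : ℝ => 1536 * C ^ 3 * A * d ^ (1 / 48 : ℝ) / (1 - q)) 0 :=
        (continuousAt_const.mul (continuousAt_id.rpow_const (Or.inr (by norm_num)))).div_const _
      have := this.tendsto.mono_left (nhdsWithin_le_nhds (s := Set.Ioi 0))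
      simpa [Real.zero_rpow] using this
    have := (self_mem_nhdsWithin (a := (0 : ℝ)) (s := Set.Ioi 0))
    obtain ⟨d, ⟨⟨h1, h2⟩, h3⟩, h4⟩ := (((Filter.eventually_mem_set.2 this).and
      ((Filter.tendsto_id.mono_left nhdsWithin_le_nhds).eventually_lt_const hδ)).and
      (t1.eventually_lt_const hκ0)).and
      (t2.eventually_lt_const (show 0 < b / 18 by positivity)) |>.exists
    exact ⟨d, h1, h2.le, h3.le, h4⟩
  refine ⟨δ', hδ'0, hδ'δ, fun α F h hα hδα he E hE hne hEF => ?_⟩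
  have hδα2 : δ ^ (α - 1) ≤ 2 :=
    (Real.rpow_le_rpow_of_nonpos hδ'0 hδ'δ (by linarith [h.exp_le_one])).trans hδα
  have bd : ∀ x, dens δ F x ≤ M := fun x => (h.dens_le hδ (by linarith) x).trans (by
    rw [hM]; nlinarith)
  have bd' : ∀ x, dens δ' F x ≤ M := fun x => (h.dens_le hδ'0 (by linarith) x).trans (by
    rw [hM]; nlinarith)
  have hf := h.isBump hδ (by linarith)
  have hf' := h.isBump hδ'0 (by linarith)
  have lip : ∀ x y, |dens δ F x - dens δ F y| ≤ M / δ * |x - y| := fun x y =>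
    (h.dens_lip hδ (by linarith) x y).trans (by
      gcongr
      rw [hM]; nlinarith)
  have L1 : 1 / 12 * b ≤ triForm P₁ P₂ t₀ r (dens δ F) (dens δ F) (dens δ F) := by
    refine le_triForm hf hf.cont hf.cont fun t ht => ?_
    obtain ⟨p1, p2⟩ := hη1 t (by rw [abs_of_pos (by linarith [ht.1])]; linarith [ht.2])
    refine le_trans (le_of_eq ?_) (le_integral_mul_translates hf (h.dens_nonneg hδ) bd lip
      (h.dens_integral hδ (by linarith)) p1 p2 (by positivity))
    rw [hη']
    field_simp
    norm_num
  have D : ∫ x, |dens δ' F x - dens δ F x| ≤ τ := by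
    refine (h.integral_abs_dens_sub_le hδ'0 (by linarith) hδ (by linarith) (κ := κ) (l := τ / 10)
      ?_ (by positivity)).trans ?_
    · refine le_trans ?_ hδ'κ
      have : δ' ^ α = δ' ^ (α - 1) * δ' := by
        rw [Real.rpow_sub_one hδ'0.ne']; field_simp
      rw [this]
      refine div_le_div_of_nonneg_right ?_ hδ.le
      have k := mul_le_mul_of_nonneg_left (mul_le_mul_of_nonneg_right hδα hδ'0.le)
        (by positivity : 0 ≤ 2 * C)
      linarith
    · have k1 : κ ≤ τ ^ 2 / 40 := min_le_left _ _
      have k2 : κ ≤ τ / 20 := min_le_right _ _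
      have k3 : ((∫ x, dens δ' F x ^ 2) - (∫ x, dens δ F x ^ 2) + 2 * κ) / (2 * (τ / 10)) ≤
          τ / 2 := by
        rw [div_le_iff₀ (by positivity)]
        nlinarith
      linarith
  have L2 : 1 / 18 * b ≤ triForm P₁ P₂ t₀ r (dens δ' F) (dens δ' F) (dens δ' F) := by
    have := abs_triForm_diag_sub_le (P₁ := P₁) (P₂ := P₂) (t₀ := t₀) (r := r) (M := M) hf' hf
      (fun x => by rw [abs_of_nonneg (h.dens_nonneg hδ'0 x)]; exact bd' x)
      (fun x => by rw [abs_of_nonneg (h.dens_nonneg hδ x)]; exact bd x)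
    have e : 3 * (M ^ 2 * ∫ x, |dens δ' F x - dens δ F x|) * b ≤ 1 / 36 * b := by
      refine mul_le_mul_of_nonneg_right ?_ hb.le
      have : M ^ 2 * (∫ x, |dens δ' F x - dens δ F x|) ≤ M ^ 2 * τ :=
        mul_le_mul_of_nonneg_left D (by positivity)
      have e2 : M ^ 2 * τ = 1 / 108 := by rw [hτ]; field_simp
      linarith
    linarith [(abs_le.1 this).1]
  have pos := h.triForm_dens_pos hδ'0 (by linarith) hα hA0 hA
    (hδ'S.trans_le (by linarith))
  refine exists_config_of_approx hE hne (a := t₀ - r) (b := t₀ + r) (by linarith) fun s hs => ?_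
  obtain ⟨j, hj⟩ := exists_pow_lt_of_lt_one (show 0 < s by exact hs) (show (1 / 2 : ℝ) < 1 by norm_num)
  have hj0 : 0 < δ' * (1 / 2) ^ j := by positivity
  have hj1 : δ' * (1 / 2) ^ j ≤ s :=
    (mul_le_of_le_one_left (by positivity) (by linarith)).trans hj.le
  have hj2 : δ' * (1 / 2) ^ j ≤ 1 :=
    (mul_le_of_le_one_right hδ'0.le (pow_le_one₀ (by norm_num) (by norm_num))).trans (by linarith)
  obtain ⟨t, ht, x, h1, h2, h3⟩ := exists_of_triForm_pos (pos j)
  exact ⟨x, h.dens_supp hj0 hj2 h1, t, Set.Ioo_subset_Icc_self ht,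
    (h.infDist_le hj0 hEF h1).trans hj1, (h.infDist_le hj0 hEF h2).trans hj1,
    (h.infDist_le hj0 hEF h3).trans hj1⟩

lemma exists_config_of_holderCDF {P₁ P₂ : ℝ[X]} (hI : DerivIndep P₁ P₂) (h01 : P₁.eval 0 = 0)
    (h02 : P₂.eval 0 = 0) {C : ℝ} (hC : 0 < C) :
    ∃ ε₀ > 0, ∀ α F, HolderCDF C α F → 1 - ε₀ < α → ∀ E : Set ℝ, IsClosed E → E.Nonempty →
      (∀ x y, F x < F y → ∃ z ∈ E, z ∈ Set.Icc x y) →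
      ∃ x ∈ E, ∃ t : ℝ, 0 < t ∧ x + P₁.eval t ∈ E ∧ x + P₂.eval t ∈ E := by
  obtain ⟨ε, hε, hstep⟩ := exists_scale hI h01 h02 hC
  choose! Ψ hΨ0 hΨ hΨE using hstep
  set d : ℕ → ℝ := fun i => Ψ^[i] (1 / 4) with hd
  have hsucc : ∀ i, d (i + 1) = Ψ (d i) := fun i => Function.iterate_succ_apply' Ψ i _
  have hd0 : ∀ i, 0 < d i ∧ d i ≤ 1 / 4 := fun i => by
    induction i with
    | zero => simp [hd]
    | succ i ih =>
      rw [hsucc]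
      exact ⟨hΨ0 _ ih.1 ih.2, (hΨ _ ih.1 ih.2).trans ih.2⟩
  have hanti : Antitone d := antitone_nat_of_succ_le fun i => by
    rw [hsucc]; exact hΨ _ (hd0 i).1 (hd0 i).2
  obtain ⟨K, hK⟩ := exists_nat_gt (4 * C / ε)
  rw [div_lt_iff₀ hε] at hK
  obtain ⟨ε₀, hε₀, hε₀1, hε₀2⟩ : ∃ ε₀ : ℝ, 0 < ε₀ ∧ ε₀ ≤ 1 / 144 ∧ d K ^ (-ε₀) ≤ 2 := by
    have t : Filter.Tendsto (fun s : ℝ => d K ^ (-s)) (nhdsWithin 0 (Set.Ioi 0)) (nhds 1) := by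
      have : ContinuousAt (fun s : ℝ => d K ^ (-s)) 0 :=
        continuousAt_const.rpow continuousAt_neg (Or.inl (hd0 K).1.ne')
      simpa using this.tendsto.mono_left (nhdsWithin_le_nhds (s := Set.Ioi 0))
    obtain ⟨s, ⟨h1, h2⟩, h3⟩ := ((Filter.eventually_mem_set.2
      (self_mem_nhdsWithin (a := (0 : ℝ)) (s := Set.Ioi 0))).and
      ((Filter.tendsto_id.mono_left nhdsWithin_le_nhds).eventually_lt_const
        (show (0 : ℝ) < 1 / 144 by norm_num))).and (t.eventually_lt_const one_lt_two) |>.exists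
    exact ⟨s, h1, h2.le, h3.le⟩
  refine ⟨ε₀, hε₀, fun α F h hα E hE hne hEF => ?_⟩
  have hdα : ∀ i ≤ K, d i ^ (α - 1) ≤ 2 := fun i hi =>
    ((Real.rpow_le_rpow_of_nonpos (hd0 K).1 (hanti hi) (by linarith [h.exp_le_one])).trans
      (Real.rpow_le_rpow_of_exponent_ge (hd0 K).1 (by linarith [(hd0 K).2]) (by linarith))).trans
      hε₀2
  by_contra hcon
  have hinc : ∀ i < K, (∫ x, dens (d i) F x ^ 2) + ε ≤ ∫ x, dens (d (i + 1)) F x ^ 2 :=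
    fun i hi => by
      by_contra! hlt
      refine hcon (hΨE _ (hd0 i).1 (hd0 i).2 α F h (by linarith) ?_ ?_ E hE hne hEF)
      · rw [← hsucc]; exact hdα _ hi
      · rw [← hsucc]; linarith
  have hsum : ∀ i ≤ K, i * ε ≤ ∫ x, dens (d i) F x ^ 2 := fun i => by
    induction i with
    | zero =>
      intro _
      simpa using integral_nonneg fun x => sq_nonneg (dens (d 0) F x)
    | succ i ih =>
      intro hi
      have := hinc i hi
      have := ih (by omega)
      push_cast
      linarith
  have hle := h.dens_energy_le (hd0 K).1 (by linarith [(hd0 K).2]) (M := 4 * C) fun x =>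
    (h.dens_le (hd0 K).1 (by linarith [(hd0 K).2]) x).trans (by nlinarith [hdα K le_rfl])
  linarith [hsum K le_rfl]

section cdf

variable {μ : Measure ℝ} {E : Set ℝ}

lemma exists_mem_of_measure_Iic_lt [IsProbabilityMeasure μ] (hE : IsClosed E) (hμE : μ E = 1)
    {x y : ℝ} (h : (μ (Set.Iic x)).toReal < (μ (Set.Iic y)).toReal) :
    ∃ z ∈ E, z ∈ Set.Icc x y := by
  by_contra! hz
  have h0 : μ Eᶜ = 0 := (prob_compl_eq_zero_iff hE.measurableSet).2 hμE
  refine h.not_ge (ENNReal.toReal_mono (measure_ne_top _ _) ?_)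
  calc μ (Set.Iic y) ≤ μ (Set.Iic x ∪ Eᶜ) := measure_mono fun z hzy => by
        by_cases hx : z ≤ x
        · exact Or.inl hx
        · exact Or.inr fun hzE => hz z hzE ⟨(not_le.1 hx).le, hzy⟩
    _ ≤ μ (Set.Iic x) + μ Eᶜ := measure_union_le _ _
    _ = μ (Set.Iic x) := by rw [h0, add_zero]

lemma holderCDF_of_measure [IsProbabilityMeasure μ] (hE : IsClosed E) (hE1 : E ⊆ Set.Icc 0 1)
    (hμE : μ E = 1) {C α : ℝ} (hC : 0 < C) (hα : 0 < α) (hα1 : α ≤ 1)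
    (hA : ∀ x ε : ℝ, 0 < ε → ε ≤ 1 → (μ (Set.Icc x (x + ε))).toReal ≤ C * ε ^ α) :
    HolderCDF C α fun x => (μ (Set.Iic x)).toReal := by
  have mono : Monotone fun x => (μ (Set.Iic x)).toReal := fun x y hxy =>
    ENNReal.toReal_mono (measure_ne_top _ _) (measure_mono (Set.Iic_subset_Iic.2 hxy))
  have h0 : μ Eᶜ = 0 := (prob_compl_eq_zero_iff hE.measurableSet).2 hμE
  have hlt : ∀ x y, x < y → y ≤ x + 1 →
      (μ (Set.Iic y)).toReal - (μ (Set.Iic x)).toReal ≤ C * (y - x) ^ α := fun x y hxy hy => by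
    have h1 := hA x (y - x) (by linarith) (by linarith)
    rw [add_sub_cancel] at h1
    have h2 : μ (Set.Iic y) ≤ μ (Set.Iic x) + μ (Set.Icc x y) :=
      (measure_mono fun z hz => by
        by_cases hx : z ≤ x
        · exact Or.inl hx
        · exact Or.inr ⟨(not_le.1 hx).le, hz⟩).trans (measure_union_le _ _)
    have h3 := ENNReal.toReal_mono (by finiteness) h2
    rw [ENNReal.toReal_add (by finiteness) (by finiteness)] at h3
    linarith
  have hneg : ∀ x < 0, (μ (Set.Iic x)).toReal = 0 := fun x hx => by
    rw [measure_mono_null (fun z hz => ?_) h0, ENNReal.toReal_zero]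
    intro hzE
    exact absurd ((hE1 hzE).1.trans hz) (not_le.2 hx)
  refine
    { const_pos := hC
      exp_pos := hα
      exp_le_one := hα1
      mono := mono
      zero := fun x hx => le_antisymm ((mono hx).trans ?_) ENNReal.toReal_nonneg
      one := fun x hx => ?_
      holder := fun x y hxy => ?_ }
  · have t : Filter.Tendsto (fun s : ℝ => C * s ^ α) (nhdsWithin 0 (Set.Ioi 0)) (nhds 0) := by
      have : ContinuousAt (fun s : ℝ => C * s ^ α) 0 :=
        continuousAt_const.mul (continuousAt_id.rpow_const (Or.inr hα.le))
      simpa [Real.zero_rpow hα.ne'] using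
        this.tendsto.mono_left (nhdsWithin_le_nhds (s := Set.Ioi 0))
    refine ge_of_tendsto t ?_
    filter_upwards [self_mem_nhdsWithin, nhdsWithin_le_nhds (Iio_mem_nhds one_pos)] with s hs hs1
    have hs0 : 0 < s := hs
    have hs2 : s < 1 := hs1
    have := hlt (-s) 0 (by linarith) (by linarith)
    rw [hneg (-s) (by linarith)] at this
    simpa using this
  · have : μ (Set.Iic x) = 1 := le_antisymm prob_le_one
      (hμE ▸ measure_mono fun z hz => (hE1 hz).2.trans hx)
    rw [this, ENNReal.toReal_one]
  · rcases lt_trichotomy x y with h | rfl | h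
    · rw [abs_sub_comm, abs_of_nonneg (sub_nonneg.2 (mono h.le)), abs_sub_comm,
        abs_of_pos (sub_pos.2 h)]
      exact hlt x y h (by linarith [(abs_le.1 hxy).1])
    · simp [Real.zero_rpow hα.ne']
    · rw [abs_of_nonneg (sub_nonneg.2 (mono h.le)), abs_of_pos (sub_pos.2 h)]
      exact hlt y x h (by linarith [(abs_le.1 hxy).2])

end cdf

/-- Theorem 2 of the paper.  Let `P₁, P₂` be linearly independent
polynomials with `P₁(0) = P₂(0) = 0`, and fix `C₁, C₂, B > 0` and `8/9 < β ≤ 1`.  Then there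
is `ε₀ > 0`, depending only on these data, such that whenever `0 < α < 1`, `α > 1 − ε₀`, and
`E ⊆ [0,1]` is closed and supports a probability measure `μ` with the dimensionality bound
(A) `μ([x, x+ε]) ≤ C₁ ε^α` and the Fourier decay bound
(B) `|μ̂(k)| ≤ C₂ (1−α)^{−B} |k|^{−β/2}` for `k ≠ 0`,
then `E` contains a triplet `x, x + P₁(t), x + P₂(t)` with `t > 0`. -/
theorem stmt1 (P₁ P₂ : Polynomial ℝ)
    (hind : ∀ a b : ℝ, a • P₁ + b • P₂ = 0 → a = 0 ∧ b = 0)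
    (h01 : P₁.eval 0 = 0) (h02 : P₂.eval 0 = 0)
    (C₁ C₂ B β : ℝ) (hC₁ : 0 < C₁) (hC₂ : 0 < C₂) (hB : 0 < B)
    (hβl : 8 / 9 < β) (hβu : β ≤ 1) :
    ∃ ε₀ : ℝ, 0 < ε₀ ∧
      ∀ α : ℝ, 0 < α → α < 1 → 1 - ε₀ < α →
      ∀ E : Set ℝ, IsClosed E → E ⊆ Set.Icc 0 1 →
      ∀ μ : Measure ℝ, IsProbabilityMeasure μ → μ E = 1 →
        (∀ x ε : ℝ, 0 < ε → ε ≤ 1 →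
          (μ (Set.Icc x (x + ε))).toReal ≤ C₁ * ε ^ α) →
        (∀ k : ℤ, k ≠ 0 →
          ‖∫ x : ℝ, Complex.exp (-(2 * Real.pi * Complex.I * (k : ℂ) * (x : ℂ))) ∂μ‖ ≤
            C₂ * (1 - α) ^ (-B) * |(k : ℝ)| ^ (-β / 2)) →
        ∃ x ∈ E, ∃ t : ℝ, 0 < t ∧ x + P₁.eval t ∈ E ∧ x + P₂.eval t ∈ E := by
  obtain ⟨ε₀, hε₀, H⟩ := exists_config_of_holderCDF (derivIndep_of_linearIndep hind h01 h02)
    h01 h02 hC₁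
  refine ⟨ε₀, hε₀, fun α hα hα1 hαε E hE hE1 μ hμ hμE hA _ => ?_⟩
  have hne : E.Nonempty := by
    rw [Set.nonempty_iff_ne_empty]
    rintro rfl
    simp at hμE
  exact H α _ (holderCDF_of_measure hE hE1 hμE hC₁ hα hα1.le hA) hαε E hE hne fun x y hxy =>
    exists_mem_of_measure_Iic_lt hE hμE hxy
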